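/- arXiv:1511.04004 — 2 statements merged into one kernel-verified Lean document; each statement's English description precedes it below -/
import Mathlib

section
/- For every integer n ≥ 13, r_4(2 + 2^(2^(n-12))) = 8·σ(2 + 2^(2^(n-12))), where σ denotes the sum-of-positive-divisors function; consequently the system B_n has exactly 1 + 8·σ(2 + 2^(2^(n-12))) solutions in integers x_1, …, x_n. -/
/-- `r4 m` is the number of representations of `m` as a sum of four squares of integers. -/
noncomputable def r4 (m : ℕ) : ℕ := {a : Fin 4 → ℤ | ∑ i, (a i) ^ 2 = (m : ℤ)}.ncard

/-- `sigma' m` is the sum of the positive divisors of `m`. -/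
def sigma' (m : ℕ) : ℕ := ∑ d ∈ m.divisors, d

/-- The system `B_n` of Browkin, in the unknowns `x 1, …, x n`. -/
def BSys (n : ℕ) (x : ℕ → ℤ) : Prop :=
  (∀ i, 1 ≤ i → i ≤ n - 13 → x i * x i = x (i + 1)) ∧
  x (n - 11) + x (n - 11) = x 1 ∧
  x (n - 11) * x (n - 11) = x 1 ∧
  x (n - 10) * x (n - 10) = x (n - 9) ∧
  x (n - 8) * x (n - 8) = x (n - 7) ∧
  x (n - 6) * x (n - 6) = x (n - 5) ∧
  x (n - 4) * x (n - 4) = x (n - 3) ∧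
  x (n - 9) + x (n - 7) = x (n - 2) ∧
  x (n - 5) + x (n - 3) = x (n - 1) ∧
  x (n - 2) + x (n - 1) = x n ∧
  x (n - 11) + x (n - 12) = x n

/-- Integer solutions of `B_n`, encoded as functions `ℕ → ℤ` vanishing outside `{1, …, n}`
(so that this set is in natural bijection with the set of solution tuples in `ℤ^n`). -/
def BSet (n : ℕ) : Set (ℕ → ℤ) :=
  {x | (∀ i, i = 0 ∨ n < i → x i = 0) ∧ BSys n x}

/-- The integer vectors of length `k` whose squares sum to `M`. -/
noncomputable def sqReps (k : ℕ) (M : ℤ) : Finset (Fin k → ℤ) :=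
  {x ∈ Fintype.piFinset fun _ : Fin k => Finset.Icc (-M) M | ∑ i, x i ^ 2 = M}

lemma mem_Icc_neg_of_sq_le {a M : ℤ} (h : a ^ 2 ≤ M) : a ∈ Finset.Icc (-M) M :=
  Finset.mem_Icc.2 (abs_le.1 (Int.abs_eq_natAbs a ▸ (Int.natAbs_le_self_sq a).trans h))

lemma mem_sqReps {k : ℕ} {M : ℤ} {x : Fin k → ℤ} : x ∈ sqReps k M ↔ ∑ i, x i ^ 2 = M := by
  simp only [sqReps, Finset.mem_filter, Fintype.mem_piFinset, and_iff_right_iff_imp]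
  intro h i
  refine mem_Icc_neg_of_sq_le (h ▸ ?_)
  exact Finset.single_le_sum (f := fun i => x i ^ 2) (fun j _ => sq_nonneg (x j))
    (Finset.mem_univ i)

/-- The vectors of odd integers of length `k` whose squares sum to `M`. -/
noncomputable def oddSqReps (k : ℕ) (M : ℤ) : Finset (Fin k → ℤ) :=
  {x ∈ sqReps k M | ∀ i, Odd (x i)}

lemma mem_oddSqReps {k : ℕ} {M : ℤ} {x : Fin k → ℤ} :
    x ∈ oddSqReps k M ↔ ∑ i, x i ^ 2 = M ∧ ∀ i, Odd (x i) := by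
  simp [oddSqReps, mem_sqReps]

/-- The odd integers in `[-m, m]`. -/
noncomputable def oddIcc (m : ℤ) : Finset ℤ := {h ∈ Finset.Icc (-m) m | Odd h}

lemma sum_oddSqReps_sq (k : ℕ) (m : ℤ) (i : Fin (k + 1)) :
    ∑ x ∈ oddSqReps (k + 1) m, x i ^ 2 = ∑ x ∈ oddSqReps (k + 1) m, x 0 ^ 2 := by
  have key : ∀ x ∈ oddSqReps (k + 1) m, x ∘ Equiv.swap 0 i ∈ oddSqReps (k + 1) m := by
    intro x hx
    rw [mem_oddSqReps] at hx ⊢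
    refine ⟨?_, fun j => hx.2 _⟩
    rw [← hx.1]
    exact Equiv.sum_comp (Equiv.swap 0 i) fun j => x j ^ 2
  refine Finset.sum_nbij' (fun x => x ∘ Equiv.swap 0 i) (fun x => x ∘ Equiv.swap 0 i)
    key key ?_ ?_ ?_
  · intro x _; ext j; simp
  · intro x _; ext j; simp
  · intro x _; simp

/-- The recurrence satisfied by the number of representations as a sum of `k` odd squares. -/
lemma sum_mul_card_oddSqReps (k : ℕ) (m : ℤ) :
    ∑ h ∈ oddIcc m, (m - (k + 1) * h ^ 2) * ((oddSqReps k (m - h ^ 2)).card : ℤ) = 0 := by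
  have h1 : ∑ x ∈ oddSqReps (k + 1) m, (m - (k + 1) * x 0 ^ 2) = 0 := by
    have h2 : ∑ x ∈ oddSqReps (k + 1) m, m =
        ∑ x ∈ oddSqReps (k + 1) m, ∑ i, x i ^ 2 :=
      Finset.sum_congr rfl fun x hx => ((mem_oddSqReps.1 hx).1).symm
    rw [Finset.sum_sub_distrib, h2, Finset.sum_comm, ← Finset.mul_sum,
      Finset.sum_congr rfl fun i _ => sum_oddSqReps_sq k m i]
    simp
  rw [← h1]
  have h3 : ∀ h ∈ oddIcc m, (m - (k + 1) * h ^ 2) * ((oddSqReps k (m - h ^ 2)).card : ℤ) =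
      ∑ x ∈ oddSqReps k (m - h ^ 2), (m - (k + 1) * h ^ 2) := by
    intro h _
    rw [Finset.sum_const, nsmul_eq_mul, mul_comm]
  rw [Finset.sum_congr rfl h3, Finset.sum_sigma']
  refine Finset.sum_bij' (fun p _ => Fin.cons p.1 p.2) (fun x _ => ⟨x 0, Fin.tail x⟩)
    ?_ ?_ ?_ ?_ ?_
  · rintro ⟨h, x⟩ hp
    simp only [Finset.mem_sigma, oddIcc, Finset.mem_filter, mem_oddSqReps] at hp
    simp only [mem_oddSqReps, Fin.sum_univ_succ, Fin.forall_fin_succ, Fin.cons_zero, Fin.cons_succ]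
    exact ⟨by linarith [hp.2.1], hp.1.2, hp.2.2⟩
  · intro x hx
    simp only [mem_oddSqReps, Fin.sum_univ_succ, Fin.forall_fin_succ] at hx
    simp only [Finset.mem_sigma, oddIcc, Finset.mem_filter, mem_oddSqReps, Fin.tail]
    refine ⟨⟨mem_Icc_neg_of_sq_le ?_, hx.2.1⟩, by linarith [hx.1], hx.2.2⟩
    have : 0 ≤ ∑ i : Fin k, x i.succ ^ 2 := Finset.sum_nonneg fun i _ => sq_nonneg _
    linarith [hx.1]
  · rintro ⟨h, x⟩ _
    simp
  · intro x _
    simp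
  · rintro ⟨h, x⟩ _
    simp

/-- The triples `(a, b, c)` with `a, c > 0` and `b ^ 2 + 4 * a * c = m`, i.e. the binary quadratic
forms `[a, b, -c]` of discriminant `m`. -/
noncomputable def indefForms (m : ℤ) : Finset (ℤ × ℤ × ℤ) :=
  {p ∈ Finset.Icc 1 m ×ˢ Finset.Icc (-m) m ×ˢ Finset.Icc 1 m | p.2.1 ^ 2 + 4 * p.1 * p.2.2 = m}

lemma mem_indefForms {m a b c : ℤ} :
    (a, b, c) ∈ indefForms m ↔ 0 < a ∧ 0 < c ∧ b ^ 2 + 4 * a * c = m := by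
  simp only [indefForms, Finset.mem_filter, Finset.mem_product]
  constructor
  · rintro ⟨⟨h1, -, h3⟩, h⟩
    rw [Finset.mem_Icc] at h1 h3
    exact ⟨by omega, by omega, h⟩
  · rintro ⟨h1, h2, h⟩
    have h4 : a * 1 ≤ a * c := by gcongr; omega
    have h5 : 1 * c ≤ a * c := by gcongr; omega
    refine ⟨⟨Finset.mem_Icc.2 ⟨by omega, by nlinarith [sq_nonneg b]⟩, mem_Icc_neg_of_sq_le ?_,
      Finset.mem_Icc.2 ⟨by omega, by nlinarith [sq_nonneg b]⟩⟩, h⟩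
    nlinarith

lemma sq_emod_eight_of_odd {h : ℤ} (ho : Odd h) : h ^ 2 % 8 = 1 := by
  obtain ⟨t, rfl⟩ := ho
  obtain ⟨s, hs⟩ := Int.even_mul_succ_self t
  have : (2 * t + 1) ^ 2 = 4 * (t * (t + 1)) + 1 := by ring
  omega

lemma odd_of_discrim {m a b c : ℤ} (hm : m % 8 = 5) (h : b ^ 2 + 4 * a * c = m) :
    Odd a ∧ Odd b ∧ Odd c := by
  have hb : Odd b := by
    by_contra hb
    obtain ⟨t, rfl⟩ := Int.not_odd_iff_even.1 hb
    have : (t + t) ^ 2 + 4 * a * c = 4 * (t ^ 2 + a * c) := by ring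
    omega
  have hac : Odd (a * c) := by
    have := sq_emod_eight_of_odd hb
    rw [mul_assoc] at h
    rw [Int.odd_iff]
    omega
  exact ⟨(Int.odd_mul.1 hac).1, hb, (Int.odd_mul.1 hac).2⟩

lemma sum_indefForms_symm (m : ℤ) (f : ℤ → ℤ → ℤ → ℤ) :
    ∑ p ∈ indefForms m, f p.1 p.2.1 p.2.2 = ∑ p ∈ indefForms m, f p.2.2 (-p.2.1) p.1 := by
  refine Finset.sum_nbij' (fun p => (p.2.2, -p.2.1, p.1)) (fun p => (p.2.2, -p.2.1, p.1))
    ?_ ?_ ?_ ?_ ?_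
  · rintro ⟨a, b, c⟩ h
    rw [mem_indefForms] at h ⊢
    exact ⟨h.2.1, h.1, by linarith [h.2.2]⟩
  · rintro ⟨a, b, c⟩ h
    rw [mem_indefForms] at h ⊢
    exact ⟨h.2.1, h.1, by linarith [h.2.2]⟩
  all_goals simp

lemma sum_indefForms_neg (m : ℤ) (f : ℤ → ℤ → ℤ → ℤ) :
    ∑ p ∈ indefForms m, f p.1 p.2.1 p.2.2 = ∑ p ∈ indefForms m, f p.1 (-p.2.1) p.2.2 := by
  refine Finset.sum_nbij' (fun p => (p.1, -p.2.1, p.2.2)) (fun p => (p.1, -p.2.1, p.2.2))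
    ?_ ?_ ?_ ?_ ?_
  · rintro ⟨a, b, c⟩ h
    rw [mem_indefForms] at h ⊢
    exact ⟨h.1, h.2.1, by linarith [h.2.2]⟩
  · rintro ⟨a, b, c⟩ h
    rw [mem_indefForms] at h ⊢
    exact ⟨h.1, h.2.1, by linarith [h.2.2]⟩
  all_goals simp

/-- The involution `(a, b, c) ↦ (a + b - c, 2 * c - b, c)` negates
`(a + c) * (a + b) * (c - b)`. -/
lemma sum_indefForms_pos (m : ℤ) :
    ∑ p ∈ indefForms m, (if 0 < p.1 + p.2.1 - p.2.2 then
      (p.1 + p.2.2) * (p.1 + p.2.1) * (p.2.2 - p.2.1) else 0) = 0 := by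
  rw [← Finset.sum_filter]
  have key : ∀ p ∈ {p ∈ indefForms m | 0 < p.1 + p.2.1 - p.2.2},
      (p.1 + p.2.1 - p.2.2, 2 * p.2.2 - p.2.1, p.2.2) ∈
        {p ∈ indefForms m | 0 < p.1 + p.2.1 - p.2.2} := by
    rintro ⟨a, b, c⟩ h
    simp only [Finset.mem_filter, mem_indefForms] at h ⊢
    obtain ⟨⟨h1, h2, h3⟩, h4⟩ := h
    exact ⟨⟨h4, h2, by linarith⟩, by linarith⟩
  have h := Finset.sum_nbij' (s := {p ∈ indefForms m | 0 < p.1 + p.2.1 - p.2.2})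
    (t := {p ∈ indefForms m | 0 < p.1 + p.2.1 - p.2.2})
    (f := fun p => (p.1 + p.2.2) * (p.1 + p.2.1) * (p.2.2 - p.2.1))
    (g := fun p => -((p.1 + p.2.2) * (p.1 + p.2.1) * (p.2.2 - p.2.1)))
    (fun p => (p.1 + p.2.1 - p.2.2, 2 * p.2.2 - p.2.1, p.2.2))
    (fun p => (p.1 + p.2.1 - p.2.2, 2 * p.2.2 - p.2.1, p.2.2)) key key
    (by rintro ⟨a, b, c⟩ _; ext <;> simp; ring)
    (by rintro ⟨a, b, c⟩ _; ext <;> simp; ring)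
    (by rintro ⟨a, b, c⟩ _; simp only; ring)
  rw [Finset.sum_neg_distrib] at h
  omega

lemma sum_indefForms_eq_zero {m : ℤ} (hm : m % 8 = 5) :
    ∑ p ∈ indefForms m, p.1 * (p.1 * p.2.2 - p.2.1 ^ 2) = 0 := by
  set g : ℤ → ℤ → ℤ → ℤ := fun a b c =>
    if 0 < a + b - c then (a + c) * (a + b) * (c - b) else 0 with hg
  set P : ℤ → ℤ → ℤ → ℤ := fun a b c => a * (a * c - b ^ 2) with hP
  have h0 : ∑ p ∈ indefForms m, g p.1 p.2.1 p.2.2 = 0 := sum_indefForms_pos m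
  have h1 := sum_indefForms_symm m g
  have h2 := sum_indefForms_neg m g
  have h3 := sum_indefForms_symm m fun a b c => g a (-b) c
  have h4 := sum_indefForms_symm m P
  have h5 : ∑ p ∈ indefForms m, (P p.1 p.2.1 p.2.2 + P p.2.2 (-p.2.1) p.1) * 2 =
      ∑ p ∈ indefForms m, ((g p.1 p.2.1 p.2.2 + g p.2.2 (-p.2.1) p.1) +
        (g p.1 (-p.2.1) p.2.2 + g p.2.2 (- -p.2.1) p.1)) := by
    refine Finset.sum_congr rfl ?_
    rintro ⟨a, b, c⟩ hp
    rw [mem_indefForms] at hp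
    obtain ⟨⟨a', rfl⟩, ⟨b', rfl⟩, ⟨c', rfl⟩⟩ := odd_of_discrim hm hp.2.2
    simp only [hP, hg]
    split_ifs <;> first | omega | ring
  rw [← Finset.sum_mul, Finset.sum_add_distrib, Finset.sum_add_distrib, Finset.sum_add_distrib,
    Finset.sum_add_distrib] at h5
  have h6 : ∑ p ∈ indefForms m, P p.1 p.2.1 p.2.2 = 0 := by linarith
  exact h6

lemma sum_mul_sigma' {m : ℤ} (hm : m % 8 = 5) :
    ∑ h ∈ oddIcc m, (m - 5 * h ^ 2) * (sigma' ((m - h ^ 2) / 4).toNat : ℤ) = 0 := by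
  have h1 : ∑ p ∈ indefForms m, 4 * (p.1 * (p.1 * p.2.2 - p.2.1 ^ 2)) = 0 := by
    rw [← Finset.mul_sum, sum_indefForms_eq_zero hm, mul_zero]
  rw [← h1]
  simp only [sigma', Nat.cast_sum, Finset.mul_sum]
  rw [Finset.sum_sigma']
  have hodd : ∀ h : ℤ, Odd h → 4 * ((m - h ^ 2) / 4) = m - h ^ 2 := by
    intro h hh
    have := Int.sq_mod_four_eq_one_of_odd hh
    omega
  refine Finset.sum_bij' (fun p _ => ((p.2 : ℤ), p.1, (m - p.1 ^ 2) / 4 / (p.2 : ℤ)))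
    (fun p _ => ⟨p.2.1, p.1.toNat⟩) ?_ ?_ ?_ ?_ ?_
  · rintro ⟨h, d⟩ hp
    simp only [Finset.mem_sigma, oddIcc, Finset.mem_filter, Nat.mem_divisors] at hp
    obtain ⟨⟨-, hh⟩, hd, hne⟩ := hp
    have h4 := hodd h hh
    have hd' : (d : ℤ) ∣ (m - h ^ 2) / 4 := by
      have := Int.natCast_dvd_natCast.2 hd
      rwa [Int.toNat_of_nonneg (by omega)] at this
    have hd0 : 0 < (d : ℤ) := by
      rcases Nat.eq_zero_or_pos d with rfl | h
      · exact absurd (Nat.eq_zero_of_zero_dvd hd) hne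
      · exact_mod_cast h
    dsimp only
    rw [mem_indefForms]
    refine ⟨hd0, Int.ediv_pos_of_pos_of_dvd (by omega) hd0.le hd', ?_⟩
    rw [mul_assoc, Int.mul_ediv_cancel' hd']
    omega
  · rintro ⟨a, b, c⟩ hp
    have ho := odd_of_discrim hm (mem_indefForms.1 hp).2.2
    obtain ⟨ha, hc, h⟩ := mem_indefForms.1 hp
    have h4 : (m - b ^ 2) / 4 = a * c := by rw [← h, mul_assoc]; omega
    simp only [Finset.mem_sigma, oddIcc, Finset.mem_filter, Nat.mem_divisors, h4]
    have hac : 0 < a * c := mul_pos ha hc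
    refine ⟨⟨mem_Icc_neg_of_sq_le (by nlinarith), ho.2.1⟩, ?_, by omega⟩
    rw [Int.toNat_mul ha.le hc.le]
    exact dvd_mul_right _ _
  · rintro ⟨h, d⟩ _
    simp
  · rintro ⟨a, b, c⟩ hp
    obtain ⟨ha, hc, h⟩ := mem_indefForms.1 hp
    have h4 : (m - b ^ 2) / 4 = a * c := by rw [← h, mul_assoc]; omega
    simp [h4, ha.le, ha.ne']
  · rintro ⟨h, d⟩ hp
    simp only [Finset.mem_sigma, oddIcc, Finset.mem_filter, Nat.mem_divisors] at hp
    obtain ⟨⟨-, hh⟩, hd, hne⟩ := hp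
    have h4 := hodd h hh
    have hd' : (d : ℤ) ∣ (m - h ^ 2) / 4 := by
      have := Int.natCast_dvd_natCast.2 hd
      rwa [Int.toNat_of_nonneg (by omega)] at this
    simp only
    rw [Int.mul_ediv_cancel' hd']
    linear_combination (-(d : ℤ)) * h4

lemma card_oddSqReps_four_one : (oddSqReps 4 4).card = 16 := by
  have : oddSqReps 4 4 = Fintype.piFinset fun _ : Fin 4 => ({-1, 1} : Finset ℤ) := by
    ext x
    simp only [mem_oddSqReps, Fintype.mem_piFinset, Finset.mem_insert, Finset.mem_singleton]
    constructor
    · rintro ⟨h, ho⟩ i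
      have hpos : ∀ j, 1 ≤ x j ^ 2 := fun j => by
        have : x j ≠ 0 := by
          intro h0
          have := ho j
          simp [h0] at this
        have := pow_pos (abs_pos.2 this) 2
        rw [sq_abs] at this
        omega
      rw [Fin.sum_univ_four] at h
      have h1 : x i ^ 2 = 1 := by
        have := hpos 0; have := hpos 1; have := hpos 2; have := hpos 3
        fin_cases i <;> simp only [Fin.zero_eta, Fin.mk_one, Fin.reduceFinMk] <;> omega
      exact (mul_self_eq_one_iff.1 ((sq (x i)).symm.trans h1)).symm
    · intro h
      have h1 : ∀ i, x i ^ 2 = 1 := fun i => by rcases h i with h | h <;> simp [h]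
      refine ⟨by simp [h1], fun i => ?_⟩
      rcases h i with h | h <;> rw [h] <;> decide
  rw [this, Fintype.card_piFinset]
  rfl

/-- A number `4 * N` with `N` odd is the sum of four odd squares in `16 * σ(N)` ways. -/
lemma card_oddSqReps_four {N : ℕ} (hN : Odd N) :
    (oddSqReps 4 (4 * N)).card = 16 * sigma' N := by
  induction N using Nat.strong_induction_on with
  | _ N ih =>
  rcases eq_or_ne N 1 with rfl | hN1
  · rw [Nat.cast_one, mul_one, card_oddSqReps_four_one]
    simp [sigma']
  have hN' := Nat.odd_iff.1 hN
  set m : ℤ := 4 * N + 1 with hm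
  have hm8 : m % 8 = 5 := by omega
  set D : ℤ → ℤ := fun h => (m - 5 * h ^ 2) * (((oddSqReps 4 (m - h ^ 2)).card : ℤ) -
    16 * (sigma' ((m - h ^ 2) / 4).toNat : ℤ)) with hD
  have h1 : ∑ h ∈ oddIcc m, D h = 0 := by
    have e1 := sum_mul_card_oddSqReps 4 m
    have e2 := sum_mul_sigma' hm8
    have e3 : ∀ h ∈ oddIcc m, D h =
        (m - ((4 : ℕ) + 1) * h ^ 2) * ((oddSqReps 4 (m - h ^ 2)).card : ℤ) -
        16 * ((m - 5 * h ^ 2) * (sigma' ((m - h ^ 2) / 4).toNat : ℤ)) := by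
      intro h _
      simp only [hD]
      push_cast
      ring
    rw [Finset.sum_congr rfl e3, Finset.sum_sub_distrib, e1, ← Finset.mul_sum, e2]
    simp
  have h2 : ∑ h ∈ ({-1, 1} : Finset ℤ), D h = ∑ h ∈ oddIcc m, D h := by
    refine Finset.sum_subset ?_ ?_
    · intro h hh
      simp only [Finset.mem_insert, Finset.mem_singleton] at hh
      simp only [oddIcc, Finset.mem_filter, Finset.mem_Icc]
      rcases hh with rfl | rfl
      · exact ⟨by omega, by decide⟩
      · exact ⟨by omega, by decide⟩
    · intro h hh hne
      simp only [Finset.mem_insert, Finset.mem_singleton, not_or] at hne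
      have ho : Odd h := (Finset.mem_filter.1 hh).2
      have h8 : h ^ 2 % 8 = 1 := sq_emod_eight_of_odd ho
      have hgt : 1 < h ^ 2 := by
        have h0 : h ≠ 0 := by rintro rfl; simp at ho
        rcases lt_or_gt_of_ne h0 with h0 | h0
        · have : h ≤ -2 := by omega
          nlinarith
        · have : 2 ≤ h := by omega
          nlinarith
      simp only [hD, mul_eq_zero]
      right
      set k : ℤ := (m - h ^ 2) / 4 with hk
      have hk4 : m - h ^ 2 = 4 * k := by omega
      rcases lt_or_ge k 0 with hk0 | hk0
      · have : oddSqReps 4 (m - h ^ 2) = ∅ := by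
          refine Finset.eq_empty_of_forall_notMem fun x hx => ?_
          have e := (mem_oddSqReps.1 hx).1
          have : 0 ≤ ∑ i, x i ^ 2 := Finset.sum_nonneg fun i _ => sq_nonneg _
          omega
        rw [this, Int.toNat_of_nonpos hk0.le]
        simp [sigma']
      · obtain ⟨j, hj⟩ := Int.eq_ofNat_of_zero_le hk0
        have := ih j (by omega) (Nat.odd_iff.2 (by omega))
        rw [hk4, hj, this]
        simp
  rw [h1, Finset.sum_pair (by decide)] at h2
  have e : m - 1 = 4 * N := by omega
  have e' : ((4 : ℤ) * N / 4).toNat = N := by omega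
  simp only [hD, even_two, Even.neg_pow, one_pow, e, e'] at h2
  have h3 : (m - 5) * (((oddSqReps 4 (4 * N)).card : ℤ) - 16 * sigma' N) = 0 := by linarith
  rcases mul_eq_zero.1 h3 with h | h
  · omega
  · zify
    linarith

lemma card_sqReps_four_sameParity (M : ℤ) (i j : Fin 4) (hi : i ≠ 0) (hj : j ≠ 0) :
    ({x ∈ sqReps 4 M | Even (x 0 - x i)} : Finset _).card =
      ({x ∈ sqReps 4 M | Even (x 0 - x j)} : Finset _).card := by
  have key : ∀ i j : Fin 4, i ≠ 0 → j ≠ 0 → ∀ x ∈ {x ∈ sqReps 4 M | Even (x 0 - x i)},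
      x ∘ Equiv.swap i j ∈ {x ∈ sqReps 4 M | Even (x 0 - x j)} := by
    intro i j hi hj x hx
    simp only [Finset.mem_filter, mem_sqReps] at hx ⊢
    refine ⟨?_, ?_⟩
    · rw [← hx.1]
      exact Equiv.sum_comp (Equiv.swap i j) fun j => x j ^ 2
    · simpa [Equiv.swap_apply_of_ne_of_ne hi.symm hj.symm] using hx.2
  refine Finset.card_nbij' (fun x => x ∘ Equiv.swap i j) (fun x => x ∘ Equiv.swap j i)
    (key i j hi hj) (key j i hj hi) ?_ ?_
  · intro x _; ext l; simp [Equiv.swap_comm j i]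
  · intro x _; ext l; simp [Equiv.swap_comm j i]

lemma card_sqReps_four_diffParity (N : ℕ) :
    ({x ∈ sqReps 4 (2 * N) | ¬ Even (x 0 - x 1)} : Finset _).card =
      (oddSqReps 4 (4 * N)).card := by
  refine Finset.card_nbij' (fun x => ![x 0 + x 1, x 0 - x 1, x 2 + x 3, x 2 - x 3])
    (fun y => ![(y 0 + y 1) / 2, (y 0 - y 1) / 2, (y 2 + y 3) / 2, (y 2 - y 3) / 2]) ?_ ?_ ?_ ?_
  · intro x hx
    simp only [Finset.mem_coe, Finset.mem_filter, mem_sqReps, Fin.sum_univ_four] at hx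
    obtain ⟨h, ho⟩ := hx
    have h2 : ¬ Even (x 2 - x 3) := by
      have : Even (x 0 ^ 2 + x 1 ^ 2 + x 2 ^ 2 + x 3 ^ 2) := h ▸ even_two_mul _
      simp only [Int.even_add, Int.even_sub, Int.even_pow' two_ne_zero] at this ho ⊢
      tauto
    simp only [Finset.mem_coe, mem_oddSqReps, Fin.sum_univ_four, Fin.forall_fin_succ]
    simp only [Int.even_sub] at ho h2
    simp [Int.odd_add, Int.odd_sub]
    refine ⟨by linear_combination 2 * h, ?_⟩
    simp only [← Int.not_even_iff_odd] at *
    tauto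
  · intro y hy
    simp only [Finset.mem_coe, mem_oddSqReps, Fin.sum_univ_four] at hy
    obtain ⟨h, ho⟩ := hy
    obtain ⟨a, ha⟩ := ho 0
    obtain ⟨b, hb⟩ := ho 1
    obtain ⟨c, hc⟩ := ho 2
    obtain ⟨d, hd⟩ := ho 3
    rw [ha, hb, hc, hd] at h
    have e1 : (y 0 + y 1) / 2 = a + b + 1 := by omega
    have e2 : (y 0 - y 1) / 2 = a - b := by omega
    have e3 : (y 2 + y 3) / 2 = c + d + 1 := by omega
    have e4 : (y 2 - y 3) / 2 = c - d := by omega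
    simp only [Finset.mem_coe, Finset.mem_filter, mem_sqReps, Fin.sum_univ_four]
    simp only [e1, e2, e3, e4, Matrix.cons_val]
    refine ⟨by linarith, ?_⟩
    rw [Int.not_even_iff_odd]
    exact ⟨b, by ring⟩
  · intro x _
    ext i
    fin_cases i <;> simp <;> omega
  · intro y hy
    simp only [Finset.mem_coe, mem_oddSqReps] at hy
    obtain ⟨a, ha⟩ := hy.2 0
    obtain ⟨b, hb⟩ := hy.2 1
    obtain ⟨c, hc⟩ := hy.2 2
    obtain ⟨d, hd⟩ := hy.2 3
    ext i
    fin_cases i <;> simp <;> omega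

lemma card_sqReps_four_eq_sum {N : ℕ} (hN : Odd N) :
    (sqReps 4 (2 * N)).card =
      ({x ∈ sqReps 4 (2 * N) | Even (x 0 - x 1)} : Finset _).card +
      ({x ∈ sqReps 4 (2 * N) | Even (x 0 - x 2)} : Finset _).card +
      ({x ∈ sqReps 4 (2 * N) | Even (x 0 - x 3)} : Finset _).card := by
  simp only [Finset.card_filter, ← Finset.sum_add_distrib]
  rw [Finset.card_eq_sum_ones]
  refine Finset.sum_congr rfl fun x hx => ?_
  rw [mem_sqReps, Fin.sum_univ_four] at hx
  have hN' := Nat.odd_iff.1 hN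
  have h4 : ∀ i, x i ^ 2 % 4 = x i % 2 := fun i => by
    rcases Int.even_or_odd (x i) with h | h
    · obtain ⟨t, ht⟩ := h
      have : x i ^ 2 = 4 * t ^ 2 := by rw [ht]; ring
      omega
    · have := Int.sq_mod_four_eq_one_of_odd h
      rw [Int.odd_iff] at h
      omega
  have h0 := h4 0
  have h1 := h4 1
  have h2 := h4 2
  have h3 := h4 3
  simp only [Int.even_iff]
  rcases Int.emod_two_eq (x 0) with e0 | e0 <;> rcases Int.emod_two_eq (x 1) with e1 | e1 <;>
    rcases Int.emod_two_eq (x 2) with e2 | e2 <;> rcases Int.emod_two_eq (x 3) with e3 | e3 <;>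
    rw [e0] at h0 <;> rw [e1] at h1 <;> rw [e2] at h2 <;> rw [e3] at h3 <;>
    first | omega | (split_ifs <;> omega)

/-- Jacobi's four-square theorem for twice an odd number. -/
lemma r4_two_mul_odd {N : ℕ} (hN : Odd N) : r4 (2 * N) = 24 * sigma' N := by
  have h0 : r4 (2 * N) = (sqReps 4 (2 * N)).card := by
    rw [r4, ← Set.ncard_coe_finset]
    congr 1
    ext x
    simp [mem_sqReps]
  have h1 := card_sqReps_four_eq_sum hN
  have h2 := card_sqReps_four_sameParity (2 * N) 2 1 (by decide) (by decide)
  have h3 := card_sqReps_four_sameParity (2 * N) 3 1 (by decide) (by decide)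
  have h4 := card_sqReps_four_diffParity N
  have h5 := Finset.card_filter_add_card_filter_not (s := sqReps 4 (2 * N))
    (fun x => Even (x 0 - x 1))
  have h6 := card_oddSqReps_four hN
  omega

lemma sigma'_two_mul_odd {N : ℕ} (hN : Odd N) : sigma' (2 * N) = 3 * sigma' N := by
  have h : ∀ k, sigma' k = ArithmeticFunction.sigma 1 k := fun k => by
    simp [sigma', ArithmeticFunction.sigma_one_apply]
  rw [h, h, ArithmeticFunction.isMultiplicative_sigma.map_mul_of_coprime
    (Nat.coprime_two_left.2 hN)]
  rfl

lemma r4_two_add_two_pow {k : ℕ} (hk : 1 ≤ k) :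
    r4 (2 + 2 ^ 2 ^ k) = 8 * sigma' (2 + 2 ^ 2 ^ k) := by
  obtain ⟨j, hj⟩ : ∃ j, 2 ^ k = j + 2 :=
    ⟨2 ^ k - 2, by have := Nat.pow_le_pow_right two_pos hk; omega⟩
  have e : 2 + 2 ^ 2 ^ k = 2 * (2 * 2 ^ j + 1) := by rw [hj]; ring
  have ho : Odd (2 * 2 ^ j + 1) := odd_two_mul_add_one _
  rw [e, r4_two_mul_odd ho, sigma'_two_mul_odd ho]
  ring

/-- The solution of `B_(k + 13)` with `x 1 = 4` attached to a representation of
`2 + 2 ^ 2 ^ (k + 1)` as a sum of four squares. -/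
def BSol (k : ℕ) (a : Fin 4 → ℤ) (i : ℕ) : ℤ :=
  if i = 0 then 0 else if i ≤ k + 1 then 2 ^ 2 ^ i else
    [2, a 0, a 0 ^ 2, a 1, a 1 ^ 2, a 2, a 2 ^ 2, a 3, a 3 ^ 2, a 0 ^ 2 + a 1 ^ 2,
      a 2 ^ 2 + a 3 ^ 2, a 0 ^ 2 + a 1 ^ 2 + (a 2 ^ 2 + a 3 ^ 2)].getD (i - (k + 2)) 0

lemma BSol_of_le {k i : ℕ} (a : Fin 4 → ℤ) (h1 : 1 ≤ i) (h2 : i ≤ k + 1) :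
    BSol k a i = 2 ^ 2 ^ i := by
  rw [BSol, if_neg (by omega), if_pos h2]

lemma BSol_add (k : ℕ) (a : Fin 4 → ℤ) (j : ℕ) : BSol k a (k + 2 + j) =
    [2, a 0, a 0 ^ 2, a 1, a 1 ^ 2, a 2, a 2 ^ 2, a 3, a 3 ^ 2, a 0 ^ 2 + a 1 ^ 2,
      a 2 ^ 2 + a 3 ^ 2, a 0 ^ 2 + a 1 ^ 2 + (a 2 ^ 2 + a 3 ^ 2)].getD j 0 := by
  rw [BSol, if_neg (by omega), if_neg (by omega), Nat.add_sub_cancel_left]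

lemma BSol_of_notMem {k i : ℕ} (a : Fin 4 → ℤ) (h : i = 0 ∨ k + 13 < i) : BSol k a i = 0 := by
  rcases h with rfl | h
  · rfl
  · obtain ⟨j, rfl⟩ := Nat.exists_eq_add_of_le h
    rw [show (k + 13).succ + j = k + 2 + (12 + j) by omega, BSol_add]
    exact List.getD_eq_default _ _ (by simp)

lemma BSol_injective (k : ℕ) : Function.Injective (BSol k) := by
  intro a b h
  have key := fun j => (BSol_add k a j).symm.trans ((congrFun h _).trans (BSol_add k b j))
  ext i
  fin_cases i
  exacts [key 1, key 3, key 5, key 7]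

lemma BSol_mem_BSet {k : ℕ} {a : Fin 4 → ℤ} (ha : ∑ i, a i ^ 2 = 2 + 2 ^ 2 ^ (k + 1)) :
    BSol k a ∈ BSet (k + 13) := by
  rw [Fin.sum_univ_four] at ha
  refine ⟨fun i hi => BSol_of_notMem a hi, ?_⟩
  simp only [BSys, Nat.reduceSubDiff, Nat.add_sub_cancel]
  rw [BSol_of_le a le_rfl (by omega), BSol_of_le a (Nat.le_add_left 1 k) le_rfl]
  refine ⟨fun i h1 h2 => ?_, ?_⟩
  · rw [BSol_of_le a h1 (by omega), BSol_of_le a (by omega) (by omega)]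
    ring
  · rw [show BSol k a (k + 2) = _ from BSol_add k a 0, show BSol k a (k + 3) = _ from BSol_add k a 1,
      show BSol k a (k + 4) = _ from BSol_add k a 2, show BSol k a (k + 5) = _ from BSol_add k a 3,
      show BSol k a (k + 6) = _ from BSol_add k a 4, show BSol k a (k + 7) = _ from BSol_add k a 5,
      show BSol k a (k + 8) = _ from BSol_add k a 6, show BSol k a (k + 9) = _ from BSol_add k a 7,
      show BSol k a (k + 10) = _ from BSol_add k a 8,
      show BSol k a (k + 11) = _ from BSol_add k a 9,
      show BSol k a (k + 12) = _ from BSol_add k a 10,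
      show BSol k a (k + 13) = _ from BSol_add k a 11]
    simp only [List.getD_cons_zero, List.getD_cons_succ]
    refine ⟨?_, ?_, ?_, ?_, ?_, ?_, ?_, ?_, ?_, ?_⟩ <;> first | trivial | linarith

lemma BSet_eq (k : ℕ) :
    BSet (k + 13) = insert 0 (BSol k '' {a | ∑ i, a i ^ 2 = 2 + 2 ^ 2 ^ (k + 1)}) := by
  ext x
  constructor
  · rintro ⟨hx, hB⟩
    simp only [BSys, Nat.reduceSubDiff, Nat.add_sub_cancel] at hB
    obtain ⟨hc, e1, e2, e3, e4, e5, e6, e7, e8, e9, e10⟩ := hB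
    have h02 : x (k + 2) = 0 ∨ x (k + 2) = 2 := by
      have : x (k + 2) * (x (k + 2) - 2) = 0 := by linarith
      rcases mul_eq_zero.1 this with h | h
      · exact .inl h
      · exact .inr (by omega)
    have hcase : ∀ i, i = 0 ∨ k + 13 < i ∨ (1 ≤ i ∧ i ≤ k + 1) ∨ ∃ j < 12, i = k + 2 + j := by
      intro i
      by_cases h : k + 2 ≤ i ∧ i ≤ k + 13
      · exact .inr (.inr (.inr ⟨i - (k + 2), by omega, by omega⟩))
      · omega
    rcases h02 with h2 | h2
    · left
      have hx1 : ∀ i, 1 ≤ i → i ≤ k + 1 → x i = 0 := by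
        intro i h1
        induction i, h1 using Nat.le_induction with
        | base => intro _; omega
        | succ i hi ih =>
          intro h
          rw [← hc i hi (by omega), ih (by omega), mul_zero]
      rw [h2, hx1 (k + 1) (by omega) le_rfl] at e10
      have s1 := mul_self_nonneg (x (k + 3))
      have s2 := mul_self_nonneg (x (k + 5))
      have s3 := mul_self_nonneg (x (k + 7))
      have s4 := mul_self_nonneg (x (k + 9))
      have z1 : x (k + 3) = 0 := mul_self_eq_zero.1 (by linarith)
      have z2 : x (k + 5) = 0 := mul_self_eq_zero.1 (by linarith)
      have z3 : x (k + 7) = 0 := mul_self_eq_zero.1 (by linarith)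
      have z4 : x (k + 9) = 0 := mul_self_eq_zero.1 (by linarith)
      simp only [z1, z2, z3, z4, mul_zero] at e3 e4 e5 e6
      funext i
      change x i = 0
      rcases hcase i with h | h | h | ⟨j, hj, rfl⟩
      · exact hx i (.inl h)
      · exact hx i (.inr h)
      · exact hx1 i h.1 h.2
      · interval_cases j <;> simp only [Nat.add_assoc, Nat.reduceAdd] <;> linarith
    · right
      have hx1 : ∀ i, 1 ≤ i → i ≤ k + 1 → x i = 2 ^ 2 ^ i := by
        intro i h1
        induction i, h1 using Nat.le_induction with
        | base => intro _; norm_num; omega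
        | succ i hi ih =>
          intro h
          rw [← hc i hi (by omega), ih (by omega)]
          ring
      rw [h2, hx1 (k + 1) (by omega) le_rfl] at e10
      refine ⟨![x (k + 3), x (k + 5), x (k + 7), x (k + 9)], ?_, ?_⟩
      · simp only [Set.mem_ofPred_eq, Fin.sum_univ_four, Matrix.cons_val]
        linarith
      · funext i
        rcases hcase i with h | h | h | ⟨j, hj, rfl⟩
        · rw [hx i (.inl h), BSol_of_notMem _ (.inl h)]
        · rw [hx i (.inr h), BSol_of_notMem _ (.inr h)]
        · rw [hx1 i h.1 h.2, BSol_of_le _ h.1 h.2]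
        · rw [BSol_add]
          interval_cases j <;>
            simp only [Nat.add_assoc, Nat.reduceAdd, List.getD_cons_zero, List.getD_cons_succ,
              Matrix.cons_val] <;> linarith
  · rintro (rfl | ⟨a, ha, rfl⟩)
    · exact ⟨fun _ _ => rfl, by simp [BSys]⟩
    · exact BSol_mem_BSet ha

lemma ncard_BSet (k : ℕ) : (BSet (k + 13)).ncard = 1 + r4 (2 + 2 ^ 2 ^ (k + 1)) := by
  have hset : {a : Fin 4 → ℤ | ∑ i, a i ^ 2 = 2 + 2 ^ 2 ^ (k + 1)} =
      (sqReps 4 (2 + 2 ^ 2 ^ (k + 1)) : Set (Fin 4 → ℤ)) := by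
    ext a
    simp [mem_sqReps]
  have h0 : (0 : ℕ → ℤ) ∉ BSol k '' {a | ∑ i, a i ^ 2 = 2 + 2 ^ 2 ^ (k + 1)} := by
    rintro ⟨a, -, h⟩
    exact two_ne_zero ((BSol_add k a 0).symm.trans (congrFun h (k + 2)))
  have hfin : (BSol k '' {a | ∑ i, a i ^ 2 = 2 + 2 ^ 2 ^ (k + 1)}).Finite := by
    rw [hset]
    exact (Finset.finite_toSet _).image _
  rw [BSet_eq, Set.ncard_insert_of_notMem h0 hfin, Set.ncard_image_of_injective _ (BSol_injective k), r4,
    add_comm]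
  push_cast
  rfl

theorem stmt1 (n : ℕ) (hn : 13 ≤ n) :
    r4 (2 + 2 ^ 2 ^ (n - 12)) = 8 * sigma' (2 + 2 ^ 2 ^ (n - 12)) ∧
    (BSet n).ncard = 1 + 8 * sigma' (2 + 2 ^ 2 ^ (n - 12)) := by
  obtain ⟨k, rfl⟩ := Nat.exists_eq_add_of_le' hn
  have h := r4_two_add_two_pow (k := k + 1) (by omega)
  rw [show k + 13 - 12 = k + 1 by omega]
  exact ⟨h, by rw [ncard_BSet, h]⟩
end

section
/- For every real ε > 0 there exists a real constant c(ε) > 0 such that for every non-negative integer s and every positive integer m with m not divisible by 4 and m not congruent to 7 modulo 8, one has r_3(4^s · m) ≥ c(ε) · m^(1/2 − ε). -/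
/-- `r3 m` is the number of representations of the integer `m` as a sum of three squares
of integers. -/
noncomputable def r3 (m : ℤ) : ℕ := {a : Fin 3 → ℤ | ∑ i, (a i) ^ 2 = m}.ncard

theorem card_divisors_le_mul_rpow {ε : ℝ} (hε : 0 < ε) :
    ∃ C : ℝ, 0 < C ∧ ∀ n : ℕ, n ≠ 0 → (n.divisors.card : ℝ) ≤ C * (n : ℝ) ^ ε := by
  have hl2 : 0 < Real.log 2 := Real.log_pos (by norm_num)
  set D : ℝ := 1 + 1 / (ε * Real.log 2) with hD
  have hD1 : 1 ≤ D := by rw [hD]; have : 0 < 1 / (ε * Real.log 2) := by positivity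
                         linarith
  set P : ℕ := ⌈(2 : ℝ) ^ (1 / ε)⌉₊ with hP
  refine ⟨D ^ P, by positivity, fun n hn => ?_⟩
  have hfac : (n : ℝ) ^ ε = ∏ p ∈ n.primeFactors, ((p : ℝ) ^ ε) ^ (n.factorization p) := by
    conv_lhs =>
      rw [← Nat.prod_factorization_pow_eq_self hn, Finsupp.prod, Nat.support_factorization]
    push_cast
    rw [← Real.finsetProd_rpow _ _ (fun p _ => by positivity)]
    refine Finset.prod_congr rfl fun p _ => ?_
    rw [← Real.rpow_natCast, ← Real.rpow_mul (by positivity), ← Real.rpow_natCast,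
      ← Real.rpow_mul (by positivity), mul_comm]
  have hterm : ∀ p ∈ n.primeFactors, ((n.factorization p + 1 : ℕ) : ℝ) ≤
      (if p < P then D else 1) * ((p : ℝ) ^ ε) ^ (n.factorization p) := by
    intro p hp
    have hp2 : (2 : ℝ) ≤ p := by exact_mod_cast (Nat.prime_of_mem_primeFactors hp).two_le
    set v := n.factorization p
    push_cast
    split_ifs with h
    · have h1 : 1 + ε * Real.log 2 ≤ (p : ℝ) ^ ε := by
        calc 1 + ε * Real.log 2 ≤ Real.exp (ε * Real.log 2) := by
              have := Real.add_one_le_exp (ε * Real.log 2); linarith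
          _ = (2 : ℝ) ^ ε := by rw [Real.rpow_def_of_pos (by norm_num), mul_comm]
          _ ≤ _ := Real.rpow_le_rpow (by norm_num) hp2 hε.le
      have h2 : 1 + v * (ε * Real.log 2) ≤ ((p : ℝ) ^ ε) ^ v :=
        (one_add_mul_le_pow (by have : 0 < ε * Real.log 2 := by positivity
                                linarith) v).trans
          (pow_le_pow_left₀ (by positivity) h1 v)
      calc (v : ℝ) + 1 ≤ D * (1 + v * (ε * Real.log 2)) := by
            have e1 : (1 / (ε * Real.log 2)) * (v * (ε * Real.log 2)) = v := by field_simp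
            have e2 : 0 < 1 / (ε * Real.log 2) := by positivity
            have e3 : (0 : ℝ) ≤ v * (ε * Real.log 2) := by positivity
            rw [hD]; nlinarith
        _ ≤ _ := by gcongr
    · have h1 : (2 : ℝ) ≤ (p : ℝ) ^ ε := by
        have h3 : (2 : ℝ) ^ (1 / ε) ≤ p := (Nat.le_ceil _).trans (by exact_mod_cast not_lt.1 h)
        calc (2 : ℝ) = ((2 : ℝ) ^ (1 / ε)) ^ ε := by
              rw [← Real.rpow_mul (by norm_num), one_div_mul_cancel hε.ne', Real.rpow_one]
          _ ≤ _ := Real.rpow_le_rpow (by positivity) h3 hε.le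
      rw [one_mul]
      calc (v : ℝ) + 1 ≤ 2 ^ v := by exact_mod_cast Nat.lt_two_pow_self
        _ ≤ _ := pow_le_pow_left₀ (by norm_num) h1 v
  calc (n.divisors.card : ℝ) = ∏ p ∈ n.primeFactors, ((n.factorization p + 1 : ℕ) : ℝ) := by
        rw [Nat.card_divisors hn]; push_cast; rfl
    _ ≤ ∏ p ∈ n.primeFactors,
        (if p < P then D else 1) * ((p : ℝ) ^ ε) ^ (n.factorization p) :=
        Finset.prod_le_prod (fun _ _ => by positivity) hterm
    _ = (∏ p ∈ n.primeFactors, (if p < P then D else 1)) * (n : ℝ) ^ ε := by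
        rw [Finset.prod_mul_distrib, hfac]
    _ ≤ _ := by
        gcongr
        rw [Finset.prod_ite, Finset.prod_const, Finset.prod_const_one, mul_one]
        refine pow_le_pow_right₀ hD1 ?_
        calc _ ≤ (Finset.range P).card := Finset.card_le_card (fun p hp => by
              simpa using (Finset.mem_filter.1 hp).2)
          _ = P := Finset.card_range P

theorem two_pow_card_primeFactors_le_mul_rpow {ε : ℝ} (hε : 0 < ε) :
    ∃ C : ℝ, 0 < C ∧ ∀ n : ℕ, n ≠ 0 → (2 : ℝ) ^ n.primeFactors.card ≤ C * (n : ℝ) ^ ε := by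
  obtain ⟨C, hC, h⟩ := card_divisors_le_mul_rpow hε
  refine ⟨C, hC, fun n hn => le_trans ?_ (h n hn)⟩
  have : 2 ^ n.primeFactors.card ≤ n.divisors.card := by
    rw [Nat.card_divisors hn, ← Finset.prod_const]
    refine Finset.prod_le_prod' fun p hp => ?_
    have := (Nat.prime_of_mem_primeFactors hp).factorization_pos_of_dvd hn
      (Nat.dvd_of_mem_primeFactors hp)
    omega
  exact_mod_cast this

open MeasureTheory in
theorem exists_int_vec_norm_lt_one {M : Matrix (Fin 3) (Fin 3) ℝ} (h0 : M.det ≠ 0)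
    (hM : |M.det| < Real.pi / 6) :
    ∃ v : Fin 3 → ℤ, v ≠ 0 ∧
      (M.mulVec (fun i => (v i : ℝ))) ⬝ᵥ (M.mulVec (fun i => (v i : ℝ))) < 1 := by
  let b := Pi.basisFun ℝ (Fin 3)
  let L : AddSubgroup (Fin 3 → ℝ) := (Submodule.span ℤ (Set.range b)).toAddSubgroup
  let B : Set (Fin 3 → ℝ) := (WithLp.toLp 2) ⁻¹' (Metric.ball (0 : EuclideanSpace ℝ (Fin 3)) 1)
  let s : Set (Fin 3 → ℝ) := (Matrix.toLin' M) ⁻¹' B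
  have hB : volume B = ENNReal.ofReal (Real.pi * 4 / 3) := by
    rw [(PiLp.volume_preserving_toLp (Fin 3)).measure_preimage
      Metric.isOpen_ball.measurableSet.nullMeasurableSet, EuclideanSpace.volume_ball_fin_three]
    simp
  have hs : volume s = ENNReal.ofReal |M.det|⁻¹ * ENNReal.ofReal (Real.pi * 4 / 3) := by
    rw [Measure.addHaar_preimage_linearMap _ (by simpa using h0), hB]
    simp [abs_inv]
  have hmem : ∀ w : Fin 3 → ℝ, w ∈ s ↔ (M.mulVec w) ⬝ᵥ (M.mulVec w) < 1 := by
    intro w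
    simp only [s, B, Set.mem_preimage, Matrix.toLin'_apply, mem_ball_zero_iff]
    rw [← sq_lt_one_iff₀ (norm_nonneg _), EuclideanSpace.norm_sq_eq]
    simp [dotProduct, sq]
  have hsymm : ∀ x ∈ s, -x ∈ s := by
    intro x hx
    rw [hmem] at hx ⊢
    simpa [Matrix.mulVec_neg] using hx
  have hconv : Convex ℝ s := by
    have h1 : Convex ℝ B :=
      (convex_ball (0 : EuclideanSpace ℝ (Fin 3)) 1).linear_preimage
        (WithLp.linearEquiv 2 ℝ (Fin 3 → ℝ)).symm.toLinearMap
    exact h1.linear_preimage _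
  have hfund : IsAddFundamentalDomain L (ZSpan.fundamentalDomain b) volume :=
    ZSpan.isAddFundamentalDomain' b volume
  have hvol : volume (ZSpan.fundamentalDomain b) = 1 := by
    simp [b, ZSpan.fundamentalDomain_pi_basisFun, volume_pi_pi]
  have : Countable L := by
    change Countable (Submodule.span ℤ (Set.range b))
    infer_instance
  obtain ⟨x, hx0, hx⟩ := exists_ne_zero_mem_lattice_of_measure_mul_two_pow_lt_measure hfund
    hsymm hconv (by
      have hp : 0 < |M.det| := abs_pos.mpr h0
      rw [hvol, hs, ← ENNReal.ofReal_mul (by positivity)]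
      have h2 : (1 : ENNReal) * 2 ^ Module.finrank ℝ (Fin 3 → ℝ) = ENNReal.ofReal 8 := by
        simp; norm_num
      rw [h2, ENNReal.ofReal_lt_ofReal_iff (by positivity), inv_mul_eq_div, lt_div_iff₀ hp]
      linarith)
  have hxL := (b.mem_span_iff_repr_mem ℤ (x : Fin 3 → ℝ)).1 x.2
  choose v hv using hxL
  have hxv : (x : Fin 3 → ℝ) = fun i => (v i : ℝ) := by
    funext i
    have := hv i
    simp [b] at this
    exact this.symm
  refine ⟨v, ?_, ?_⟩
  · rintro rfl
    apply hx0
    ext i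
    simp [hxv]
  · rw [← hxv]
    exact (hmem _).1 hx

open scoped MatrixOrder in
/-- Hermite's bound for positive definite ternary forms of small determinant. -/
theorem exists_int_vec_lt_one_of_posDef {A : Matrix (Fin 3) (Fin 3) ℝ} (hA : A.PosDef)
    (hd : A.det ≤ 1 / 4) :
    ∃ v : Fin 3 → ℤ, v ≠ 0 ∧
      (fun i => (v i : ℝ)) ⬝ᵥ (A.mulVec (fun i => (v i : ℝ))) < 1 := by
  obtain ⟨M, hM⟩ : ∃ M : Matrix (Fin 3) (Fin 3) ℝ, A = M.transpose * M := by
    obtain ⟨M, hM⟩ := CStarAlgebra.nonneg_iff_eq_star_mul_self.1 hA.posSemidef.nonneg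
    exact ⟨M, by simpa [Matrix.star_eq_conjTranspose] using hM⟩
  have hdet : A.det = M.det ^ 2 := by
    rw [hM, Matrix.det_mul, Matrix.det_transpose, sq]
  have hpos := hA.det_pos
  have h0 : M.det ≠ 0 := by
    intro h
    simp [hdet, h] at hpos
  obtain ⟨v, hv0, hv⟩ := exists_int_vec_norm_lt_one h0 (by
    have h1 : |M.det| ≤ 1 / 2 := by
      apply abs_le_of_sq_le_sq
      · rw [← hdet]; linarith
      · norm_num
    have := Real.pi_gt_three
    linarith)
  refine ⟨v, hv0, ?_⟩
  rw [hM, ← Matrix.mulVec_mulVec, Matrix.dotProduct_mulVec, Matrix.vecMul_transpose]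
  exact hv

theorem ternary_exists_int_vec {a b c d e f : ℝ}
    (hpos : ∀ x y z : ℝ, (x ≠ 0 ∨ y ≠ 0 ∨ z ≠ 0) →
      0 < a * x ^ 2 + d * y ^ 2 + f * z ^ 2 + 2 * b * x * y + 2 * c * x * z + 2 * e * y * z)
    (hdet : a * d * f + 2 * b * c * e - a * e ^ 2 - d * c ^ 2 - f * b ^ 2 ≤ 1 / 4) :
    ∃ x y z : ℤ, (x ≠ 0 ∨ y ≠ 0 ∨ z ≠ 0) ∧
      a * x ^ 2 + d * y ^ 2 + f * z ^ 2 + 2 * b * x * y + 2 * c * x * z + 2 * e * y * z < 1 := by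
  have hA : (!![a, b, c; b, d, e; c, e, f] : Matrix (Fin 3) (Fin 3) ℝ).PosDef := by
    refine Matrix.PosDef.of_dotProduct_mulVec_pos ?_ ?_
    · ext i j
      fin_cases i <;> fin_cases j <;> simp [Matrix.conjTranspose]
    · intro x hx
      have h1 : x 0 ≠ 0 ∨ x 1 ≠ 0 ∨ x 2 ≠ 0 := by
        by_contra! h
        apply hx
        ext i
        fin_cases i <;> simp [h]
      have h2 := hpos _ _ _ h1
      simp only [dotProduct, Matrix.mulVec, Fin.sum_univ_three]
      simp
      linarith
  obtain ⟨v, hv0, hv⟩ := exists_int_vec_lt_one_of_posDef hA (by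
    simp [Matrix.det_fin_three]
    linarith)
  refine ⟨v 0, v 1, v 2, ?_, ?_⟩
  · by_contra! h
    apply hv0
    ext i
    fin_cases i <;> simp [h]
  · simp only [dotProduct, Matrix.mulVec, Fin.sum_univ_three] at hv
    simp at hv
    linarith

/-- A positive definite integral ternary form of determinant one is a sum of three squares of
linear forms; here this is evaluated at the third basis vector. -/
theorem unimodular_ternary_eq_sum_three_sq {a b c d e f : ℤ}
    (hpos : ∀ x y z : ℝ, (x ≠ 0 ∨ y ≠ 0 ∨ z ≠ 0) →
      0 < a * x ^ 2 + d * y ^ 2 + f * z ^ 2 + 2 * b * x * y + 2 * c * x * z + 2 * e * y * z)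
    (hdet : a * d * f + 2 * b * c * e - a * e ^ 2 - d * c ^ 2 - f * b ^ 2 = 1) :
    ∃ u v w : ℤ, f = u ^ 2 + v ^ 2 + w ^ 2 ∧ ∃ r s t : ℤ, c = r * u + s * v + t * w := by
  have hposZ : ∀ x y z : ℤ, (x ≠ 0 ∨ y ≠ 0 ∨ z ≠ 0) →
      0 < a * x ^ 2 + d * y ^ 2 + f * z ^ 2 + 2 * b * x * y + 2 * c * x * z + 2 * e * y * z := by
    intro x y z h
    have := hpos x y z (by exact_mod_cast h)
    exact_mod_cast this
  have hdetR : (a * d * f + 2 * b * c * e - a * e ^ 2 - d * c ^ 2 - f * b ^ 2 : ℝ) = 1 := by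
    exact_mod_cast hdet
  obtain ⟨x1, x2, x3, hx, hxlt⟩ := ternary_exists_int_vec
    (a := a / 2) (b := b / 2) (c := c / 2) (d := d / 2) (e := e / 2) (f := f / 2)
    (by
      intro x y z h
      have := hpos x y z h
      linarith)
    (by linarith)
  have hx1 : a * x1 ^ 2 + d * x2 ^ 2 + f * x3 ^ 2 + 2 * b * x1 * x2 + 2 * c * x1 * x3
      + 2 * e * x2 * x3 = 1 := by
    have h1 := hposZ _ _ _ hx
    have h2 : (a * x1 ^ 2 + d * x2 ^ 2 + f * x3 ^ 2 + 2 * b * x1 * x2 + 2 * c * x1 * x3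
      + 2 * e * x2 * x3 : ℝ) < 2 := by linarith
    have h3 : a * x1 ^ 2 + d * x2 ^ 2 + f * x3 ^ 2 + 2 * b * x1 * x2 + 2 * c * x1 * x3
      + 2 * e * x2 * x3 < 2 := by exact_mod_cast h2
    omega
  obtain ⟨l1, hl1⟩ : ∃ l, l = a * x1 + b * x2 + c * x3 := ⟨_, rfl⟩
  obtain ⟨l2, hl2⟩ : ∃ l, l = b * x1 + d * x2 + e * x3 := ⟨_, rfl⟩
  obtain ⟨l3, hl3⟩ : ∃ l, l = c * x1 + e * x2 + f * x3 := ⟨_, rfl⟩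
  have hdet2 : (a + l1 ^ 2) * (d + l2 ^ 2) * (f + l3 ^ 2)
      + 2 * (b + l1 * l2) * (c + l1 * l3) * (e + l2 * l3) - (a + l1 ^ 2) * (e + l2 * l3) ^ 2
      - (d + l2 ^ 2) * (c + l1 * l3) ^ 2 - (f + l3 ^ 2) * (b + l1 * l2) ^ 2 = 2 := by
    have : (a + l1 ^ 2) * (d + l2 ^ 2) * (f + l3 ^ 2)
      + 2 * (b + l1 * l2) * (c + l1 * l3) * (e + l2 * l3) - (a + l1 ^ 2) * (e + l2 * l3) ^ 2
      - (d + l2 ^ 2) * (c + l1 * l3) ^ 2 - (f + l3 ^ 2) * (b + l1 * l2) ^ 2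
      = (a * d * f + 2 * b * c * e - a * e ^ 2 - d * c ^ 2 - f * b ^ 2) *
        (1 + (a * x1 ^ 2 + d * x2 ^ 2 + f * x3 ^ 2 + 2 * b * x1 * x2 + 2 * c * x1 * x3
          + 2 * e * x2 * x3)) := by
      rw [hl1, hl2, hl3]; ring
    rw [this, hdet, hx1]; norm_num
  have hdet2R : ((a + l1 ^ 2) * (d + l2 ^ 2) * (f + l3 ^ 2)
      + 2 * (b + l1 * l2) * (c + l1 * l3) * (e + l2 * l3) - (a + l1 ^ 2) * (e + l2 * l3) ^ 2
      - (d + l2 ^ 2) * (c + l1 * l3) ^ 2 - (f + l3 ^ 2) * (b + l1 * l2) ^ 2 : ℝ) = 2 := by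
    exact_mod_cast hdet2
  obtain ⟨y1, y2, y3, hy, hylt⟩ := ternary_exists_int_vec
    (a := (a + l1 ^ 2) / 2) (b := (b + l1 * l2) / 2) (c := (c + l1 * l3) / 2)
    (d := (d + l2 ^ 2) / 2) (e := (e + l2 * l3) / 2) (f := (f + l3 ^ 2) / 2)
    (by
      intro x y z h
      have := hpos x y z h
      linarith only [this, sq_nonneg (l1 * x + l2 * y + l3 * z)])
    (by linarith only [hdet2R])
  obtain ⟨g, hg⟩ : ∃ g, g = l1 * y1 + l2 * y2 + l3 * y3 := ⟨_, rfl⟩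
  obtain ⟨q, hq⟩ : ∃ q, q = a * y1 ^ 2 + d * y2 ^ 2 + f * y3 ^ 2 + 2 * b * y1 * y2
      + 2 * c * y1 * y3 + 2 * e * y2 * y3 := ⟨_, rfl⟩
  have hq0 : 0 < q := by
    rw [hq]; exact hposZ _ _ _ hy
  have hqg : q + g ^ 2 < 2 := by
    have : (q + g ^ 2 : ℝ) < 2 := by
      rw [hq, hg]; push_cast; linarith only [hylt]
    exact_mod_cast this
  have hg0 : g = 0 := by
    by_contra h
    have h1 : 0 < g ^ 2 := by positivity
    linarith only [h1, hq0, hqg]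
  have hq1 : q = 1 := by linarith only [hqg, hq0, sq_nonneg g]
  obtain ⟨m1, hm1⟩ : ∃ l, l = a * y1 + b * y2 + c * y3 := ⟨_, rfl⟩
  obtain ⟨m3, hm3⟩ : ∃ l, l = c * y1 + e * y2 + f * y3 := ⟨_, rfl⟩
  obtain ⟨D, hD⟩ : ∃ D, D = a * d * f + 2 * b * c * e - a * e ^ 2 - d * c ^ 2 - f * b ^ 2 :=
    ⟨_, rfl⟩
  obtain ⟨p, hp⟩ : ∃ p, p = a * x1 ^ 2 + d * x2 ^ 2 + f * x3 ^ 2 + 2 * b * x1 * x2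
      + 2 * c * x1 * x3 + 2 * e * x2 * x3 := ⟨_, rfl⟩
  have key1 : p * q * f + 2 * g * l3 * m3 - p * m3 ^ 2 - q * l3 ^ 2 - f * g ^ 2
      = D * (x1 * y2 - x2 * y1) ^ 2 := by
    rw [hp, hq, hg, hm3, hD, hl1, hl2, hl3]; ring
  have key2 : p * (q * c - m1 * m3) - g * (g * c - m1 * l3) + l1 * (g * m3 - q * l3)
      = D * (x1 * y2 - x2 * y1) * (x2 * y3 - x3 * y2) := by
    rw [hp, hq, hg, hm3, hm1, hD, hl1, hl2, hl3]; ring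
  rw [← hp] at hx1
  rw [← hD] at hdet
  rw [hx1, hdet, hq1, hg0] at key1 key2
  refine ⟨l3, m3, x1 * y2 - x2 * y1, by linarith only [key1], l1, m1, x2 * y3 - x3 * y2,
    by linarith only [key2]⟩

theorem sum_three_sq_primitive_of_sq_add_eq_mul {m d a k : ℤ} (hm : 0 < m)
    (hdm : 0 < d * m - 1) (h : a ^ 2 + d = k * (d * m - 1)) :
    ∃ x y z : ℤ, x ^ 2 + y ^ 2 + z ^ 2 = m ∧ ∃ r s t : ℤ, r * x + s * y + t * z = 1 := by
  suffices H : ∃ u v w : ℤ, m = u ^ 2 + v ^ 2 + w ^ 2 ∧ ∃ r s t : ℤ, 1 = r * u + s * v + t * w by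
    obtain ⟨u, v, w, h1, r, s, t, h2⟩ := H
    exact ⟨u, v, w, h1.symm, r, s, t, h2.symm⟩
  refine unimodular_ternary_eq_sum_three_sq (a := k) (b := a) (c := 1) (d := d * m - 1) (e := 0)
      (f := m) ?_ ?_
  · intro x y z hxyz
    have hm' : (0 : ℝ) < m := by exact_mod_cast hm
    have hdm' : (0 : ℝ) < d * m - 1 := by exact_mod_cast hdm
    have h' : (a : ℝ) ^ 2 + d = k * (d * m - 1) := by exact_mod_cast h
    set D : ℝ := d * m - 1 with hD
    set Q : ℝ := k * x ^ 2 + D * y ^ 2 + m * z ^ 2 + 2 * a * x * y + 2 * 1 * x * z + 2 * 0 * y * z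
      with hQ
    have key : m * D * Q = D * (m * z + x) ^ 2 + m * (D * y + a * x) ^ 2 + x ^ 2 := by
      have : m * D * Q = m * D * y * (D * y + 2 * a * x) + D * m * z * (m * z + 2 * x)
          + m * (k * D) * x ^ 2 := by rw [hQ]; ring
      rw [this, ← h']
      have hd' : (d : ℝ) * m = D + 1 := by rw [hD]; ring
      linear_combination x ^ 2 * hd'
    have hpos : 0 < m * D * Q := by
      rw [key]
      have e1 : 0 ≤ D * (m * z + x) ^ 2 := by positivity
      have e2 : 0 ≤ m * (D * y + a * x) ^ 2 := by positivity
      by_contra hcon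
      have h3 : x ^ 2 = 0 := by nlinarith [sq_nonneg x]
      have hx : x = 0 := by simpa using h3
      have h4 : D * (m * z + x) ^ 2 = 0 := by nlinarith [sq_nonneg x]
      have h5 : m * (D * y + a * x) ^ 2 = 0 := by nlinarith [sq_nonneg x]
      subst hx
      have hz : z = 0 := by simpa [hdm'.ne', hm'.ne'] using h4
      have hy : y = 0 := by simpa [hdm'.ne', hm'.ne'] using h5
      simp [hz, hy] at hxyz
    have : 0 < Q := by
      by_contra hcon
      have : m * D * Q ≤ 0 := mul_nonpos_of_nonneg_of_nonpos (by positivity) (by linarith)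
      linarith
    have e3 : ((d * m - 1 : ℤ) : ℝ) = D := by push_cast; rfl
    rw [e3]; simpa [hQ] using this
  · linear_combination -m * h

theorem exists_sq_add_of_jacobiSym {d : ℤ} {p : ℕ} (hp : p.Prime)
    (h : jacobiSym (-d) p = 1) : ∃ a : ℤ, (p : ℤ) ∣ a ^ 2 + d := by
  have := Fact.mk hp
  obtain ⟨y, hy⟩ := ZMod.isSquare_of_jacobiSym_eq_one h
  obtain ⟨a, rfl⟩ := ZMod.intCast_surjective y
  refine ⟨a, ?_⟩
  rw [← ZMod.intCast_zmod_eq_zero_iff_dvd]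
  push_cast at hy ⊢
  linear_combination -hy

theorem exists_prime_eq_mul_add {q a : ℕ} (hq : 0 < q) (h : a.Coprime q) :
    ∃ p j : ℕ, 3 < p ∧ p.Prime ∧ p = q * j + a := by
  have : NeZero q := ⟨hq.ne'⟩
  obtain ⟨p, hp1, hp2, hp3⟩ := Nat.forall_exists_prime_gt_and_eq_mod
    ((ZMod.isUnit_iff_coprime a q).2 h) (a + 3)
  have h1 : a ≡ p [MOD q] := ((ZMod.natCast_eq_natCast_iff _ _ _).1 hp3).symm
  obtain ⟨j, hj⟩ := (Nat.modEq_iff_dvd' (by omega)).1 h1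
  exact ⟨p, j, by omega, hp2, by omega⟩

theorem sum_three_sq_primitive_of_mod_four_eq_two {m : ℕ} (hm : m % 4 = 2) :
    ∃ x y z : ℤ, x ^ 2 + y ^ 2 + z ^ 2 = m ∧ ∃ r s t : ℤ, r * x + s * y + t * z = 1 := by
  have hc : (m - 1).Coprime (4 * m) := by
    refine Nat.Coprime.mul_right ?_ ?_
    · exact Nat.Coprime.pow_right 2 (Nat.coprime_two_right.2 (Nat.odd_iff.2 (by omega)))
    · have h := (Nat.coprime_self_add_right (m := m - 1) (n := 1)).2 (Nat.coprime_one_right _)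
      rwa [Nat.sub_add_cancel (by omega)] at h
  obtain ⟨p, j, hp3, hp, hpj⟩ := exists_prime_eq_mul_add (by omega) hc
  have hd : ((4 * j + 1 : ℕ) : ℤ) * m - 1 = p := by
    rw [hpj]; push_cast [Nat.cast_sub (show 1 ≤ m by omega)]; ring
  have hp4 : p % 4 = 1 := by
    have : p = 4 * (m * j) + (m - 1) := by rw [hpj]; ring
    omega
  have hodd : Odd (4 * j + 1) := ⟨2 * j, by ring⟩
  have hpodd : Odd p := Nat.odd_iff.2 (by omega)
  have hJ : jacobiSym (-((4 * j + 1 : ℕ) : ℤ)) p = 1 := by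
    rw [neg_eq_neg_one_mul, jacobiSym.mul_left, jacobiSym.at_neg_one hpodd,
      ZMod.χ₄_nat_one_mod_four hp4, one_mul,
      jacobiSym.quadratic_reciprocity_one_mod_four (by omega) hpodd,
      jacobiSym.mod_left' (a₂ := -1), jacobiSym.at_neg_one hodd,
      ZMod.χ₄_nat_one_mod_four (by omega)]
    rw [show (p : ℤ) = -1 + (4 * j + 1 : ℕ) * m by linear_combination -hd,
      Int.add_mul_emod_self_left]
  obtain ⟨a, k, hk⟩ := exists_sq_add_of_jacobiSym hp hJ
  refine sum_three_sq_primitive_of_sq_add_eq_mul (d := ((4 * j + 1 : ℕ) : ℤ)) (a := a) (k := k)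
    (by omega) (by rw [hd]; exact_mod_cast hp.pos) ?_
  rw [hd, hk]; ring

theorem sum_three_sq_primitive_of_odd {m c : ℕ} (hm : 0 < m) (h : m % 8 = 3 ∧ c = 1 ∨
    m % 8 = 1 ∧ c = 3 ∨ m % 8 = 5 ∧ c = 3) :
    ∃ x y z : ℤ, x ^ 2 + y ^ 2 + z ^ 2 = m ∧ ∃ r s t : ℤ, r * x + s * y + t * z = 1 := by
  obtain ⟨e, he⟩ : ∃ e, c * m = 2 * e + 1 := by
    rcases h with ⟨h, rfl⟩ | ⟨h, rfl⟩ | ⟨h, rfl⟩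
    · exact ⟨m / 2, by omega⟩
    · exact ⟨(3 * m) / 2, by omega⟩
    · exact ⟨(3 * m) / 2, by omega⟩
  have heo : e % 2 = 1 := by
    rcases h with ⟨h, rfl⟩ | ⟨h, rfl⟩ | ⟨h, rfl⟩ <;> omega
  have hc : e.Coprime (4 * m) := by
    refine Nat.Coprime.mul_right ?_ ?_
    · exact Nat.Coprime.pow_right 2 (Nat.coprime_two_right.2 (Nat.odd_iff.2 heo))
    · have h1 : e.Coprime (c * m) := by
        rw [he, add_comm]
        exact (Nat.coprime_add_mul_right_right e 1 2).2 (Nat.coprime_one_right _)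
      exact h1.coprime_mul_left_right
  obtain ⟨p, j, hp3, hp, hpj⟩ := exists_prime_eq_mul_add (by omega) hc
  have hd : ((8 * j + c : ℕ) : ℤ) * m - 1 = 2 * p := by
    have he' : (c : ℤ) * m = 2 * e + 1 := by exact_mod_cast he
    rw [hpj]; push_cast; linear_combination he'
  have hc13 : c = 1 ∨ c = 3 := by omega
  have hodd : Odd (8 * j + c) := Nat.odd_iff.2 (by omega)
  have hpe : p = 4 * (m * j) + e := by rw [hpj]; ring
  have hpodd : Odd p := Nat.odd_iff.2 (by omega)
  have hJ2 : jacobiSym (p : ℤ) (8 * j + c) = 1 := by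
    have h1 : jacobiSym (-2 * (p : ℤ)) (8 * j + c) = 1 := by
      rw [jacobiSym.mod_left' (a₂ := 1), jacobiSym.one_left]
      rw [show -2 * (p : ℤ) = 1 + (8 * j + c : ℕ) * (-m) by linear_combination hd]
      simp
    have h2 : jacobiSym (-2) (8 * j + c) = 1 := by
      rw [jacobiSym.at_neg_two hodd, ZMod.χ₈'_nat_eq_if_mod_eight]
      rcases hc13 with rfl | rfl
      · rw [if_neg (by omega), if_pos (by omega)]
      · rw [if_neg (by omega), if_pos (by omega)]
    rwa [jacobiSym.mul_left, h2, one_mul] at h1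
  have hJ : jacobiSym (-((8 * j + c : ℕ) : ℤ)) p = 1 := by
    rw [neg_eq_neg_one_mul, jacobiSym.mul_left, jacobiSym.at_neg_one hpodd]
    rcases (show p % 4 = 1 ∨ p % 4 = 3 by have := Nat.odd_iff.1 hpodd; omega) with hp4 | hp4
    · rw [ZMod.χ₄_nat_one_mod_four hp4, one_mul,
        jacobiSym.quadratic_reciprocity_one_mod_four' hodd hp4, hJ2]
    · have : (8 * j + c) % 4 = 3 := by
        rcases h with ⟨h, rfl⟩ | ⟨h, rfl⟩ | ⟨h, rfl⟩ <;> omega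
      rw [ZMod.χ₄_nat_three_mod_four hp4,
        jacobiSym.quadratic_reciprocity_three_mod_four this hp4, hJ2]
      norm_num
  obtain ⟨a, k, hk⟩ := exists_sq_add_of_jacobiSym hp hJ
  obtain ⟨b, hb2, l, hl⟩ : ∃ b : ℤ, b % 2 = 1 ∧ (p : ℤ) ∣ b ^ 2 + (8 * j + c : ℕ) := by
    rcases Int.emod_two_eq_zero_or_one a with h0 | h0
    · refine ⟨a + p, ?_, k + 2 * a + p, ?_⟩
      · have := Nat.odd_iff.1 hpodd; omega
      · linear_combination hk
    · exact ⟨a, h0, k, hk⟩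
  have h2l : (2 : ℤ) ∣ l := by
    have h1 : (2 : ℤ) ∣ p * l := by
      rw [← hl]
      have e1 : b ^ 2 % 2 = 1 := by
        rw [pow_two, Int.mul_emod, hb2]; norm_num
      have := Nat.odd_iff.1 hodd
      omega
    refine (Int.Prime.dvd_mul' Nat.prime_two h1).resolve_left ?_
    have := Nat.odd_iff.1 hpodd
    omega
  obtain ⟨k', rfl⟩ := h2l
  refine sum_three_sq_primitive_of_sq_add_eq_mul (d := ((8 * j + c : ℕ) : ℤ)) (a := b) (k := k')
    (by omega)
    (by rw [hd]; have := hp.pos; omega) ?_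
  rw [hd, hl]; ring

theorem sum_three_sq_primitive {m : ℕ} (hm : 0 < m) (h4 : ¬ 4 ∣ m) (h7 : m % 8 ≠ 7) :
    ∃ x y z : ℤ, x ^ 2 + y ^ 2 + z ^ 2 = m ∧ ∃ r s t : ℤ, r * x + s * y + t * z = 1 := by
  rcases (show m % 4 = 2 ∨ m % 8 = 3 ∨ m % 8 = 1 ∨ m % 8 = 5 by omega) with h | h | h | h
  · exact sum_three_sq_primitive_of_mod_four_eq_two h
  · exact sum_three_sq_primitive_of_odd (c := 1) hm (by omega)
  · exact sum_three_sq_primitive_of_odd (c := 3) hm (by omega)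
  · exact sum_three_sq_primitive_of_odd (c := 3) hm (by omega)

section Lipschitz

open Quaternion

namespace Lipschitz

theorem exists_near_multiple {A : ℤ} (hA : 0 < A) (w : ℤ) :
    ∃ g e : ℤ, w = A * g + e ∧ (2 * e) ^ 2 ≤ A ^ 2 := by
  have h1 := Int.emod_nonneg w hA.ne'
  have h2 := Int.emod_lt_of_pos w hA
  have h3 := Int.mul_ediv_add_emod w A
  by_cases h : 2 * (w % A) ≤ A
  · exact ⟨w / A, w % A, h3.symm, by nlinarith⟩
  · refine ⟨w / A + 1, w % A - A, by linarith, by nlinarith⟩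

theorem normSq_pos {α : ℍ[ℤ]} (hα : α ≠ 0) : 0 < normSq α :=
  lt_of_le_of_ne normSq_nonneg (fun h => hα (normSq_eq_zero.1 h.symm))

theorem mul_star_right_cancel {α β γ : ℍ[ℤ]} (hα : α ≠ 0) (h : β * star α = γ * star α) :
    β = γ :=
  mul_right_cancel₀ (star_ne_zero.2 hα) h

theorem exists_coords (a b c d : ℤ) :
    ∃ q : ℍ[ℤ], q.re = a ∧ q.imI = b ∧ q.imJ = c ∧ q.imK = d :=
  ⟨⟨a, b, c, d⟩, rfl, rfl, rfl, rfl⟩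

theorem self_mul_star_eq_smul (α : ℍ[ℤ]) : α * star α = normSq α • (1 : ℍ[ℤ]) := by
  rw [self_mul_star, ← coe_mul_eq_smul, mul_one]

theorem euclid_or_two_smul_eq {α : ℍ[ℤ]} (hα : α ≠ 0) (β : ℍ[ℤ]) :
    (∃ γ, normSq (β - γ * α) < normSq α) ∨ ∃ δ, (2 : ℤ) • β = δ * α := by
  have hA := normSq_pos hα
  set A := normSq α with hAdef
  set w := β * star α with hw
  obtain ⟨g0, e0, h0, h0'⟩ := exists_near_multiple hA w.re
  obtain ⟨g1, e1, h1, h1'⟩ := exists_near_multiple hA w.imI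
  obtain ⟨g2, e2, h2, h2'⟩ := exists_near_multiple hA w.imJ
  obtain ⟨g3, e3, h3, h3'⟩ := exists_near_multiple hA w.imK
  by_cases hlt : e0 ^ 2 + e1 ^ 2 + e2 ^ 2 + e3 ^ 2 < A ^ 2
  · left
    obtain ⟨γ, c0, c1, c2, c3⟩ := exists_coords g0 g1 g2 g3
    refine ⟨γ, ?_⟩
    have key : (β - γ * α) * star α = w - A • γ := by
      rw [sub_mul, mul_assoc, self_mul_star_eq_smul, ← hw, ← hAdef, mul_smul_comm, mul_one]
    have h := congrArg normSq key
    rw [map_mul, normSq_star, normSq_def' (w - A • γ)] at h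
    simp only [re_sub, imI_sub, imJ_sub, imK_sub, re_smul, imI_smul, imJ_smul, imK_smul, h0, h1,
      h2, h3, c0, c1, c2, c3, smul_eq_mul, add_sub_cancel_left] at h
    nlinarith
  · right
    have f0 : (2 * e0) ^ 2 = A ^ 2 := by linarith
    have f1 : (2 * e1) ^ 2 = A ^ 2 := by linarith
    have f2 : (2 * e2) ^ 2 = A ^ 2 := by linarith
    have f3 : (2 * e3) ^ 2 = A ^ 2 := by linarith
    have aux : ∀ {w g e : ℤ}, w = A * g + e → (2 * e) ^ 2 = A ^ 2 → ∃ d, 2 * w = A * d := by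
      intro w g e h h'
      rcases sq_eq_sq_iff_eq_or_eq_neg.1 h' with h' | h'
      · exact ⟨2 * g + 1, by rw [h]; linear_combination h'⟩
      · exact ⟨2 * g - 1, by rw [h]; linear_combination h'⟩
    obtain ⟨d0, k0⟩ := aux h0 f0
    obtain ⟨d1, k1⟩ := aux h1 f1
    obtain ⟨d2, k2⟩ := aux h2 f2
    obtain ⟨d3, k3⟩ := aux h3 f3
    obtain ⟨δ, c0, c1, c2, c3⟩ := exists_coords d0 d1 d2 d3
    refine ⟨δ, mul_star_right_cancel hα ?_⟩
    rw [smul_mul_assoc, ← hw, mul_assoc, self_mul_star_eq_smul, ← hAdef, mul_smul_comm, mul_one]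
    ext <;> simp only [re_smul, imI_smul, imJ_smul, imK_smul, smul_eq_mul, k0, k1, k2, k3, c0, c1,
      c2, c3]

theorem even_of_four_dvd_sum_three_sq {a b c : ℤ} (h : 4 ∣ a ^ 2 + b ^ 2 + c ^ 2) :
    2 ∣ a ∧ 2 ∣ b ∧ 2 ∣ c := by
  have aux : ∀ t : ℤ, t % 2 = 0 ∧ t ^ 2 % 4 = 0 ∨ t % 2 = 1 ∧ t ^ 2 % 4 = 1 := by
    intro t
    rcases Int.emod_two_eq_zero_or_one t with h | h
    · left; refine ⟨h, ?_⟩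
      obtain ⟨k, rfl⟩ := Int.dvd_of_emod_eq_zero h
      rw [show (2 * k) ^ 2 = 4 * k ^ 2 by ring]; omega
    · right; exact ⟨h, Int.sq_mod_four_eq_one_of_odd (Int.odd_iff.2 h)⟩
  have ha := aux a; have hb := aux b; have hc := aux c
  omega

/-- A pure integral quaternion whose norm is divisible by `4` is twice an integral one. -/
theorem exists_two_smul_eq {y : ℍ[ℤ]} (h0 : y.re = 0) (h : 4 ∣ normSq y) :
    ∃ z : ℍ[ℤ], z.re = 0 ∧ y = (2 : ℤ) • z ∧ normSq y = 4 * normSq z := by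
  rw [normSq_def', h0] at h
  obtain ⟨⟨a, ha⟩, ⟨b, hb⟩, ⟨c, hc⟩⟩ :=
    even_of_four_dvd_sum_three_sq (a := y.imI) (b := y.imJ) (c := y.imK) (by simpa using h)
  obtain ⟨z, c0, c1, c2, c3⟩ := exists_coords 0 a b c
  refine ⟨z, c0, ?_, ?_⟩
  · ext <;> simp only [re_smul, imI_smul, imJ_smul, imK_smul, smul_eq_mul, h0, ha, hb, hc, c0, c1,
      c2, c3, mul_zero]
  · rw [normSq_def', normSq_def', h0, ha, hb, hc, c0, c1, c2, c3]; ring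

theorem exists_conj_of_sq_add_dvd {x : ℍ[ℤ]} (hx : x.re = 0) {n : ℤ} (hn : 0 < n)
    (hodd : n % 2 = 1) (hcop : IsCoprime n (normSq x)) {b : ℤ} (hb : n ∣ b ^ 2 + normSq x) :
    ∃ α y : ℍ[ℤ], y.re = 0 ∧ normSq y = normSq x ∧ α * x = y * α ∧
      ∃ k : ℤ, (k = 1 ∨ k = 2 ∨ k = 4) ∧ normSq α = k * n := by
  obtain ⟨l, hl⟩ := hb
  set m := normSq x with hm
  have hxs : star x = -x := by ext <;> simp [hx]
  have hxx : x * x = -(m • (1 : ℍ[ℤ])) := by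
    have h := self_mul_star_eq_smul x
    rw [hxs, ← hm, mul_neg] at h
    rw [← h, neg_neg]
  let I : Set ℍ[ℤ] := {α | ∃ β γ : ℍ[ℤ], α = n • β + γ * (b • 1 + x)}
  have hIn : n • (1 : ℍ[ℤ]) ∈ I := ⟨1, 0, by simp⟩
  have hIx : b • (1 : ℍ[ℤ]) + x ∈ I := ⟨0, 1, by simp⟩
  have hInx : n • (1 : ℍ[ℤ]) + (b • 1 + x) ∈ I := ⟨1, 1, by simp⟩
  have hsub : ∀ α ∈ I, ∀ β ∈ I, ∀ γ : ℍ[ℤ], β - γ * α ∈ I := by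
    rintro _ ⟨β, γ, rfl⟩ _ ⟨β', γ', rfl⟩ δ
    refine ⟨β' - δ * β, γ' - δ * γ, ?_⟩
    rw [mul_add δ, mul_smul_comm, ← mul_assoc, sub_mul, smul_sub]
    abel
  have hn0 : n • (1 : ℍ[ℤ]) ≠ 0 := smul_ne_zero hn.ne' one_ne_zero
  obtain ⟨α, ⟨hαI, hα⟩, hmin⟩ := (measure (fun α : ℍ[ℤ] => (normSq α).toNat)).wf.has_min
    {α | α ∈ I ∧ α ≠ 0} ⟨_, hIn, hn0⟩
  have hA := normSq_pos hα
  have hdiv : ∀ β ∈ I, normSq α ∣ 4 * normSq β := by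
    intro β hβ
    obtain ⟨δ, hδ⟩ : ∃ δ, (2 : ℤ) • β = δ * α := by
      rcases euclid_or_two_smul_eq hα β with ⟨γ, hγ⟩ | h
      · have h0 : β - γ * α = 0 := by
          by_contra hne
          refine hmin (β - γ * α) ⟨hsub α hαI β hβ γ, hne⟩ ?_
          have := normSq_pos hne
          change (normSq (β - γ * α)).toNat < (normSq α).toNat
          omega
        exact ⟨(2 : ℤ) • γ, by rw [sub_eq_zero.1 h0, smul_mul_assoc]⟩
      · exact h
    have h := congrArg normSq hδ
    rw [normSq_smul, map_mul] at h
    exact ⟨normSq δ, by linear_combination h⟩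
  obtain ⟨β, γ, hαβ⟩ := hαI
  have hnorm_b : normSq (b • (1 : ℍ[ℤ]) + x) = n * l := by
    rw [← hl, hm, normSq_def', normSq_def']; simp [hx]; ring
  have hnorm_nb : normSq (n • (1 : ℍ[ℤ]) + (b • 1 + x)) = n * (n + 2 * b + l) := by
    have : n * (n + 2 * b + l) = (n + b) ^ 2 + m := by linear_combination -hl
    rw [this, hm, normSq_def', normSq_def']; simp [hx]; ring
  have hnα : n ∣ normSq α := by
    have : normSq α = n * (n * normSq β + 2 * (β.re * (γ * (b • 1 + x)).re +
        β.imI * (γ * (b • 1 + x)).imI + β.imJ * (γ * (b • 1 + x)).imJ +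
        β.imK * (γ * (b • 1 + x)).imK)) + normSq (γ * (b • 1 + x)) := by
      rw [hαβ]
      generalize γ * (b • 1 + x) = w
      simp only [normSq_def', re_add, imI_add, imJ_add, imK_add, re_smul, imI_smul, imJ_smul,
        imK_smul, smul_eq_mul]
      ring
    rw [this, map_mul, hnorm_b]
    exact dvd_add (dvd_mul_right _ _) ⟨normSq γ * l, by ring⟩
  obtain ⟨k, hk⟩ := hnα
  have hkpos : 0 < k := by rw [hk] at hA; exact (pos_iff_pos_of_mul_pos hA).1 hn
  have h1 : k ∣ 4 * n := by
    have := hdiv _ hIn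
    rw [hk, normSq_smul, map_one] at this
    exact Int.dvd_of_mul_dvd_mul_left hn.ne' (by convert this using 1; ring)
  have h8 : k ∣ 8 := by
    have e1 : k ∣ 4 * l := by
      have := hdiv _ hIx
      rw [hk, hnorm_b] at this
      exact Int.dvd_of_mul_dvd_mul_left hn.ne' (by convert this using 1; ring)
    have e2 : k ∣ 4 * (n + 2 * b + l) := by
      have := hdiv _ hInx
      rw [hk, hnorm_nb] at this
      exact Int.dvd_of_mul_dvd_mul_left hn.ne' (by convert this using 1; ring)
    have e3 : k ∣ 8 * b := by
      have := dvd_sub (dvd_sub e2 e1) h1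
      rwa [show 4 * (n + 2 * b + l) - 4 * l - 4 * n = 8 * b by ring] at this
    obtain ⟨u, v, huv⟩ := hcop
    have e4 : (8 : ℤ) = 4 * n * (2 * (u + v * l)) - 8 * b * (v * b) := by
      linear_combination (-8) * huv + 8 * v * hl
    rw [e4]
    exact dvd_sub (dvd_mul_of_dvd_left h1 _) (dvd_mul_of_dvd_left e3 _)
  have hk124 : k = 1 ∨ k = 2 ∨ k = 4 := by
    have := Int.le_of_dvd (by norm_num) h8
    obtain ⟨c, hc⟩ := h1
    interval_cases k <;> omega
  obtain ⟨z, hz⟩ : ∃ z : ℍ[ℤ], α * x = n • z + b • α := by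
    refine ⟨β * x - l • γ - b • β, ?_⟩
    have e1 : (b • (1 : ℍ[ℤ]) + x) * x = b • (b • 1 + x) - (n * l) • 1 := by
      rw [add_mul, hxx, ← hl, smul_mul_assoc, one_mul]
      module
    rw [hαβ, add_mul, mul_assoc, e1, mul_sub, mul_smul_comm, mul_smul_comm, mul_one,
      smul_mul_assoc]
    module
  set y₀ := z * star α + (b * k) • 1 with hy₀
  have hny : n • y₀ = α * x * star α := by
    rw [hz, add_mul, smul_mul_assoc, smul_mul_assoc, self_mul_star_eq_smul, hk, hy₀]
    module
  have hre : y₀.re = 0 := by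
    have h := congrArg (fun q : ℍ[ℤ] => q.re) hny
    have h' : (α * x * star α).re = 0 := by simp [hx]; ring
    simp only [h', re_smul, smul_eq_mul, mul_eq_zero] at h
    exact h.resolve_left hn.ne'
  have hnorm : normSq y₀ = k ^ 2 * m := by
    have h := congrArg normSq hny
    rw [normSq_smul, map_mul, map_mul, normSq_star, hk, ← hm] at h
    refine mul_left_cancel₀ (pow_ne_zero 2 hn.ne') ?_
    rw [h]; ring
  obtain ⟨y, hy0, hyk, hym⟩ : ∃ y : ℍ[ℤ], y.re = 0 ∧ y₀ = k • y ∧ normSq y = m := by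
    rcases hk124 with rfl | rfl | rfl
    · exact ⟨y₀, hre, by simp, by linarith⟩
    · obtain ⟨y, e1, e2, e3⟩ := exists_two_smul_eq hre ⟨m, by linarith⟩
      exact ⟨y, e1, e2, by linarith⟩
    · obtain ⟨y, e1, e2, e3⟩ := exists_two_smul_eq hre ⟨4 * m, by linarith⟩
      obtain ⟨y', f1, f2, f3⟩ := exists_two_smul_eq e1 ⟨m, by linarith⟩
      exact ⟨y', f1, by rw [e2, f2, smul_smul]; norm_num, by linarith⟩
  refine ⟨α, y, hy0, hym, mul_star_right_cancel hα ?_, k, hk124, by rw [hk, mul_comm]⟩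
  rw [← hny, hyk, mul_assoc, self_mul_star_eq_smul, hk, mul_smul_comm, mul_one, smul_smul]

theorem exists_of_commute {x q : ℍ[ℤ]} (hx : x.re = 0)
    (hprim : ∃ r s t : ℤ, r * x.imI + s * x.imJ + t * x.imK = 1) (h : q * x = x * q) :
    ∃ t : ℤ, q = q.re • 1 + t • x := by
  obtain ⟨r, s, t, hrst⟩ := hprim
  have h1 := congrArg (fun q : ℍ[ℤ] => q.imI) h
  have h2 := congrArg (fun q : ℍ[ℤ] => q.imJ) h
  have h3 := congrArg (fun q : ℍ[ℤ] => q.imK) h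
  simp only [imI_mul, imJ_mul, imK_mul, hx] at h1 h2 h3
  have hJK : q.imJ * x.imK = q.imK * x.imJ := by linarith
  have hKI : q.imK * x.imI = q.imI * x.imK := by linarith
  have hIJ : q.imI * x.imJ = q.imJ * x.imI := by linarith
  refine ⟨r * q.imI + s * q.imJ + t * q.imK, ?_⟩
  ext
  · simp [hx]
  · simp only [imI_add, imI_smul, imI_one, smul_eq_mul]
    linear_combination (-q.imI) * hrst + s * hIJ - t * hKI
  · simp only [imJ_add, imJ_smul, imJ_one, smul_eq_mul]
    linear_combination (-q.imJ) * hrst - r * hIJ + t * hJK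
  · simp only [imK_add, imK_smul, imK_one, smul_eq_mul]
    linear_combination (-q.imK) * hrst + r * hKI - hJK * s

/-- The number of integral quaternions of bounded norm conjugating one primitive pure quaternion
to another one. -/
theorem card_conj_le {x y : ℍ[ℤ]} (hx : x.re = 0) (hy : y.re = 0)
    (hprim : ∃ r s t : ℤ, r * x.imI + s * x.imJ + t * x.imK = 1) {m : ℕ} (hm : normSq x = m)
    (hm0 : 0 < m) {Y : ℝ} (hY : m ≤ Y) (F : Finset ℍ[ℤ])
    (hF : ∀ α ∈ F, α ≠ 0 ∧ α * x = y * α ∧ ((normSq α : ℤ) : ℝ) ≤ Y) :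
    (F.card : ℝ) ≤ 12 * (Y / √m) := by
  have hm0' : (1 : ℝ) ≤ m := by exact_mod_cast hm0
  have hY0 : 0 < Y := by linarith
  have hsm : 0 < √(m : ℝ) := Real.sqrt_pos.2 (by linarith)
  rcases F.eq_empty_or_nonempty with rfl | ⟨α₁, hα₁⟩
  · simp only [Finset.card_empty, Nat.cast_zero]; positivity
  obtain ⟨α, ⟨hα, hαx⟩, hmin'⟩ := (measure (fun α : ℍ[ℤ] => (normSq α).toNat)).wf.has_min
    {α | α ≠ 0 ∧ α * x = y * α} ⟨α₁, (hF _ hα₁).1, (hF _ hα₁).2.1⟩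
  have hA := normSq_pos hα
  have hmin : ∀ β : ℍ[ℤ], β * x = y * β → normSq β < normSq α → β = 0 := by
    intro β h1 h2
    by_contra hne
    refine hmin' β ⟨hne, h1⟩ ?_
    change (normSq β).toNat < (normSq α).toNat
    omega
  set a := normSq α with ha
  have hAR : (0 : ℝ) < a := by exact_mod_cast hA
  have haY : (a : ℝ) ≤ Y := by
    by_contra hcon
    have h1 := hF _ hα₁
    refine h1.1 (hmin _ h1.2.1 ?_)
    have : ((normSq α₁ : ℤ) : ℝ) < a := by linarith
    exact_mod_cast this
  have hsx : star x = -x := by ext <;> simp [hx]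
  have hsy : star y = -y := by ext <;> simp [hy]
  have hαx' : x * star α = star α * y := by
    have := congrArg star hαx
    rwa [star_mul, star_mul, hsx, hsy, neg_mul, mul_neg, neg_inj] at this
  have hrep : ∀ β : ℍ[ℤ], β * x = y * β →
      ∃ t : ℤ, star α * β = (star α * β).re • 1 + t • x := by
    intro β hβ
    refine exists_of_commute hx hprim ?_
    rw [mul_assoc, hβ, ← mul_assoc, ← mul_assoc, hαx']
  choose! T hT using hrep
  have hN : ∀ β : ℍ[ℤ], β * x = y * β → a * normSq β = (star α * β).re ^ 2 + m * T β ^ 2 := by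
    intro β hβ
    have h1 := congrArg normSq (hT β hβ)
    rw [map_mul, normSq_star, ← ha] at h1
    rw [h1, ← hm, normSq_def', normSq_def']
    simp only [re_add, imI_add, imJ_add, imK_add, re_smul, imI_smul, imJ_smul, imK_smul, hx,
      re_one, imI_one, imJ_one, imK_one, smul_eq_mul]
    ring
  set P : ℤ := ⌊√(a * Y / m)⌋ with hP
  set R : ℤ := ⌊√(Y / a)⌋ with hR
  have hP0 : 0 ≤ P := Int.floor_nonneg.2 (Real.sqrt_nonneg _)
  have hR0 : 0 ≤ R := Int.floor_nonneg.2 (Real.sqrt_nonneg _)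
  have hcard : F.card ≤ (Finset.Icc (-P) P ×ˢ Finset.Icc (-R - 1) R).card := by
    refine Finset.card_le_card_of_injOn (fun β => (T β, (star α * β).re / a)) ?_ ?_
    · intro β hβ
      obtain ⟨-, h1, h2⟩ := hF β hβ
      have h3 := hN β h1
      have h4 : (a : ℝ) * normSq β = ((star α * β).re : ℝ) ^ 2 + m * (T β : ℝ) ^ 2 := by
        exact_mod_cast h3
      set s := (star α * β).re
      have h5 : (a : ℝ) * normSq β ≤ a * Y := mul_le_mul_of_nonneg_left h2 hAR.le
      have hT2 : |(T β : ℝ)| ≤ √(a * Y / m) := by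
        refine Real.abs_le_sqrt ?_
        rw [le_div_iff₀ (by linarith)]
        nlinarith [sq_nonneg (s : ℝ)]
      have hs2 : |(s / a : ℝ)| ≤ √(Y / a) := by
        refine Real.abs_le_sqrt ?_
        rw [div_pow, div_le_div_iff₀ (by positivity) hAR]
        have : (s : ℝ) ^ 2 ≤ a * Y := by
          nlinarith [mul_nonneg (by linarith : (0 : ℝ) ≤ m) (sq_nonneg (T β : ℝ))]
        nlinarith
      have e1 : |T β| ≤ P := Int.le_floor.2 (by push_cast; exact hT2)
      rw [abs_le] at hs2 e1
      have e2 : s / a ≤ R := by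
        refine Int.le_floor.2 (le_trans ?_ hs2.2)
        rw [le_div_iff₀ hAR]
        exact_mod_cast Int.ediv_mul_le s hA.ne'
      have e3 : -R - 1 ≤ s / a := by
        have h6 : √(Y / a) < R + 1 := Int.lt_floor_add_one _
        rw [Int.le_ediv_iff_mul_le hA]
        have : -((R : ℝ) + 1) < s / a := by linarith [hs2.1]
        rw [lt_div_iff₀ hAR] at this
        have : (-R - 1) * a < s := by
          have h7 : (((-R - 1) * a : ℤ) : ℝ) < s := by push_cast; linarith
          exact_mod_cast h7
        exact this.le
      simp only [Finset.coe_product, Finset.coe_Icc, Set.mem_prod, Set.mem_Icc]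
      exact ⟨e1, e3, e2⟩
    · intro β hβ γ hγ h
      simp only [Prod.mk.injEq] at h
      obtain ⟨-, hβ1, -⟩ := hF β hβ
      obtain ⟨-, hγ1, -⟩ := hF γ hγ
      have hd : (β - γ) * x = y * (β - γ) := by rw [sub_mul, mul_sub, hβ1, hγ1]
      have h0 : star α * (β - γ) = ((star α * β).re - (star α * γ).re) • 1 := by
        rw [mul_sub, hT β hβ1, hT γ hγ1, h.1]
        simp only [re_add, re_smul, re_one, hx]
        module
      have hn : a * normSq (β - γ) = ((star α * β).re - (star α * γ).re) ^ 2 := by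
        have := congrArg normSq h0
        rwa [map_mul, normSq_star, normSq_smul, map_one, mul_one, ← ha] at this
      refine sub_eq_zero.1 (hmin _ hd ?_)
      have e1 := Int.mul_ediv_add_emod (star α * β).re a
      have e2 := Int.mul_ediv_add_emod (star α * γ).re a
      have e3 := Int.emod_nonneg (star α * β).re hA.ne'
      have e4 := Int.emod_nonneg (star α * γ).re hA.ne'
      have e5 := Int.emod_lt_of_pos (star α * β).re hA
      have e6 := Int.emod_lt_of_pos (star α * γ).re hA
      rw [h.2] at e1
      have e7 : ((star α * β).re - (star α * γ).re) ^ 2 < a ^ 2 :=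
        sq_lt_sq' (by linarith) (by linarith)
      nlinarith
  have hcard' : (F.card : ℝ) ≤ (2 * √(a * Y / m) + 1) * (2 * √(Y / a) + 2) := by
    have h1 : ((Finset.Icc (-P) P ×ˢ Finset.Icc (-R - 1) R).card : ℝ)
        = (2 * P + 1) * (2 * R + 2) := by
      rw [Finset.card_product, Int.card_Icc, Int.card_Icc]
      have e1 : (((P + 1 - -P).toNat : ℤ) : ℝ) = 2 * P + 1 := by
        rw [Int.toNat_of_nonneg (by linarith)]; push_cast; ring
      have e2 : (((R + 1 - (-R - 1)).toNat : ℤ) : ℝ) = 2 * R + 2 := by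
        rw [Int.toNat_of_nonneg (by linarith)]; push_cast; ring
      push_cast at e1 e2 ⊢
      rw [e1, e2]
    have hP' : (P : ℝ) ≤ √(a * Y / m) := Int.floor_le _
    have hR' : (R : ℝ) ≤ √(Y / a) := Int.floor_le _
    have hP0' : (0 : ℝ) ≤ P := by exact_mod_cast hP0
    have hR0' : (0 : ℝ) ≤ R := by exact_mod_cast hR0
    calc (F.card : ℝ) ≤ _ := by exact_mod_cast hcard
      _ = _ := h1
      _ ≤ _ := by gcongr
  refine hcard'.trans ?_
  have k1 : √(a * Y / m) * √(Y / a) = Y / √m := by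
    rw [← Real.sqrt_mul (by positivity), show (a * Y / m) * (Y / a) = Y ^ 2 / (m : ℝ) by field_simp,
      Real.sqrt_div (by positivity), Real.sqrt_sq hY0.le]
  have hsq : √(m : ℝ) * √m = m := Real.mul_self_sqrt (by linarith)
  have hsm1 : 1 ≤ √(m : ℝ) := Real.one_le_sqrt.2 hm0'
  have k2 : √(a * Y / m) ≤ Y / √m := by
    rw [← Real.sqrt_sq hY0.le, ← Real.sqrt_div (by positivity)]
    refine Real.sqrt_le_sqrt ?_
    rw [Real.sqrt_sq hY0.le]
    gcongr
    nlinarith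
  have ha1 : (1 : ℝ) ≤ a := by exact_mod_cast hA
  have k3 : √(Y / a) ≤ Y / √m := by
    rw [← Real.sqrt_sq hY0.le, ← Real.sqrt_div (by positivity)]
    refine Real.sqrt_le_sqrt ?_
    rw [Real.sqrt_sq hY0.le]
    rw [div_le_div_iff₀ hAR (by linarith)]
    nlinarith [mul_le_mul_of_nonneg_left hY hY0.le,
      mul_nonneg (sq_nonneg Y) (by linarith : (0 : ℝ) ≤ a - 1)]
  have k4 : 1 ≤ Y / √m := by
    rw [le_div_iff₀ hsm]
    nlinarith
  nlinarith

end Lipschitz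

theorem finite_sum_three_sq_eq (m : ℤ) : {a : Fin 3 → ℤ | ∑ i, (a i) ^ 2 = m}.Finite := by
  refine (Set.finite_Icc (fun _ : Fin 3 => -m) (fun _ => m)).subset ?_
  intro a ha
  simp only [Set.mem_ofPred_eq, Fin.sum_univ_three] at ha
  have aux : ∀ t : ℤ, t ^ 2 ≤ m → -m ≤ t ∧ t ≤ m := fun t ht =>
    ⟨by have := Int.le_self_sq (-t); rw [neg_sq] at this; linarith,
      (Int.le_self_sq t).trans ht⟩
  have key : ∀ i, (a i) ^ 2 ≤ m := by
    intro i
    fin_cases i <;> simp <;> nlinarith [sq_nonneg (a 0), sq_nonneg (a 1), sq_nonneg (a 2)]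
  exact ⟨fun i => (aux _ (key i)).1, fun i => (aux _ (key i)).2⟩

theorem r3_four_mul (m : ℤ) : r3 (4 * m) = r3 m := by
  unfold r3
  have : {a : Fin 3 → ℤ | ∑ i, (a i) ^ 2 = 4 * m} =
      Set.image (fun a : Fin 3 → ℤ => (2 : ℤ) • a) {a : Fin 3 → ℤ | ∑ i, (a i) ^ 2 = m} := by
    ext a
    simp only [Set.mem_ofPred_eq, Set.mem_image, Fin.sum_univ_three]
    constructor
    · intro h
      obtain ⟨⟨u, hu⟩, ⟨v, hv⟩, ⟨w, hw⟩⟩ := Lipschitz.even_of_four_dvd_sum_three_sq ⟨m, h⟩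
      refine ⟨![u, v, w], ?_, ?_⟩
      · rw [hu, hv, hw] at h; simp; linarith
      · ext i; fin_cases i <;> simp [hu, hv, hw]
    · rintro ⟨b, hb, rfl⟩
      simp only [Pi.smul_apply, smul_eq_mul]
      linear_combination 4 * hb
  rw [this]
  exact Set.ncard_image_of_injective _ (smul_right_injective _ two_ne_zero)

theorem r3_four_pow_mul (s m : ℕ) : r3 ((4 ^ s * m : ℕ) : ℤ) = r3 m := by
  induction s with
  | zero => simp
  | succ s ih =>
    rw [← ih, ← r3_four_mul (4 ^ s * m : ℕ)]; congr 1; push_cast; ring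

theorem card_le_mul_r3 {m : ℕ} (hm0 : 0 < m) {u v w : ℤ} (huvw : u ^ 2 + v ^ 2 + w ^ 2 = m)
    (hprim : ∃ r s t : ℤ, r * u + s * v + t * w = 1) {X : ℝ} (hX : m ≤ X) (B : Finset ℕ)
    (hB : ∀ n ∈ B, (n : ℝ) ≤ X ∧ n % 2 = 1 ∧ n.Coprime m ∧
      ∃ k n₀ : ℕ, n = k ^ 2 * n₀ ∧ ∃ b : ℤ, (n₀ : ℤ) ∣ b ^ 2 + m) :
    (B.card : ℝ) ≤ 48 * (X / √m) * r3 m := by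
  obtain ⟨x, hx, hx1, hx2, hx3⟩ := Lipschitz.exists_coords 0 u v w
  have hxm : normSq x = m := by rw [normSq_def', hx, hx1, hx2, hx3, ← huvw]; ring
  rw [← hx1, ← hx2, ← hx3] at hprim
  have hB' : ∀ n ∈ B, ∃ α y : ℍ[ℤ], y.re = 0 ∧ normSq y = m ∧ α * x = y * α ∧
      ∃ k : ℤ, (k = 1 ∨ k = 2 ∨ k = 4) ∧ normSq α = k * n := by
    intro n hn
    obtain ⟨-, hodd, hcop, k, n₀, rfl, b, hb⟩ := hB n hn
    have hn0 : 0 < n₀ := by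
      rcases Nat.eq_zero_or_pos n₀ with rfl | h
      · simp at hodd
      · exact h
    have hodd₀ : n₀ % 2 = 1 := by
      rcases Nat.mod_two_eq_zero_or_one n₀ with h | h
      · rw [Nat.mul_mod, h] at hodd; simp at hodd
      · exact h
    obtain ⟨α, y, h1, h2, h3, l, h4, h5⟩ := Lipschitz.exists_conj_of_sq_add_dvd hx
      (n := n₀) (by exact_mod_cast hn0) (by exact_mod_cast hodd₀)
      (by rw [hxm]; exact Nat.isCoprime_iff_coprime.2 hcop.coprime_mul_left) (b := b)
      (by rw [hxm]; exact hb)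
    refine ⟨(k : ℤ) • α, y, h1, h2.trans hxm, ?_, l, h4, ?_⟩
    · rw [smul_mul_assoc, h3, mul_smul_comm]
    · rw [normSq_smul, h5]; push_cast; ring
  choose! α y h1 h2 h3 k h4 h5 using hB'
  have hm0' : (1 : ℝ) ≤ m := by exact_mod_cast hm0
  have hdec := Classical.decEq ℍ[ℤ]
  have hinj : Set.InjOn α (B : Set ℕ) := by
    intro n hn n' hn' h
    have e1 := h5 n hn
    rw [h, h5 n' hn'] at e1
    have e2 := (hB n hn).2.1
    have e3 := (hB n' hn').2.1
    rcases h4 n hn with h | h | h <;> rcases h4 n' hn' with h' | h' | h' <;> rw [h, h'] at e1 <;>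
      omega
  have hfib : ∀ z ∈ B.image y, (B.filter (fun n => y n = z)).card ≤ ⌊48 * (X / √m)⌋₊ := by
    intro z hz
    obtain ⟨n₁, hn₁, rfl⟩ := Finset.mem_image.1 hz
    refine Nat.le_floor ?_
    have hc := Lipschitz.card_conj_le hx (h1 n₁ hn₁) hprim hxm hm0 (Y := 4 * X) (by linarith)
      ((B.filter (fun n => y n = y n₁)).image α) ?_
    · rw [Finset.card_image_of_injOn (hinj.mono (Finset.coe_subset.2 (Finset.filter_subset _ _)))]
        at hc
      refine hc.trans (le_of_eq ?_)
      ring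
    · intro β hβ
      obtain ⟨n, hn, rfl⟩ := Finset.mem_image.1 hβ
      obtain ⟨hn, hny⟩ := Finset.mem_filter.1 hn
      obtain ⟨b1, b2, -⟩ := hB n hn
      have e5 := h5 n hn
      refine ⟨?_, by rw [← hny]; exact h3 n hn, ?_⟩
      · intro h0
        rw [h0, map_zero] at e5
        rcases h4 n hn with h | h | h <;> rw [h] at e5 <;> omega
      · rw [e5]
        push_cast
        have : (k n : ℝ) ≤ 4 := by
          have : k n ≤ 4 := by rcases h4 n hn with h | h | h <;> omega
          exact_mod_cast this
        exact mul_le_mul this b1 (by positivity) (by norm_num)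
  have hcard := Finset.card_le_mul_card_image B _ hfib
  have himg : (B.image y).card ≤ r3 m := by
    unfold r3
    rw [← Set.ncard_coe_finset]
    refine Set.ncard_le_ncard_of_injOn (fun q : ℍ[ℤ] => ![q.imI, q.imJ, q.imK]) ?_ ?_
      (finite_sum_three_sq_eq m)
    · intro q hq
      obtain ⟨n, hn, rfl⟩ := Finset.mem_image.1 (Finset.mem_coe.1 hq)
      have := h2 n hn
      rw [normSq_def', h1 n hn] at this
      simp only [Set.mem_ofPred_eq, Fin.sum_univ_three]
      simp
      linarith
    · intro q hq q' hq' h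
      obtain ⟨n, hn, rfl⟩ := Finset.mem_image.1 (Finset.mem_coe.1 hq)
      obtain ⟨n', hn', rfl⟩ := Finset.mem_image.1 (Finset.mem_coe.1 hq')
      have e0 := congrFun h 0
      have e1 := congrFun h 1
      have e2 := congrFun h 2
      simp at e0 e1 e2
      ext
      · rw [h1 n hn, h1 n' hn']
      · exact e0
      · exact e1
      · exact e2
  have hnn : 0 ≤ 48 * (X / √m) := by
    have : 0 ≤ X := by linarith
    positivity
  calc (B.card : ℝ) ≤ (⌊48 * (X / √m)⌋₊ * (B.image y).card : ℕ) := by exact_mod_cast hcard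
    _ ≤ _ := by
      push_cast
      exact mul_le_mul (Nat.floor_le hnn) (by exact_mod_cast himg) (by positivity) hnn

theorem isSquare_neg_of_squarefree {m n : ℕ} (hn : Squarefree n)
    (h : ∀ p : ℕ, p.Prime → p ∣ n → jacobiSym (-m) p = 1) :
    ∃ b : ℤ, (n : ℤ) ∣ b ^ 2 + m := by
  induction n using induction_on_primes with
  | zero => exact absurd rfl hn.ne_zero
  | one => exact ⟨0, by simp⟩
  | prime_mul p n hp ih =>
    have hcp : p.Coprime n := by
      by_contra hc
      exact hp.not_isUnit (hn p <| mul_dvd_mul_left p <| hp.dvd_iff_not_coprime.mpr hc)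
    obtain ⟨b, hb⟩ := ih hn.of_mul_right (fun q hq hqn => h q hq (dvd_mul_of_dvd_right hqn _))
    have := Fact.mk hp
    obtain ⟨z, hz⟩ := ZMod.isSquare_of_jacobiSym_eq_one (h p hp (dvd_mul_right _ _))
    obtain ⟨a, rfl⟩ := ZMod.intCast_surjective z
    have ha : (p : ℤ) ∣ a ^ 2 + m := by
      rw [← ZMod.intCast_zmod_eq_zero_iff_dvd]
      push_cast at hz ⊢
      linear_combination -hz
    obtain ⟨s, t, hst⟩ := Nat.isCoprime_iff_coprime.2 hcp
    refine ⟨a * (t * n) + b * (s * p), ?_⟩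
    push_cast
    refine IsCoprime.mul_dvd (Nat.isCoprime_iff_coprime.2 hcp) ?_ ?_
    · obtain ⟨c, hc⟩ := ha
      rw [show (a * (t * n) + b * (s * p)) ^ 2 + (m : ℤ) = (a ^ 2 + m) + p * (s * (b - a) *
        (2 * a + p * s * (b - a))) by
          have : t * (n : ℤ) = 1 - s * p := by linarith
          rw [this]; ring, hc]
      exact dvd_add (dvd_mul_right _ _) (dvd_mul_right _ _)
    · obtain ⟨c, hc⟩ := hb
      rw [show (a * (t * n) + b * (s * p)) ^ 2 + (m : ℤ) = (b ^ 2 + m) + n * (t * (a - b) *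
        (2 * b + n * t * (a - b))) by
          have : s * (p : ℤ) = 1 - t * n := by linarith
          rw [this]; ring, hc]
      exact dvd_add (dvd_mul_right _ _) (dvd_mul_right _ _)

theorem DirichletCharacter.zetaMul_apply_eq_sum {N : ℕ} (χ : DirichletCharacter ℂ N) (n : ℕ) :
    χ.zetaMul n = ∑ d ∈ n.divisors, χ d := by
  refine ArithmeticFunction.coe_zeta_mul_apply.trans (Finset.sum_congr rfl fun d hd => ?_)
  exact if_neg (Nat.pos_of_mem_divisors hd).ne'

theorem exists_sq_mul_of_zetaMul_ne_zero {N m : ℕ} {χ : DirichletCharacter ℂ N}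
    (hχ : ∀ p : ℕ, p.Prime → p ≠ 2 → χ p = (jacobiSym (-m) p : ℤ)) {n : ℕ}
    (hodd : n % 2 = 1) (hcop : n.Coprime m) (hn : χ.zetaMul n ≠ 0) :
    ∃ k n₀ : ℕ, n = k ^ 2 * n₀ ∧ ∃ b : ℤ, (n₀ : ℤ) ∣ b ^ 2 + m := by
  obtain ⟨n₀, k, h, hsq⟩ := Nat.sq_mul_squarefree n
  have hn0 : n ≠ 0 := by rintro rfl; simp at hodd
  refine ⟨k, n₀, h.symm, isSquare_neg_of_squarefree hsq ?_⟩
  intro p hp hpn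
  have hpn' : p ∣ n := h ▸ dvd_mul_of_dvd_right hpn _
  have hp2 : p ≠ 2 := by rintro rfl; omega
  have hk0 : k ≠ 0 := by rintro rfl; simp at h; omega
  have hval : Odd (n.factorization p) := by
    rw [← h, Nat.factorization_mul (pow_ne_zero 2 hk0) hsq.ne_zero, Nat.factorization_pow]
    have e1 : n₀.factorization p = 1 :=
      le_antisymm (hsq.natFactorization_le_one p)
        ((hp.dvd_iff_one_le_factorization hsq.ne_zero).1 hpn)
    simp [e1]
  have hne : χ.zetaMul (p ^ n.factorization p) ≠ 0 := by
    rw [χ.isMultiplicative_zetaMul.multiplicative_factorization _ hn0] at hn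
    refine Finset.prod_ne_zero_iff.1 hn p ?_
    exact Nat.mem_primeFactors.2 ⟨hp, hpn', hn0⟩
  rcases jacobiSym.trichotomy (-m : ℤ) p with h0 | h1 | h1
  · have := Fact.mk hp
    rw [jacobiSym.eq_zero_iff] at h0
    refine absurd ?_ h0.2
    rw [Int.neg_gcd]
    exact (Nat.Coprime.coprime_dvd_left hpn' hcop).symm
  · exact h1
  · exfalso
    apply hne
    have hχp := hχ p hp hp2
    rw [h1] at hχp
    have heven : Even (n.factorization p + 1) := Odd.add_one hval
    rw [DirichletCharacter.zetaMul_apply_eq_sum, Nat.sum_divisors_prime_pow hp]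
    simp only [Nat.cast_pow, map_pow, hχp, Int.cast_neg, Int.cast_one, neg_one_geom_sum, heven,
      if_true]

end Lipschitz

section

open scoped NumberTheorySymbols

theorem jacobiSym_mul_sub_one {k c : ℕ} (hk : k % 2 = 1) (hc : c % 4 = 0) (hc0 : 0 < c) :
    J((k : ℤ) | c * k - 1) = 1 := by
  have hck : 0 < c * k := Nat.mul_pos hc0 (by omega)
  have h3 : (c * k - 1) % 4 = 3 := by
    have : c * k % 4 = 0 := by rw [Nat.mul_mod, hc]; simp
    omega
  have hkodd : Odd k := Nat.odd_iff.2 hk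
  have hred : J(((c * k - 1 : ℕ) : ℤ) | k) = J(-1 | k) := by
    refine jacobiSym.mod_left' ?_
    rw [Nat.cast_sub hck]
    push_cast
    rw [show (c : ℤ) * k - 1 = -1 + k * c by ring, Int.add_mul_emod_self_left]
  rcases (show k % 4 = 1 ∨ k % 4 = 3 by omega) with h | h
  · rw [jacobiSym.quadratic_reciprocity_one_mod_four h (Nat.odd_iff.2 (by omega)), hred,
      jacobiSym.at_neg_one hkodd, ZMod.χ₄_nat_one_mod_four h]
  · rw [jacobiSym.quadratic_reciprocity_three_mod_four h h3, hred,
      jacobiSym.at_neg_one hkodd, ZMod.χ₄_nat_three_mod_four h]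
    norm_num

theorem jacobiSym_neg_four_mul_sub_one {m : ℕ} (hm : 0 < m) (h4 : ¬ 4 ∣ m) :
    J(-(m : ℤ) | 4 * m - 1) = -1 := by
  have h3 : (4 * m - 1) % 4 = 3 := by omega
  have hodd : Odd (4 * m - 1) := Nat.odd_iff.2 (by omega)
  rw [neg_eq_neg_one_mul, jacobiSym.mul_left, jacobiSym.at_neg_one hodd,
    ZMod.χ₄_nat_three_mod_four h3]
  rcases Nat.even_or_odd' m with ⟨k, hk | hk⟩
  · have e1 : J((k : ℤ) | 4 * m - 1) = 1 := by
      rw [hk, ← mul_assoc]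
      exact jacobiSym_mul_sub_one (by omega) (by norm_num) (by norm_num)
    have e2 : J((2 : ℤ) | 4 * m - 1) = 1 := by
      rw [jacobiSym.at_two hodd, ZMod.χ₈_nat_eq_if_mod_eight, if_neg (by omega),
        if_pos (by omega)]
    have e3 : J((m : ℤ) | 4 * m - 1) = J((2 : ℤ) | 4 * m - 1) * J((k : ℤ) | 4 * m - 1) := by
      rw [← jacobiSym.mul_left]; congr 1; rw [hk]; push_cast; ring
    rw [e3, e1, e2]; norm_num
  · rw [jacobiSym_mul_sub_one (by omega) (by norm_num) (by norm_num)]; norm_num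

theorem exists_character_eq_jacobiSym {m : ℕ} (hm : 0 < m) (h4 : ¬ 4 ∣ m) :
    ∃ χ : DirichletCharacter ℂ (4 * m), χ ^ 2 = 1 ∧ χ ≠ 1 ∧
      ∀ d : ℕ, d % 2 = 1 → χ d = (J(-(m : ℤ) | d) : ℤ) := by
  have : NeZero (4 * m) := ⟨by omega⟩
  let f : ℕ → ℂ := fun d => if d % 2 = 1 then ((J(-(m : ℤ) | d) : ℤ) : ℂ) else 0
  have hfmod : ∀ d, f (d % (4 * m)) = f d := by
    intro d
    have e : d % (4 * m) % 2 = d % 2 := Nat.mod_mod_of_dvd d ⟨2 * m, by ring⟩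
    simp only [f, e]
    split_ifs with h
    · have := jacobiSym.mod_right (-(m : ℤ)) (Nat.odd_iff.2 h)
      rw [Int.natAbs_neg, Int.natAbs_natCast] at this
      rw [this]
    · rfl
  have hfmul : ∀ a b, f (a * b) = f a * f b := by
    intro a b
    simp only [f]
    by_cases ha : a % 2 = 1
    · by_cases hb : b % 2 = 1
      · have := jacobiSym.mul_right' (-(m : ℤ)) (b₁ := a) (b₂ := b) (by rintro rfl; simp at ha)
          (by rintro rfl; simp at hb)
        rw [if_pos ha, if_pos hb, if_pos (by rw [Nat.mul_mod, ha, hb]), this]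
        push_cast; rfl
      · have hb' : b % 2 = 0 := by omega
        rw [if_neg hb, if_neg (by rw [Nat.mul_mod, hb']; simp), mul_zero]
    · have ha' : a % 2 = 0 := by omega
      rw [if_neg ha, if_neg (by rw [Nat.mul_mod, ha']; simp), zero_mul]
  let χ : DirichletCharacter ℂ (4 * m) :=
    { toFun := fun a => f a.val
      map_one' := by
        rw [ZMod.val_one_eq_one_mod, hfmod]
        simp [f]
      map_mul' := fun a b => by rw [ZMod.val_mul, hfmod, hfmul]
      map_nonunit' := fun a ha => by
        simp only [f]
        split_ifs with h
        · rw [← ZMod.natCast_zmod_val a, ZMod.isUnit_iff_coprime] at ha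
          have h1 : ¬ (a.val).Coprime m := fun hc => ha <| Nat.Coprime.mul_right
            (Nat.Coprime.pow_right 2 (Nat.coprime_two_right.2 (Nat.odd_iff.2 h))) hc
          have : J(-(m : ℤ) | a.val) = 0 := by
            rw [jacobiSym.eq_zero_iff]
            refine ⟨by rintro h0; rw [h0] at h; simp at h, ?_⟩
            rw [Int.neg_gcd, Int.gcd_natCast_natCast]
            exact fun h => h1 (Nat.Coprime.symm h)
          rw [this]; simp
        · rfl }
  have hχ : ∀ d : ℕ, χ d = f d := by
    intro d
    change f ((d : ZMod (4 * m)).val) = f d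
    rw [ZMod.val_natCast, hfmod]
  have hodd : ∀ d : ℕ, d % 2 = 1 → χ d = (J(-(m : ℤ) | d) : ℤ) := by
    intro d hd
    rw [hχ]
    exact if_pos hd
  refine ⟨χ, ?_, ?_, hodd⟩
  · rw [← MulChar.isQuadratic_iff_sq_eq_one]
    intro a
    rw [← ZMod.natCast_zmod_val a, hχ]
    simp only [f]
    split_ifs
    · rcases jacobiSym.trichotomy (-(m : ℤ)) a.val with h | h | h <;> rw [h] <;> simp
    · simp
  · intro h1
    have h := hodd (4 * m - 1) (by omega)
    rw [jacobiSym_neg_four_mul_sub_one hm h4, h1] at h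
    have hu : IsUnit ((4 * m - 1 : ℕ) : ZMod (4 * m)) := by
      rw [ZMod.isUnit_iff_coprime]
      have h := (Nat.coprime_self_add_right (m := 4 * m - 1) (n := 1)).2 (Nat.coprime_one_right _)
      rwa [Nat.sub_add_cancel (by omega)] at h
    rw [MulChar.one_apply hu] at h
    norm_num at h

end

open Complex Filter Asymptotics Topology MeasureTheory Set in
/-- If `F` is entire, agrees with the Dirichlet series of `f` for `1 < re s`, and the partial sums
of `f` vanish before `D` and are bounded by `K * n ^ r` afterwards, then `F` is bounded on
`r < re s`. -/
theorem norm_le_of_norm_sum_le {f : ℕ → ℂ} {F : ℂ → ℂ} (hF : Differentiable ℂ F)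
    (hS : ∀ s : ℂ, 1 < s.re → LSeriesSummable f s)
    (hFf : ∀ s : ℂ, 1 < s.re → F s = LSeries f s) {K r : ℝ} (hK : 0 ≤ K) (hr : 0 ≤ r) (hr1 : r < 1)
    {D : ℕ} (hD : 1 ≤ D) (h0 : ∀ n < D, ∑ k ∈ Finset.Icc 1 n, f k = 0)
    (hb : ∀ n : ℕ, ‖∑ k ∈ Finset.Icc 1 n, f k‖ ≤ K * (n : ℝ) ^ r) {s : ℂ} (hs : r < s.re) :
    ‖F s‖ ≤ K * ‖s‖ * (D : ℝ) ^ (r - s.re) / (s.re - r) := by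
  set g : ℝ → ℂ := fun t ↦ ∑ k ∈ Finset.Icc 1 ⌊t⌋₊, f k with hg
  have hD0 : (0 : ℝ) < D := by exact_mod_cast hD
  have hg0 : ∀ t : ℝ, t < D → g t = 0 := by
    intro t ht
    apply h0
    rcases lt_or_ge t 0 with h | h
    · rw [Nat.floor_of_nonpos h.le]; omega
    · exact (Nat.floor_lt h).2 ht
  have hgb : ∀ t : ℝ, 0 ≤ t → ‖g t‖ ≤ K * t ^ r := fun t ht ↦ (hb _).trans <|
    mul_le_mul_of_nonneg_left (Real.rpow_le_rpow (Nat.cast_nonneg _) (Nat.floor_le ht) hr) hK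
  have hgint : LocallyIntegrableOn g (Ioi 0) := by
    have := locallyIntegrableOn_mul_sum_Icc (𝕜 := ℂ) f (m := 1) le_rfl (g := fun _ ↦ (1 : ℂ))
      (continuous_const.locallyIntegrable.locallyIntegrableOn (Ici (0 : ℝ)))
    simp only [one_mul] at this
    exact this.mono_set Ioi_subset_Ici_self
  have hdiff : ∀ z : ℂ, r < z.re → DifferentiableAt ℂ (mellin g) (-z) := by
    intro z hz
    apply mellin_differentiableAt_of_isBigO_rpow (a := -r) (b := -z.re - 1) hgint
    · refine IsBigO.of_bound K ?_
      filter_upwards [eventually_ge_atTop 0] with t ht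
      simp only [neg_neg]
      rw [Real.norm_of_nonneg (Real.rpow_nonneg ht _)]
      exact hgb t ht
    · simpa using hz
    · refine IsBigO.of_bound 0 ?_
      have : Iio (1 : ℝ) ∈ 𝓝[>] (0 : ℝ) := mem_nhdsWithin_of_mem_nhds (Iio_mem_nhds one_pos)
      filter_upwards [this] with t ht
      rw [hg0 t (lt_of_lt_of_le ht (by exact_mod_cast hD))]; simp
    · simp
  have hmel : ∀ z : ℂ, mellin g (-z) = ∫ t in Ioi (1 : ℝ), g t * (t : ℂ) ^ (-(z + 1)) := by
    intro z
    rw [mellin]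
    have : ∀ t : ℝ, (t : ℂ) ^ (-z - 1) • g t = g t * (t : ℂ) ^ (-(z + 1)) := by
      intro t; rw [smul_eq_mul, mul_comm]; congr 2; ring
    simp_rw [this]
    symm
    rw [← integral_indicator measurableSet_Ioi, ← integral_indicator measurableSet_Ioi]
    apply integral_congr_ae
    have : ∀ᵐ t : ℝ, t ≠ 1 := by simp [ae_iff, measure_singleton]
    filter_upwards [this] with t ht
    by_cases h1 : 1 < t
    · rw [indicator_of_mem (mem_Ioi.2 h1), indicator_of_mem (mem_Ioi.2 (by linarith))]
    · rw [indicator_of_notMem (by simpa using h1)]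
      have : g t = 0 := hg0 t (lt_of_lt_of_le (lt_of_le_of_ne (not_lt.1 h1) ht)
        (by exact_mod_cast hD))
      simp [indicator, this]
  have hO : (fun n ↦ ∑ k ∈ Finset.Icc 1 n, f k) =O[atTop] fun n ↦ (n : ℝ) ^ r := by
    refine IsBigO.of_bound K (Eventually.of_forall fun n ↦ ?_)
    rw [Real.norm_of_nonneg (by positivity)]
    exact hb n
  have hopen : IsOpen {z : ℂ | r < z.re} := isOpen_lt continuous_const continuous_re
  have heq : EqOn F (fun z ↦ z * mellin g (-z)) {z : ℂ | r < z.re} := by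
    refine AnalyticOnNhd.eqOn_of_preconnected_of_eventuallyEq (𝕜 := ℂ) (z₀ := 2) ?_ ?_ ?_ ?_ ?_
    · exact hF.differentiableOn.analyticOnNhd hopen
    · refine DifferentiableOn.analyticOnNhd (fun z hz ↦ ?_) hopen
      have : DifferentiableAt ℂ (fun z ↦ mellin g (-z)) z :=
        (hdiff z hz).comp z differentiableAt_id.neg
      exact (differentiableAt_id.mul this).differentiableWithinAt
    · exact (convex_halfSpace_re_gt r).isPreconnected
    · change r < (2 : ℂ).re
      norm_num; linarith
    · have : {z : ℂ | 1 < z.re} ∈ 𝓝 (2 : ℂ) :=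
        (isOpen_lt continuous_const continuous_re).mem_nhds (by simp)
      filter_upwards [this] with z hz
      have hz' : 1 < z.re := hz
      rw [hFf z hz', hmel, LSeries_eq_mul_integral f hr (by linarith) (hS z hz') hO]
  have hval : F s = s * mellin g (-s) := heq hs
  rw [hval, hmel, norm_mul]
  have hintegral : ‖∫ t in Ioi (1 : ℝ), g t * (t : ℂ) ^ (-(s + 1))‖ ≤
      K * ((D : ℝ) ^ (r - s.re) / (s.re - r)) := by
    have h1 : ∫ t in Ioi (1 : ℝ), g t * (t : ℂ) ^ (-(s + 1)) =
        ∫ t in Ioi (1 : ℝ), (Ioi (D : ℝ)).indicator (fun t ↦ g t * (t : ℂ) ^ (-(s + 1))) t := by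
      rw [← integral_indicator measurableSet_Ioi, ← integral_indicator measurableSet_Ioi]
      apply integral_congr_ae
      have : ∀ᵐ t : ℝ, t ≠ D := by simp [ae_iff, measure_singleton]
      filter_upwards [this] with t ht
      by_cases h : (D : ℝ) < t
      · simp [indicator, h]
      · simp [indicator, hg0 t (lt_of_le_of_ne (not_lt.1 h) ht)]
    rw [h1, setIntegral_indicator measurableSet_Ioi]
    have h2 : Ioi (1 : ℝ) ∩ Ioi (D : ℝ) = Ioi (D : ℝ) :=
      inter_eq_right.2 (Ioi_subset_Ioi (by exact_mod_cast hD))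
    rw [h2]
    have h3 : ∫ t in Ioi (D : ℝ), K * t ^ (r - s.re - 1) =
        K * ((D : ℝ) ^ (r - s.re) / (s.re - r)) := by
      rw [integral_const_mul, integral_Ioi_rpow_of_lt (by linarith) hD0]
      congr 1
      rw [sub_add_cancel, ← neg_sub s.re r, div_neg, neg_div, neg_neg]
    rw [← h3]
    apply norm_integral_le_of_norm_le
    · exact (integrableOn_Ioi_rpow_of_lt (by linarith) hD0).const_mul K
    · refine (ae_restrict_iff' measurableSet_Ioi).2 (Eventually.of_forall fun t ht ↦ ?_)
      have ht0 : 0 < t := hD0.trans ht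
      rw [norm_mul, norm_cpow_eq_rpow_re_of_pos ht0]
      have : r - s.re - 1 = r + (-(s + 1)).re := by simp; ring
      rw [this, Real.rpow_add ht0, ← mul_assoc]
      exact mul_le_mul_of_nonneg_right (hgb t ht0.le) (by positivity)
  calc ‖s‖ * _ ≤ ‖s‖ * (K * ((D : ℝ) ^ (r - s.re) / (s.re - r))) := by gcongr
    _ = _ := by ring

open Complex Filter Topology Set ComplexConjugate in
/-- An entire function that is real on the reals greater than `1` is real on the real axis. -/
theorem im_eq_zero_of_forall_one_lt {F : ℂ → ℂ} (hF : Differentiable ℂ F)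
    (h : ∀ x : ℝ, 1 < x → (F x).im = 0) (x : ℝ) : (F x).im = 0 := by
  have hG : Differentiable ℂ (fun s ↦ conj (F (conj s))) := fun s ↦ by
    simpa [Function.comp_def] using (hF (conj s)).conj_conj
  have heq : EqOn F (fun s ↦ conj (F (conj s))) univ := by
    refine AnalyticOnNhd.eqOn_of_preconnected_of_frequently_eq (𝕜 := ℂ) (z₀ := 2) ?_ ?_ ?_ ?_ ?_
    · exact hF.differentiableOn.analyticOnNhd isOpen_univ
    · exact hG.differentiableOn.analyticOnNhd isOpen_univ
    · exact isPreconnected_univ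
    · trivial
    · have hcont : Tendsto (fun x : ℝ ↦ (x : ℂ)) (𝓝[>] 2) (𝓝[≠] 2) := by
        apply tendsto_nhdsWithin_of_tendsto_nhds_of_eventually_within
        · have := continuous_ofReal.tendsto (2 : ℝ)
          exact (by simpa using this : Tendsto _ (𝓝 (2 : ℝ)) (𝓝 (2 : ℂ))).mono_left
            nhdsWithin_le_nhds
        · filter_upwards [self_mem_nhdsWithin] with y hy
          have : (2 : ℝ) < y := hy
          simp only [mem_compl_iff, mem_singleton_iff]
          intro h'
          have : y = 2 := by exact_mod_cast h'
          linarith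
      refine hcont.frequently (Eventually.frequently ?_)
      filter_upwards [self_mem_nhdsWithin] with y hy
      have hy : (2 : ℝ) < y := hy
      rw [conj_ofReal, eq_comm, conj_eq_iff_im]
      exact h y (by linarith)
  have := heq (mem_univ (x : ℂ))
  simp only [conj_ofReal] at this
  exact conj_eq_iff_im.1 this.symm

open Complex in
theorem exists_differentiable_eq_sub_one_mul_riemannZeta :
    ∃ E : ℂ → ℂ, Differentiable ℂ E ∧ E 1 = 1 ∧ ∀ s ≠ 1, E s = (s - 1) * riemannZeta s := by
  refine ⟨DirichletCharacter.LFunctionTrivChar₁ 1,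
    DirichletCharacter.differentiable_LFunctionTrivChar₁ 1, by simp, fun s hs ↦ ?_⟩
  rw [DirichletCharacter.LFunctionTrivChar₁, Function.update_of_ne hs,
    DirichletCharacter.LFunctionTrivChar, DirichletCharacter.LFunction_modOne_eq]

open Complex in
/-- If `F` is entire then `ζ F` is the sum of a polar part at `1` and an entire function. -/
theorem exists_differentiable_eq_riemannZeta_mul_sub {H : ℂ → ℂ} (hH : Differentiable ℂ H) :
    ∃ f : ℂ → ℂ, Differentiable ℂ f ∧
      ∀ s ≠ 1, f s = riemannZeta s * H s - H 1 * (s - 1)⁻¹ := by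
  obtain ⟨E, hE, hE1, hEs⟩ := exists_differentiable_eq_sub_one_mul_riemannZeta
  refine ⟨dslope (fun s ↦ E s * H s) 1, ?_, fun s hs ↦ ?_⟩
  · rw [← differentiableOn_univ, Complex.differentiableOn_dslope Filter.univ_mem]
    exact (hE.mul hH).differentiableOn
  · rw [dslope_of_ne _ hs, slope_def_field, hE1, hEs s hs]
    have : s - 1 ≠ 0 := sub_ne_zero.2 hs
    field_simp

open Complex Filter Topology ComplexOrder in
/-- Taylor coefficients at `2` of `ζ H` minus its polar part, when `ζ H` has nonnegative
Dirichlet coefficients. -/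
theorem neg_re_le_iteratedDeriv_two {a : ℕ → ℂ} (ha : 0 ≤ a) (ha1 : a 1 = 1)
    (hS : ∀ s : ℂ, 1 < s.re → LSeriesSummable a s) {f : ℂ → ℂ} (hf : Differentiable ℂ f) {l : ℂ}
    (hfa : ∀ s : ℂ, 1 < s.re → f s = LSeries a s - l * (s - 1)⁻¹) (k : ℕ) :
    (if k = 0 then 1 else 0) - l.re ≤
      ((-1) ^ k * iteratedDeriv k f 2 / (k.factorial : ℂ)).re := by
  have habs : LSeries.abscissaOfAbsConv a ≤ 1 :=
    LSeries.abscissaOfAbsConv_le_of_forall_lt_LSeriesSummable' fun y hy ↦ by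
      exact hS _ (by simpa using EReal.coe_lt_coe_iff.1 hy)
  have hlt : LSeries.abscissaOfAbsConv a < ((2 : ℝ) : EReal) :=
    habs.trans_lt (by exact_mod_cast one_lt_two)
  have hev : ∀ᶠ z : ℂ in 𝓝 2, 1 < z.re :=
    (isOpen_lt continuous_const continuous_re).mem_nhds (by simp)
  have hkey : (-1) ^ k * iteratedDeriv k (LSeries a) 2 =
      (-1) ^ k * iteratedDeriv k f 2 + l * k.factorial := by
    have h1 : LSeries a =ᶠ[𝓝 2] fun s ↦ f s + l * (s - 1)⁻¹ := by
      filter_upwards [hev] with z hz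
      rw [hfa z hz]; ring
    have h2 : ContDiffAt ℂ k (fun s : ℂ ↦ (s - 1)⁻¹) 2 :=
      ContDiffAt.inv (contDiffAt_id.sub contDiffAt_const) (by norm_num)
    have h3 : iteratedDeriv k (fun s : ℂ ↦ (s - 1)⁻¹) 2 = (-1) ^ k * k.factorial := by
      have := iter_deriv_inv_linear (𝕜 := ℂ) k 1 (-1)
      simp only [one_mul, ← sub_eq_add_neg, one_pow, mul_one] at this
      rw [iteratedDeriv_eq_iterate, this]
      norm_num
    rw [h1.iteratedDeriv_eq, iteratedDeriv_fun_add hf.contDiff.contDiffAt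
      (contDiffAt_const.mul h2), iteratedDeriv_const_mul_field, h3, mul_add]
    congr 1
    rw [mul_left_comm, ← mul_assoc ((-1 : ℂ) ^ k), ← mul_pow]; simp
  have hpos := LSeries.iteratedDeriv_alternating ha hlt k
  have hfac : (0 : ℝ) < k.factorial := by exact_mod_cast k.factorial_pos
  have h4 : (-1) ^ k * iteratedDeriv k f 2 / (k.factorial : ℂ) =
      (-1) ^ k * iteratedDeriv k (LSeries a) 2 / (k.factorial : ℝ) - l := by
    rw [hkey]; push_cast
    have : (k.factorial : ℂ) ≠ 0 := by exact_mod_cast k.factorial_ne_zero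
    field_simp; ring
  rw [h4, sub_re, div_ofReal_re]
  have hpos' : 0 ≤ ((-1) ^ k * iteratedDeriv k (LSeries a) 2).re := by
    have := (Complex.le_def.1 hpos).1
    simpa using this
  split_ifs with hk
  · subst hk
    simp only [pow_zero, one_mul, iteratedDeriv_zero, Nat.factorial_zero, Nat.cast_one, div_one]
    have h5 : (1 : ℂ) ≤ LSeries a 2 := by
      have h6 : LSeries.term a 2 1 = 1 := by simp [LSeries.term, ha1]
      rw [LSeries, ← h6]
      refine (hS 2 (by simp)).le_tsum 1 fun n _ ↦ ?_
      exact LSeries.term_nonneg (ha n) 2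
    have := (Complex.le_def.1 h5).1
    simp at this
    linarith
  · have := div_nonneg hpos' hfac.le
    linarith

/-- A lower bound for a sum whose first terms are bounded below by those of a geometric series, and
whose other terms decay. -/
theorem le_of_hasSum_of_le {u : ℕ → ℝ} {l M y S : ℝ} (hy : 1 < y) (hy' : y ≤ 5 / 4)
    (hu : ∀ k, (if k = 0 then 1 else 0) - l ≤ u k) (hM : ∀ k, |u k| ≤ M * (2 / 3) ^ k)
    (hS : HasSum (fun k ↦ u k * y ^ k) S) (K : ℕ) (hK : 1 ≤ K) :
    1 - l * ((y ^ K - 1) / (y - 1)) - 6 * M * (5 / 6) ^ K ≤ S := by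
  have hM0 : 0 ≤ M := by simpa using (abs_nonneg _).trans (hM 0)
  have h1 : 1 - l * ((y ^ K - 1) / (y - 1)) ≤ ∑ k ∈ Finset.range K, u k * y ^ k := by
    rw [← geom_sum_eq hy.ne', Finset.mul_sum]
    have : (1 : ℝ) = ∑ k ∈ Finset.range K, if k = 0 then 1 else 0 := by
      rw [Finset.sum_ite_eq' (Finset.range K) 0 (fun _ ↦ (1 : ℝ))]
      simp; omega
    rw [this, ← Finset.sum_sub_distrib]
    refine Finset.sum_le_sum fun k _ ↦ ?_
    have h2 := mul_le_mul_of_nonneg_right (hu k) (pow_nonneg (zero_le_one.trans hy.le) k)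
    refine le_trans (le_of_eq ?_) h2
    split_ifs with hk
    · simp [hk]
    · ring
  have h2 : -(6 * M * (5 / 6) ^ K) ≤ ∑' k, u (k + K) * y ^ (k + K) := by
    have hg : HasSum (fun k ↦ -(M * (5 / 6 : ℝ) ^ (k + K))) (-(6 * M * (5 / 6) ^ K)) := by
      have := ((hasSum_geometric_of_lt_one (r := (5 / 6 : ℝ)) (by norm_num)
        (by norm_num)).mul_left (M * (5 / 6) ^ K)).neg
      have h3 : -(M * (5 / 6 : ℝ) ^ K * (1 - 5 / 6)⁻¹) = -(6 * M * (5 / 6) ^ K) := by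
        norm_num; ring
      rw [h3] at this
      simpa only [pow_add, mul_comm, mul_left_comm, mul_assoc] using this
    refine hasSum_le (fun k ↦ ?_) hg ((summable_nat_add_iff K).2 hS.summable).hasSum
    refine neg_le_of_abs_le ?_
    rw [abs_mul, abs_of_nonneg (pow_nonneg (zero_le_one.trans hy.le) _)]
    calc |u (k + K)| * y ^ (k + K) ≤ (M * (2 / 3) ^ (k + K)) * (5 / 4) ^ (k + K) := by
          gcongr
          exact hM _
      _ = M * (5 / 6) ^ (k + K) := by rw [mul_assoc, ← mul_pow]; norm_num
  rw [← hS.tsum_eq, ← hS.summable.sum_add_tsum_nat_add K]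
  linarith

open Complex Filter Topology ComplexOrder in
/-- **Estermann's inequality**: if `ζ H` has nonnegative Dirichlet coefficients and is nonpositive
at some real `β < 1`, then `H 1` is not too small. -/
theorem le_re_apply_one_of_re_nonpos {a : ℕ → ℂ} (ha : 0 ≤ a) (ha1 : a 1 = 1)
    (hS : ∀ s : ℂ, 1 < s.re → LSeriesSummable a s) {H : ℂ → ℂ} (hH : Differentiable ℂ H)
    (hL : ∀ s : ℂ, 1 < s.re → LSeries a s = riemannZeta s * H s) {M : ℝ} (hM1 : 1 ≤ M)
    (hM : ∀ s ∈ Metric.sphere (2 : ℂ) (3 / 2), ‖riemannZeta s * H s - H 1 * (s - 1)⁻¹‖ ≤ M)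
    {β : ℝ} (hβ : 3 / 4 ≤ β) (hβ1 : β < 1)
    (hneg : (riemannZeta β * H β).re ≤ 0) :
    (1 - β) / 6 * (12 * M) ^ (-(6 * (1 - β))) ≤ (H 1).re := by
  obtain ⟨f, hf, hfs⟩ := exists_differentiable_eq_riemannZeta_mul_sub hH
  have hne : ∀ s ∈ Metric.sphere (2 : ℂ) (3 / 2), s ≠ 1 := by
    rintro s hs rfl
    rw [mem_sphere_iff_norm] at hs
    norm_num at hs
  set u : ℕ → ℝ := fun k ↦ ((-1) ^ k * iteratedDeriv k f 2 / (k.factorial : ℂ)).re with hu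
  have hu1 : ∀ k, (if k = 0 then 1 else 0) - (H 1).re ≤ u k := fun k ↦
    neg_re_le_iteratedDeriv_two ha ha1 hS hf (fun s hs ↦ by
      rw [hL s hs]; exact hfs s (by rintro rfl; simp at hs)) k
  have hu2 : ∀ k, |u k| ≤ M * (2 / 3) ^ k := by
    intro k
    refine (abs_re_le_norm _).trans ?_
    have hfac : (0 : ℝ) < k.factorial := by exact_mod_cast k.factorial_pos
    have := norm_iteratedDeriv_le_of_forall_mem_sphere_norm_le k (by norm_num : (0 : ℝ) < 3 / 2)
      hf.diffContOnCl (C := M) (fun z hz ↦ (hfs z (hne z hz)) ▸ hM z hz)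
    rw [norm_div, norm_mul, norm_pow, norm_neg, norm_one, one_pow, one_mul, norm_natCast,
      div_le_iff₀ hfac]
    refine this.trans (le_of_eq ?_)
    rw [div_eq_mul_inv, ← inv_pow]
    norm_num
    ring
  have hsum : HasSum (fun k ↦ u k * (2 - β) ^ k) (f β).re := by
    have h1 := hasSum_taylorSeries_on_ball (c := (2 : ℂ)) (r := 3) (f := f) (z := (β : ℂ))
      hf.differentiableOn (by
        rw [Metric.mem_ball, dist_eq_norm, show (β : ℂ) - 2 = ((β - 2 : ℝ) : ℂ) by push_cast; rfl,
          norm_real, Real.norm_eq_abs, abs_lt]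
        constructor <;> linarith)
    have h2 := hasSum_re h1
    convert h2 using 2 with k
    rw [hu, ← re_mul_ofReal]
    congr 1
    push_cast
    simp only [smul_eq_mul]
    rw [show (β : ℂ) - 2 = (-1) * (2 - β) by ring, mul_pow]
    ring
  have hval : (f β).re ≤ (H 1).re / (1 - β) := by
    have hβne : (β : ℂ) ≠ 1 := by
      intro h
      exact hβ1.ne (by exact_mod_cast h)
    rw [hfs β hβne, sub_re, show H 1 * ((β : ℂ) - 1)⁻¹ = H 1 * (((β - 1)⁻¹ : ℝ) : ℂ) by
      push_cast; rfl, re_mul_ofReal]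
    have : (H 1).re / (1 - β) = -((H 1).re * (β - 1)⁻¹) := by
      rw [← neg_sub, div_neg, div_eq_mul_inv]
    rw [this]; linarith
  set K : ℕ := ⌈6 * Real.log (12 * M)⌉₊ with hKdef
  have hlog : 0 < Real.log (12 * M) := Real.log_pos (by linarith)
  have hK : 1 ≤ K := Nat.one_le_ceil_iff.2 (by linarith)
  have hKlo : 6 * Real.log (12 * M) ≤ K := Nat.le_ceil _
  have hKhi : (K : ℝ) ≤ 6 * Real.log (12 * M) + 1 := (Nat.ceil_lt_add_one (by linarith)).le
  have hmain := le_of_hasSum_of_le (by linarith : (1 : ℝ) < 2 - β) (by linarith) hu1 hu2 hsum K hK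
  have h12 : (0 : ℝ) < 12 * M := by linarith
  have h56 : 6 * M * (5 / 6 : ℝ) ^ K ≤ 1 / 2 := by
    have h1 : (5 / 6 : ℝ) ≤ Real.exp (-(1 / 6)) := by
      have := Real.add_one_le_exp (-(1 / 6))
      linarith
    have h2 : (5 / 6 : ℝ) ^ K ≤ (12 * M)⁻¹ := by
      calc (5 / 6 : ℝ) ^ K ≤ Real.exp (-(1 / 6)) ^ K := by gcongr
        _ = Real.exp (-(K / 6)) := by rw [← Real.exp_nat_mul]; congr 1; ring
        _ ≤ Real.exp (-Real.log (12 * M)) := Real.exp_le_exp.2 (by linarith)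
        _ = (12 * M)⁻¹ := by rw [Real.exp_neg, Real.exp_log h12]
    calc 6 * M * (5 / 6 : ℝ) ^ K ≤ 6 * M * (12 * M)⁻¹ := by gcongr
      _ = 1 / 2 := by field_simp; norm_num
  have hd : 0 < 1 - β := by linarith
  have hy0 : 0 < (2 - β) ^ K := pow_pos (by linarith) K
  have hlow : (1 - β) / 2 ≤ (H 1).re * (2 - β) ^ K := by
    have h3 : 1 / 2 ≤ (H 1).re * ((2 - β) ^ K / (1 - β)) := by
      have h4 : (H 1).re * (((2 - β) ^ K - 1) / (2 - β - 1)) =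
          (H 1).re * ((2 - β) ^ K / (1 - β)) - (H 1).re / (1 - β) := by
        rw [show 2 - β - 1 = 1 - β by ring]; ring
      linarith
    rw [← mul_div_assoc, le_div_iff₀ hd] at h3
    linarith
  have hyK : (2 - β) ^ K ≤ 3 * (12 * M) ^ (6 * (1 - β)) := by
    calc (2 - β) ^ K ≤ Real.exp (1 - β) ^ K := by
          gcongr
          · linarith
          · have := Real.add_one_le_exp (1 - β)
            linarith
      _ = Real.exp ((1 - β) * K) := by rw [← Real.exp_nat_mul]; congr 1; ring
      _ ≤ Real.exp (1 + Real.log (12 * M) * (6 * (1 - β))) := by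
          apply Real.exp_le_exp.2
          nlinarith
      _ = Real.exp 1 * (12 * M) ^ (6 * (1 - β)) := by
          rw [Real.exp_add, Real.rpow_def_of_pos h12]
      _ ≤ 3 * (12 * M) ^ (6 * (1 - β)) := by
          gcongr
          exact Real.exp_one_lt_three.le
  have hp : 0 < (12 * M) ^ (6 * (1 - β)) := Real.rpow_pos_of_pos h12 _
  have hl0 : 0 < (H 1).re := by
    by_contra h
    have := mul_nonneg (neg_nonneg.2 (not_lt.1 h)) hy0.le
    linarith
  rw [Real.rpow_neg h12.le, ← div_eq_mul_inv, div_le_iff₀ hp]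
  have := mul_le_mul_of_nonneg_left hyK hl0.le
  linarith

theorem ZMod.sum_range_add_one_eq_sum_univ {M : Type*} [AddCommMonoid M] {q : ℕ} [NeZero q]
    (f : ZMod q → M) : ∑ k ∈ Finset.range q, f ((k + 1 : ℕ) : ZMod q) = ∑ a, f a := by
  rw [← Equiv.sum_comp (Equiv.addRight (1 : ZMod q)) f]
  refine Finset.sum_nbij' (fun k ↦ (k : ZMod q)) ZMod.val (by simp) ?_ ?_ (by simp) ?_
  · intro a _
    simpa using ZMod.val_lt a
  · intro k hk
    exact ZMod.val_cast_of_lt (by simpa using hk)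
  · simp

/-- The sum of a periodic function over an initial segment of the positive integers. -/
theorem ZMod.sum_range_add_one_eq {M : Type*} [AddCommMonoid M] {q : ℕ} [NeZero q]
    (f : ZMod q → M) (n : ℕ) : ∑ k ∈ Finset.range n, f ((k + 1 : ℕ) : ZMod q) =
      (n / q) • ∑ a, f a + ∑ k ∈ Finset.range (n % q), f ((k + 1 : ℕ) : ZMod q) := by
  have h : ∀ t r : ℕ, ∑ k ∈ Finset.range (q * t + r), f ((k + 1 : ℕ) : ZMod q) =
      t • ∑ a, f a + ∑ k ∈ Finset.range r, f ((k + 1 : ℕ) : ZMod q) := by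
    intro t r
    induction t with
    | zero => simp
    | succ t ih =>
      rw [show q * (t + 1) + r = q + (q * t + r) by ring, Finset.sum_range_add,
        ZMod.sum_range_add_one_eq_sum_univ]
      have : ∀ k : ℕ, f ((q + k + 1 : ℕ) : ZMod q) = f ((k + 1 : ℕ) : ZMod q) := by
        intro k; congr 1; push_cast; simp
      simp_rw [this]
      rw [ih, succ_nsmul', add_assoc]
  conv_lhs => rw [← Nat.div_add_mod n q]
  exact h _ _

theorem sum_Icc_one_eq_sum_range_add_one {M : Type*} [AddCommMonoid M] (f : ℕ → M) (n : ℕ) :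
    ∑ k ∈ Finset.Icc 1 n, f k = ∑ k ∈ Finset.range n, f (k + 1) := by
  rw [Finset.range_eq_Ico, Finset.sum_Ico_add' f 0 n 1]
  rfl

theorem norm_sum_Icc_le_natCast {f : ℕ → ℂ} (hf : ∀ n, ‖f n‖ ≤ 1) (n : ℕ) :
    ‖∑ k ∈ Finset.Icc 1 n, f k‖ ≤ n := by
  refine (norm_sum_le_of_le _ fun k _ ↦ hf k).trans ?_
  simp

namespace DirichletCharacter

variable {q : ℕ} {χ : DirichletCharacter ℂ q}

theorem LSeriesSummable_natCast (χ : DirichletCharacter ℂ q) {s : ℂ} (hs : 1 < s.re) :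
    LSeriesSummable (fun n ↦ χ n) s :=
  LSeriesSummable_of_bounded_of_one_lt_re (m := 1) (fun n _ ↦ norm_le_one χ n) hs

theorem apply_eq_of_sq_eq_one (hχ : χ ^ 2 = 1) (a : ZMod q) : χ a = 0 ∨ χ a = 1 ∨ χ a = -1 :=
  MulChar.isQuadratic_iff_sq_eq_one.2 hχ a

theorem im_apply_eq_zero_of_sq_eq_one (hχ : χ ^ 2 = 1) (a : ZMod q) : (χ a).im = 0 := by
  rcases apply_eq_of_sq_eq_one hχ a with h | h | h <;> simp [h]

variable [NeZero q]

theorem norm_sum_Icc_le (hχ : χ ≠ 1) (n : ℕ) : ‖∑ k ∈ Finset.Icc 1 n, χ k‖ ≤ q := by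
  rw [sum_Icc_one_eq_sum_range_add_one (fun k ↦ χ k), ZMod.sum_range_add_one_eq,
    MulChar.sum_eq_zero_of_ne_one hχ, smul_zero, zero_add]
  refine (norm_sum_le_of_le _ fun k _ ↦ norm_le_one χ _).trans ?_
  simpa using (Nat.mod_lt n (NeZero.pos q)).le

theorem norm_LFunction_le_of_mem_sphere (hχ : χ ≠ 1) {s : ℂ}
    (hs : s ∈ Metric.sphere (2 : ℂ) (3 / 2)) : ‖LFunction χ s‖ ≤ 7 * q := by
  have hs' : ‖s - 2‖ = 3 / 2 := mem_sphere_iff_norm.1 hs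
  have hre : 1 / 2 ≤ s.re := by
    have := (abs_le.1 ((Complex.abs_re_le_norm (s - 2)).trans_eq hs')).1
    simp at this
    linarith
  have hnorm : ‖s‖ ≤ 7 / 2 := by
    calc ‖s‖ = ‖(s - 2) + 2‖ := by ring_nf
      _ ≤ ‖s - 2‖ + ‖(2 : ℂ)‖ := norm_add_le _ _
      _ = 7 / 2 := by rw [hs']; norm_num
  have := norm_le_of_norm_sum_le (differentiable_LFunction hχ)
    (fun _ ↦ LSeriesSummable_natCast χ) (fun _ ↦ LFunction_eq_LSeries χ)
    (Nat.cast_nonneg q) le_rfl one_pos le_rfl (fun n hn ↦ by simp [Nat.lt_one_iff.1 hn])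
    (fun n ↦ by simpa using norm_sum_Icc_le hχ n) (s := s) (by linarith)
  refine this.trans ?_
  simp only [Nat.cast_one, Real.one_rpow, mul_one, sub_zero]
  rw [div_le_iff₀ (by linarith)]
  have hq : (0 : ℝ) ≤ q := Nat.cast_nonneg q
  nlinarith

theorem norm_LFunction_one_le (hχ : χ ≠ 1) {η : ℝ} (hη : 0 < η) (hη1 : η ≤ 1) :
    ‖LFunction χ 1‖ ≤ (q : ℝ) ^ η / η := by
  have hq : (0 : ℝ) < q := by exact_mod_cast NeZero.pos q
  have := norm_le_of_norm_sum_le (differentiable_LFunction hχ)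
    (fun _ ↦ LSeriesSummable_natCast χ) (fun _ ↦ LFunction_eq_LSeries χ)
    (K := (q : ℝ) ^ η) (r := 1 - η) (by positivity) (by linarith) (by linarith) le_rfl
    (fun n hn ↦ by simp [Nat.lt_one_iff.1 hn])
    (fun n ↦ ?_) (s := 1) (by simpa using hη)
  · simpa using this
  · set S := ‖∑ k ∈ Finset.Icc 1 n, χ k‖
    have h1 : S ≤ q := norm_sum_Icc_le hχ n
    have h2 : S ≤ n := norm_sum_Icc_le_natCast (fun n ↦ norm_le_one χ n) n
    have h0 : 0 ≤ S := norm_nonneg _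
    calc S = S ^ η * S ^ (1 - η) := by
          rcases h0.eq_or_lt with h | h
          · rw [← h, Real.zero_rpow hη.ne', zero_mul]
          · rw [← Real.rpow_add h]; simp
      _ ≤ (q : ℝ) ^ η * (n : ℝ) ^ (1 - η) := by gcongr

end DirichletCharacter

open Complex in
theorem LSeries_ofReal_im_eq_zero {f : ℕ → ℂ} (hf : ∀ n, (f n).im = 0) {x : ℝ}
    (h : LSeriesSummable f x) : (LSeries f x).im = 0 := by
  rw [LSeries, im_tsum h]
  refine (tsum_congr fun n ↦ ?_).trans tsum_zero
  rw [LSeries.term]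
  split_ifs
  · simp
  · rw [← ofReal_natCast, ← ofReal_cpow (Nat.cast_nonneg n), div_ofReal_im, hf, zero_div]

open Complex in
theorem DirichletCharacter.LFunction_ofReal_im_eq_zero {q : ℕ} [NeZero q]
    {χ : DirichletCharacter ℂ q} (hχ2 : χ ^ 2 = 1) (hχ : χ ≠ 1) (x : ℝ) :
    (LFunction χ x).im = 0 := by
  refine im_eq_zero_of_forall_one_lt (differentiable_LFunction hχ) (fun y hy ↦ ?_) x
  rw [LFunction_eq_LSeries χ (by simpa using hy)]
  exact LSeries_ofReal_im_eq_zero (fun n ↦ im_apply_eq_zero_of_sq_eq_one hχ2 n)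
    (LSeriesSummable_natCast χ (by simpa using hy))

open Complex Filter Topology in
/-- The Riemann zeta function is real on the real axis, and negative just to the left of `1`. -/
theorem exists_forall_riemannZeta_neg : ∃ δ : ℝ, 0 < δ ∧ ∀ x : ℝ, 1 - δ < x → x < 1 →
    (riemannZeta x).im = 0 ∧ (riemannZeta x).re < 0 := by
  obtain ⟨E, hE, hE1, hEs⟩ := exists_differentiable_eq_sub_one_mul_riemannZeta
  have hne : ∀ x : ℝ, x ≠ 1 → (x : ℂ) ≠ 1 := fun x hx h ↦ hx (by exact_mod_cast h)
  have him : ∀ x : ℝ, (E x).im = 0 := by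
    refine fun x ↦ im_eq_zero_of_forall_one_lt hE (fun y hy ↦ ?_) x
    rw [hEs _ (hne y hy.ne'), show (y : ℂ) - 1 = ((y - 1 : ℝ) : ℂ) by push_cast; rfl,
      im_ofReal_mul, ← LSeries_one_eq_riemannZeta (by simpa using hy),
      LSeries_ofReal_im_eq_zero (by simp) ((LSeriesSummable_one_iff).2 (by simpa using hy)),
      mul_zero]
  have hcont : Tendsto (fun x : ℝ ↦ (E x).re) (𝓝 1) (𝓝 1) := by
    have h := (continuous_re.comp (hE.continuous.comp continuous_ofReal)).tendsto 1
    simpa [hE1, Function.comp_def] using h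
  obtain ⟨δ, hδ, h⟩ := Metric.eventually_nhds_iff.1 (hcont.eventually (lt_mem_nhds one_pos))
  refine ⟨δ, hδ, fun x hx hx1 ↦ ?_⟩
  have hpos : 0 < (E x).re := h (by rw [Real.dist_eq, abs_lt]; constructor <;> linarith)
  have hi := him x
  rw [hEs _ (hne x hx1.ne), show (x : ℂ) - 1 = ((x - 1 : ℝ) : ℂ) by push_cast; rfl] at hpos hi
  rw [im_ofReal_mul] at hi
  rw [re_ofReal_mul] at hpos
  have hx0 : x - 1 < 0 := by linarith
  refine ⟨(mul_eq_zero.1 hi).resolve_left hx0.ne, ?_⟩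
  by_contra hcon
  exact absurd (mul_nonpos_of_nonpos_of_nonneg hx0.le (not_lt.1 hcon)) (not_le.2 hpos)

open Complex ComplexOrder in
/-- **Estermann's inequality**, in terms of a bound on a sphere for `H`. -/
theorem exists_le_re_apply_one_of_re_nonpos : ∃ C : ℝ, 1 ≤ C ∧
    ∀ {a : ℕ → ℂ} {H : ℂ → ℂ} {B β : ℝ}, (∀ n, 0 ≤ (a n).re ∧ (a n).im = 0) → a 1 = 1 →
    (∀ s : ℂ, 1 < s.re → LSeriesSummable a s) → Differentiable ℂ H →
    (∀ s : ℂ, 1 < s.re → LSeries a s = riemannZeta s * H s) → 1 ≤ B →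
    (∀ s ∈ Metric.sphere (2 : ℂ) (3 / 2), ‖H s‖ ≤ B) → ‖H 1‖ ≤ B → 3 / 4 ≤ β → β < 1 →
    (riemannZeta β * H β).re ≤ 0 → (1 - β) / 6 * (C * B) ^ (-(6 * (1 - β))) ≤ (H 1).re := by
  have hs1 : ∀ s ∈ Metric.sphere (2 : ℂ) (3 / 2), 1 / 2 ≤ ‖s - 1‖ := by
    intro s hs
    have h1 : ‖s - 2‖ = 3 / 2 := mem_sphere_iff_norm.1 hs
    have h2 := norm_sub_le (s - 1) 1
    rw [show s - 1 - 1 = s - 2 by ring, h1, norm_one] at h2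
    linarith
  have hcont : ContinuousOn riemannZeta (Metric.sphere (2 : ℂ) (3 / 2)) := by
    intro s hs
    refine (differentiableAt_riemannZeta ?_).continuousAt.continuousWithinAt
    rintro rfl
    have := hs1 1 hs
    norm_num at this
  obtain ⟨C₀, hC₀⟩ := (isCompact_sphere (2 : ℂ) (3 / 2)).exists_bound_of_continuousOn hcont
  have hC : 1 ≤ max C₀ 0 + 2 := by have := le_max_right C₀ 0; linarith
  refine ⟨12 * (max C₀ 0 + 2), by linarith, ?_⟩
  intro a H B β ha ha1 hS hH hL hB hHB hH1 hβ hβ1 hneg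
  have ha' : 0 ≤ a := fun n ↦ Complex.le_def.2
    ⟨by simpa using (ha n).1, by simpa using (ha n).2.symm⟩
  rw [mul_assoc]
  refine le_re_apply_one_of_re_nonpos ha' ha1 hS hH hL
    (by nlinarith) (fun s hs ↦ ?_) hβ hβ1 hneg
  have h2 : ‖(s - 1)⁻¹‖ ≤ 2 := by
    rw [norm_inv]
    exact inv_le_of_inv_le₀ two_pos (by simpa using hs1 s hs)
  calc ‖riemannZeta s * H s - H 1 * (s - 1)⁻¹‖
      ≤ ‖riemannZeta s‖ * ‖H s‖ + ‖H 1‖ * ‖(s - 1)⁻¹‖ := by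
        rw [← norm_mul, ← norm_mul]; exact norm_sub_le _ _
    _ ≤ max C₀ 0 * B + B * 2 := by
        have := (hC₀ s hs).trans (le_max_left C₀ 0)
        have := hHB s hs
        gcongr
    _ = _ := by ring

theorem sum_range_two_mul_neg_one_pow_mul (c : ℤ) (n : ℕ) :
    ∑ j ∈ Finset.range (2 * n), (-1) ^ j * ((j + 1) * (c - j)) = 2 * n ^ 2 - c * n := by
  induction n with
  | zero => simp
  | succ n ih =>
    rw [show 2 * (n + 1) = 2 * n + 1 + 1 by ring, Finset.sum_range_succ, Finset.sum_range_succ, ih]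
    simp [pow_add, pow_mul]
    ring

theorem sum_range_mul_geom_sum_nonneg {x y : ℤ} (hx : x = 0 ∨ x = 1 ∨ x = -1)
    (hy : y = 0 ∨ y = 1 ∨ y = -1) (k : ℕ) :
    0 ≤ ∑ j ∈ Finset.range (k + 1), y ^ j * ((∑ i ∈ Finset.range (j + 1), x ^ i) *
      ∑ i ∈ Finset.range (k - j + 1), x ^ i) := by
  have h0 : ∀ j, 0 ≤ ∑ i ∈ Finset.range (j + 1), x ^ i := by
    intro j
    rcases hx with rfl | rfl | rfl
    · exact Finset.sum_nonneg fun i _ ↦ by positivity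
    · exact Finset.sum_nonneg fun i _ ↦ by positivity
    · rw [neg_one_geom_sum]; split_ifs <;> simp
  rcases hy with rfl | rfl | rfl
  · exact Finset.sum_nonneg fun j _ ↦ by have := h0 j; have := h0 (k - j); positivity
  · exact Finset.sum_nonneg fun j _ ↦ by have := h0 j; have := h0 (k - j); positivity
  rcases hx with rfl | rfl | rfl
  · have : ∀ j, ∑ i ∈ Finset.range (j + 1), (0 : ℤ) ^ i = 1 := fun j ↦ by
      simp [Finset.sum_range_succ']
    simp only [this, mul_one]
    rw [neg_one_geom_sum]; split_ifs <;> simp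
  · simp only [one_pow, Finset.sum_const, Finset.card_range, nsmul_eq_mul, mul_one]
    have h1 : ∀ j ∈ Finset.range (k + 1), (-1 : ℤ) ^ j * (((j + 1 : ℕ) : ℤ) * ((k - j + 1 : ℕ) : ℤ))
        = (-1) ^ j * ((j + 1) * ((k + 1 : ℤ) - j)) := by
      intro j hj
      have := Finset.mem_range.1 hj
      push_cast [Nat.cast_sub (show j ≤ k by omega)]
      ring
    rw [Finset.sum_congr rfl h1]
    obtain ⟨n, rfl | rfl⟩ := k.even_or_odd'
    · rw [Finset.sum_range_succ, sum_range_two_mul_neg_one_pow_mul]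
      simp [pow_mul]
      ring_nf
      positivity
    · rw [show 2 * n + 1 + 1 = 2 * (n + 1) by ring, sum_range_two_mul_neg_one_pow_mul]
      push_cast
      ring_nf
      rfl
  · refine Finset.sum_nonneg fun j _ ↦ ?_
    rw [neg_one_geom_sum (n := j + 1)]
    split_ifs with h
    · simp
    · have : Even j := by simpa [Nat.even_add_one] using h
      have h2 := h0 (k - j)
      rw [this.neg_one_pow]
      positivity

theorem ArithmeticFunction.mul_apply_prime_pow {R : Type*} [Semiring R]
    (f g : ArithmeticFunction R) {p : ℕ} (hp : p.Prime) (k : ℕ) :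
    (f * g) (p ^ k) = ∑ j ∈ Finset.range (k + 1), f (p ^ j) * g (p ^ (k - j)) := by
  rw [mul_apply, Nat.sum_divisorsAntidiagonal fun a b ↦ f a * g b, Nat.sum_divisors_prime_pow hp]
  refine Finset.sum_congr rfl fun j hj ↦ ?_
  rw [Nat.pow_div (by have := Finset.mem_range.1 hj; omega) hp.pos]

namespace DirichletCharacter

open ArithmeticFunction

variable {q : ℕ} {χ ψ : DirichletCharacter ℂ q}

theorem zetaMul_apply_prime_pow (χ : DirichletCharacter ℂ q) {p : ℕ} (hp : p.Prime) (k : ℕ) :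
    χ.zetaMul (p ^ k) = ∑ i ∈ Finset.range (k + 1), χ p ^ i := by
  simp [zetaMul_apply_eq_sum, Nat.sum_divisors_prime_pow hp]

/-- The Dirichlet coefficients of `ζ(s) L(s, χ) L(s, ψ) L(s, χψ)`. -/
noncomputable def zetaMulMul (χ ψ : DirichletCharacter ℂ q) : ArithmeticFunction ℂ :=
  toArithmeticFunction (ψ ·) * toArithmeticFunction ((χ * ψ) ·) * χ.zetaMul

theorem isMultiplicative_zetaMulMul (χ ψ : DirichletCharacter ℂ q) :
    (zetaMulMul χ ψ).IsMultiplicative :=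
  ((isMultiplicative_toArithmeticFunction ψ).mul
    (isMultiplicative_toArithmeticFunction (χ * ψ))).mul (isMultiplicative_zetaMul χ)

theorem zetaMulMul_apply_prime_pow (χ ψ : DirichletCharacter ℂ q) {p : ℕ} (hp : p.Prime) (k : ℕ) :
    zetaMulMul χ ψ (p ^ k) = ∑ j ∈ Finset.range (k + 1), ψ p ^ j *
      ((∑ i ∈ Finset.range (j + 1), χ p ^ i) * ∑ i ∈ Finset.range (k - j + 1), χ p ^ i) := by
  rw [zetaMulMul, mul_apply_prime_pow _ _ hp]
  refine Finset.sum_congr rfl fun j _ ↦ ?_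
  rw [zetaMul_apply_prime_pow χ hp, mul_apply_prime_pow _ _ hp, ← mul_assoc]
  congr 1
  rw [← Finset.sum_range_reflect, Finset.mul_sum]
  refine Finset.sum_congr rfl fun i hi ↦ ?_
  have hi' : i ≤ j := by have := Finset.mem_range.1 hi; omega
  have : j - (j - i) = i := by omega
  simp [toArithmeticFunction, hp.ne_zero, this]
  rw [mul_left_comm, ← pow_add, Nat.sub_add_cancel hi', mul_comm]

theorem exists_int_eq_of_sq_eq_one (hχ : χ ^ 2 = 1) (a : ZMod q) :
    ∃ x : ℤ, χ a = x ∧ (x = 0 ∨ x = 1 ∨ x = -1) := by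
  rcases apply_eq_of_sq_eq_one hχ a with h | h | h
  · exact ⟨0, by simpa using h, by simp⟩
  · exact ⟨1, by simpa using h, by simp⟩
  · exact ⟨-1, by simpa using h, by simp⟩

open scoped ComplexOrder in
theorem zetaMulMul_nonneg (hχ : χ ^ 2 = 1) (hψ : ψ ^ 2 = 1) (n : ℕ) : 0 ≤ zetaMulMul χ ψ n := by
  rcases eq_or_ne n 0 with rfl | hn
  · simp
  rw [(isMultiplicative_zetaMulMul χ ψ).multiplicative_factorization _ hn]
  refine Finset.prod_nonneg fun p hp ↦ ?_
  obtain ⟨x, hx, hx'⟩ := exists_int_eq_of_sq_eq_one hχ p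
  obtain ⟨y, hy, hy'⟩ := exists_int_eq_of_sq_eq_one hψ p
  beta_reduce
  rw [zetaMulMul_apply_prime_pow χ ψ (Nat.prime_of_mem_primeFactors hp), hx, hy]
  have := sum_range_mul_geom_sum_nonneg hx' hy' (n.factorization p)
  exact_mod_cast (Int.cast_nonneg (R := ℂ) this)

theorem LSeriesSummable_toArithmeticFunction (χ : DirichletCharacter ℂ q) {s : ℂ}
    (hs : 1 < s.re) : LSeriesSummable (toArithmeticFunction (χ ·)) s :=
  (LSeriesSummable_congr _ fun h ↦ (χ.apply_eq_toArithmeticFunction_apply h).symm).2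
    (LSeriesSummable_natCast χ hs)

theorem LSeriesSummable_zetaMulMul (χ ψ : DirichletCharacter ℂ q) {s : ℂ} (hs : 1 < s.re) :
    LSeriesSummable (zetaMulMul χ ψ) s :=
  ArithmeticFunction.LSeriesSummable_mul (ArithmeticFunction.LSeriesSummable_mul
    (LSeriesSummable_toArithmeticFunction ψ hs) (LSeriesSummable_toArithmeticFunction (χ * ψ) hs))
    (LSeriesSummable_zetaMul χ hs)

variable [NeZero q]

theorem LSeries_toArithmeticFunction (χ : DirichletCharacter ℂ q) {s : ℂ} (hs : 1 < s.re) :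
    LSeries (toArithmeticFunction (χ ·)) s = LFunction χ s := by
  rw [LFunction_eq_LSeries χ hs]
  exact (LSeries_congr χ.apply_eq_toArithmeticFunction_apply s).symm

theorem LSeries_zetaMul (χ : DirichletCharacter ℂ q) {s : ℂ} (hs : 1 < s.re) :
    LSeries χ.zetaMul s = riemannZeta s * LFunction χ s := by
  rw [zetaMul, ← coe_mul, LSeries_convolution', LSeries_toArithmeticFunction χ hs,
    ← LSeries_zeta_eq_riemannZeta hs]
  · simp_rw [← natCoe_apply]
  · exact LSeriesSummable_zeta_iff.mpr hs
  · exact LSeriesSummable_toArithmeticFunction χ hs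

theorem LSeries_zetaMulMul (χ ψ : DirichletCharacter ℂ q) {s : ℂ} (hs : 1 < s.re) :
    LSeries (zetaMulMul χ ψ) s =
      riemannZeta s * (LFunction χ s * LFunction ψ s * LFunction (χ * ψ) s) := by
  rw [zetaMulMul, ArithmeticFunction.LSeries_mul' (ArithmeticFunction.LSeriesSummable_mul
    (LSeriesSummable_toArithmeticFunction ψ hs) (LSeriesSummable_toArithmeticFunction (χ * ψ) hs))
    (LSeriesSummable_zetaMul χ hs),
    ArithmeticFunction.LSeries_mul' (LSeriesSummable_toArithmeticFunction ψ hs)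
    (LSeriesSummable_toArithmeticFunction (χ * ψ) hs), LSeries_toArithmeticFunction ψ hs,
    LSeries_toArithmeticFunction (χ * ψ) hs, LSeries_zetaMul χ hs]
  ring

end DirichletCharacter

namespace DirichletCharacter

open Complex Filter Topology

theorem re_mul_of_im_eq_zero {z w : ℂ} (hz : z.im = 0) : (z * w).re = z.re * w.re := by
  simp [hz]

open scoped ComplexOrder in
theorem exists_le_re_LFunction_one : ∃ δ C : ℝ, 0 < δ ∧ 1 ≤ C ∧
    ∀ {q : ℕ} [NeZero q] {χ : DirichletCharacter ℂ q}, χ ^ 2 = 1 → χ ≠ 1 → ∀ {β : ℝ}, 1 - δ < β →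
      3 / 4 ≤ β → β < 1 → 0 ≤ (LFunction χ β).re →
      (1 - β) / 6 * (C * q) ^ (-(6 * (1 - β))) ≤ (LFunction χ 1).re := by
  obtain ⟨δ, hδ, hζ⟩ := exists_forall_riemannZeta_neg
  obtain ⟨C, hC, h⟩ := exists_le_re_apply_one_of_re_nonpos
  refine ⟨δ, C * 7, hδ, by linarith, fun {q} _ {χ} hχ2 hχ {β} hβδ hβ hβ1 hL ↦ ?_⟩
  have hq : (1 : ℝ) ≤ q := by exact_mod_cast NeZero.one_le
  rw [mul_assoc]
  refine h (a := χ.zetaMul) (fun n ↦ ?_) ?_ (fun s hs ↦ LSeriesSummable_zetaMul χ hs)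
    (differentiable_LFunction hχ) (fun s hs ↦ LSeries_zetaMul χ hs) (by linarith)
    (fun s hs ↦ norm_LFunction_le_of_mem_sphere hχ hs) ?_ hβ hβ1 ?_
  · have := Complex.le_def.1 (zetaMul_nonneg hχ2 n)
    exact ⟨by simpa using this.1, by simpa using this.2.symm⟩
  · exact (isMultiplicative_zetaMul χ).map_one
  · have := norm_LFunction_one_le hχ one_pos le_rfl
    simp only [Real.rpow_one, div_one] at this
    linarith
  · obtain ⟨h1, h2⟩ := hζ β hβδ hβ1
    rw [re_mul_of_im_eq_zero h1]
    exact mul_nonpos_of_nonpos_of_nonneg h2.le hL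

open scoped ComplexOrder in
theorem exists_le_re_LFunction_one_mul : ∃ C : ℝ, 1 ≤ C ∧
    ∀ {q : ℕ} [NeZero q] {χ ψ : DirichletCharacter ℂ q}, χ ^ 2 = 1 → ψ ^ 2 = 1 → χ ≠ 1 → ψ ≠ 1 →
      χ * ψ ≠ 1 → ∀ {β : ℝ}, 3 / 4 ≤ β → β < 1 → LFunction χ β = 0 →
      (1 - β) / 6 * (C * q ^ 3) ^ (-(6 * (1 - β))) ≤
        (LFunction χ 1 * LFunction ψ 1 * LFunction (χ * ψ) 1).re := by
  obtain ⟨C, hC, h⟩ := exists_le_re_apply_one_of_re_nonpos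
  refine ⟨C * 343, by linarith, fun {q} _ {χ ψ} hχ2 hψ2 hχ hψ hχψ {β} hβ hβ1 hL ↦ ?_⟩
  have hq : (1 : ℝ) ≤ q := by exact_mod_cast NeZero.one_le
  have hq3 : (1 : ℝ) ≤ (q : ℝ) ^ 3 := one_le_pow₀ hq
  rw [mul_assoc C]
  refine h (a := zetaMulMul χ ψ) (H := fun s ↦ LFunction χ s * LFunction ψ s * LFunction (χ * ψ) s)
    (fun n ↦ ?_) ?_ (fun s hs ↦ LSeriesSummable_zetaMulMul χ ψ hs)
    (((differentiable_LFunction hχ).mul (differentiable_LFunction hψ)).mul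
      (differentiable_LFunction hχψ)) (fun s hs ↦ LSeries_zetaMulMul χ ψ hs) (by linarith)
    (fun s hs ↦ ?_) ?_ hβ hβ1 ?_
  · have := Complex.le_def.1 (zetaMulMul_nonneg hχ2 hψ2 n)
    exact ⟨by simpa using this.1, by simpa using this.2.symm⟩
  · exact (isMultiplicative_zetaMulMul χ ψ).map_one
  · rw [norm_mul, norm_mul]
    calc _ ≤ (7 * q : ℝ) * (7 * q) * (7 * q) := by
          gcongr <;> exact norm_LFunction_le_of_mem_sphere (by assumption) hs
      _ = 343 * q ^ 3 := by ring
  · rw [norm_mul, norm_mul]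
    have h1 : ∀ {φ : DirichletCharacter ℂ q}, φ ≠ 1 → ‖LFunction φ 1‖ ≤ q := fun hφ ↦ by
      simpa using norm_LFunction_one_le hφ one_pos le_rfl
    calc _ ≤ (q : ℝ) * q * q := by
          gcongr <;> exact h1 (by assumption)
      _ = q ^ 3 := by ring
      _ ≤ 343 * q ^ 3 := by linarith
  · simp [hL]

open scoped ComplexOrder in
theorem re_LFunction_one_pos {q : ℕ} [NeZero q] {χ : DirichletCharacter ℂ q} (hχ2 : χ ^ 2 = 1)
    (hχ : χ ≠ 1) : 0 < (LFunction χ 1).re := by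
  have him : (LFunction χ 1).im = 0 := by simpa using LFunction_ofReal_im_eq_zero hχ2 hχ 1
  obtain ⟨E, hE, hE1, hEs⟩ := exists_differentiable_eq_sub_one_mul_riemannZeta
  have hne : (LFunction χ 1).re ≠ 0 := fun h ↦
    LFunction_apply_one_ne_zero hχ (Complex.ext h him)
  refine lt_of_le_of_ne ?_ hne.symm
  have hcont : Tendsto (fun x : ℝ ↦ (E x * LFunction χ x).re) (𝓝[>] 1)
      (𝓝 (LFunction χ 1).re) := by
    have h := ((continuous_re.comp ((hE.continuous.mul
      (differentiable_LFunction hχ).continuous).comp continuous_ofReal)).tendsto 1).mono_left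
        (nhdsWithin_le_nhds (s := Set.Ioi 1))
    simpa [hE1, Function.comp_def] using h
  refine ge_of_tendsto hcont ?_
  filter_upwards [self_mem_nhdsWithin] with x hx
  have hx : (1 : ℝ) < x := hx
  have hx1 : (x : ℂ) ≠ 1 := fun h ↦ hx.ne' (by exact_mod_cast h)
  rw [hEs _ hx1, mul_assoc, ← LSeries_zetaMul χ (by simpa using hx),
    show (x : ℂ) - 1 = ((x - 1 : ℝ) : ℂ) by push_cast; rfl, re_ofReal_mul]
  refine mul_nonneg (by linarith) ?_
  have : 0 ≤ LSeries χ.zetaMul x :=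
    tsum_nonneg fun n ↦ LSeries.term_nonneg (zetaMul_nonneg hχ2 n) x
  simpa using (Complex.le_def.1 this).1

theorem exists_prod_one_sub_eq {q : ℕ} {χ : DirichletCharacter ℂ q} (hχ2 : χ ^ 2 = 1) (N : ℕ) :
    ∃ P : ℝ, ((2 : ℝ) ^ N.primeFactors.card)⁻¹ ≤ P ∧ P ≤ 2 ^ N.primeFactors.card ∧
      ∏ p ∈ N.primeFactors, (1 - χ p * (p : ℂ) ^ (-1 : ℂ)) = P := by
  have h : ∀ p ∈ N.primeFactors, |(χ p).re / p| ≤ 1 / 2 := by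
    intro p hp
    have hp2 : (2 : ℝ) ≤ p := by exact_mod_cast (Nat.prime_of_mem_primeFactors hp).two_le
    have h1 : |(χ p).re| ≤ 1 := (abs_re_le_norm _).trans (norm_le_one χ _)
    rw [abs_div, abs_of_pos (by linarith : (0 : ℝ) < p), div_le_div_iff₀ (by linarith) two_pos]
    linarith
  refine ⟨∏ p ∈ N.primeFactors, (1 - (χ p).re / p), ?_, ?_, ?_⟩
  · rw [← inv_pow, ← Finset.prod_const]
    refine Finset.prod_le_prod (fun p _ ↦ by norm_num) fun p hp ↦ ?_
    have := abs_le.1 (h p hp)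
    linarith
  · rw [← Finset.prod_const]
    refine Finset.prod_le_prod (fun p hp ↦ ?_) fun p hp ↦ ?_
    all_goals have := abs_le.1 (h p hp); linarith
  · push_cast
    refine Finset.prod_congr rfl fun p _ ↦ ?_
    rw [cpow_neg_one, div_eq_mul_inv]
    congr 2
    exact Complex.ext (by simp) (by simp [im_apply_eq_zero_of_sq_eq_one hχ2])

theorem re_LFunction_changeLevel_one {M N : ℕ} [NeZero M] [NeZero N] (hMN : M ∣ N)
    {χ : DirichletCharacter ℂ M} (hχ2 : χ ^ 2 = 1) (hχ : χ ≠ 1) :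
    (LFunction χ 1).re * ((2 : ℝ) ^ N.primeFactors.card)⁻¹ ≤
      (LFunction (changeLevel hMN χ) 1).re ∧
    (LFunction (changeLevel hMN χ) 1).re ≤ (LFunction χ 1).re * 2 ^ N.primeFactors.card := by
  obtain ⟨P, hP1, hP2, hP⟩ := exists_prod_one_sub_eq hχ2 N
  rw [LFunction_changeLevel hMN χ (Or.inl hχ), hP, re_mul_ofReal]
  have := (re_LFunction_one_pos hχ2 hχ).le
  constructor <;> gcongr

theorem exists_LFunction_eq_zero {q : ℕ} [NeZero q] {χ : DirichletCharacter ℂ q} (hχ2 : χ ^ 2 = 1)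
    (hχ : χ ≠ 1) {β : ℝ} (hβ : β < 1) (h : (LFunction χ β).re < 0) :
    ∃ x : ℝ, β < x ∧ x < 1 ∧ LFunction χ x = 0 := by
  have hcont : Continuous fun x : ℝ ↦ (LFunction χ x).re :=
    continuous_re.comp ((differentiable_LFunction hχ).continuous.comp continuous_ofReal)
  obtain ⟨x, hx, hx0⟩ := intermediate_value_Ioo hβ.le hcont.continuousOn
    (show (0 : ℝ) ∈ Set.Ioo _ _ from ⟨h, by simpa using re_LFunction_one_pos hχ2 hχ⟩)
  exact ⟨x, hx.1, hx.2, Complex.ext hx0 (LFunction_ofReal_im_eq_zero hχ2 hχ x)⟩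

end DirichletCharacter

namespace DirichletCharacter

open Complex

theorem exists_le_re_LFunction_one_of_eq_zero {ε : ℝ} (hε : 0 < ε) {β : ℝ} (hβ : 3 / 4 ≤ β)
    (hβ1 : β < 1) (hβε : 1 - β ≤ ε / 36) : ∃ c : ℝ, 0 < c ∧
    ∀ {q : ℕ} [NeZero q] {χ ψ : DirichletCharacter ℂ q}, χ ^ 2 = 1 → ψ ^ 2 = 1 → χ ≠ 1 → ψ ≠ 1 →
      χ * ψ ≠ 1 → LFunction χ β = 0 → c * (q : ℝ) ^ (-ε) ≤ (LFunction ψ 1).re := by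
  obtain ⟨C, hC, h⟩ := exists_le_re_LFunction_one_mul
  have hC0 : 0 < C := by linarith
  obtain ⟨η, hη0, hη1, hηε⟩ : ∃ η : ℝ, 0 < η ∧ η ≤ 1 ∧ 4 * η ≤ ε :=
    ⟨min (ε / 4) 1, by positivity, min_le_right _ _, by linarith [min_le_left (ε / 4) 1]⟩
  have hβ0 : 0 < 1 - β := by linarith
  refine ⟨(1 - β) / 6 * C ^ (-(6 * (1 - β))) * η ^ 2, by positivity,
    fun {q} _ {χ ψ} hχ2 hψ2 hχ hψ hχψ hL ↦ ?_⟩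
  have hq : (1 : ℝ) ≤ q := by exact_mod_cast NeZero.one_le
  have hq0 : (0 : ℝ) < q := by linarith
  have hmain := h hχ2 hψ2 hχ hψ hχψ hβ hβ1 hL
  have hpos := re_LFunction_one_pos hψ2 hψ
  have him : (LFunction ψ 1).im = 0 := by simpa using LFunction_ofReal_im_eq_zero hψ2 hψ 1
  have hnorm : ‖LFunction ψ 1‖ = (LFunction ψ 1).re := by
    rw [← abs_re_eq_norm.mpr him, abs_of_pos hpos]
  have hup : (LFunction χ 1 * LFunction ψ 1 * LFunction (χ * ψ) 1).re ≤
      ((q : ℝ) ^ η / η) * (LFunction ψ 1).re * ((q : ℝ) ^ η / η) := by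
    refine (re_le_norm _).trans ?_
    rw [norm_mul, norm_mul, hnorm]
    have h1 := norm_LFunction_one_le hχ hη0 hη1
    have h2 := norm_LFunction_one_le hχψ hη0 hη1
    gcongr
  have hsplit : (C * (q : ℝ) ^ 3) ^ (-(6 * (1 - β))) =
      C ^ (-(6 * (1 - β))) * (q : ℝ) ^ (-(18 * (1 - β))) := by
    rw [Real.mul_rpow hC0.le (by positivity), ← Real.rpow_natCast, ← Real.rpow_mul hq0.le]
    congr 2
    push_cast
    ring
  rw [hsplit] at hmain
  have hpow : (q : ℝ) ^ (-ε) * (q : ℝ) ^ η * (q : ℝ) ^ η ≤ (q : ℝ) ^ (-(18 * (1 - β))) := by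
    rw [← Real.rpow_add hq0, ← Real.rpow_add hq0]
    exact Real.rpow_le_rpow_of_exponent_le hq (by linarith)
  have hqη : 0 < (q : ℝ) ^ η := by positivity
  have hfin : (1 - β) / 6 * (C ^ (-(6 * (1 - β))) * ((q : ℝ) ^ (-ε) * (q : ℝ) ^ η * (q : ℝ) ^ η)) ≤
      ((q : ℝ) ^ η / η) * (LFunction ψ 1).re * ((q : ℝ) ^ η / η) :=
    (by gcongr : _ ≤ _).trans (hmain.trans hup)
  have e : ((q : ℝ) ^ η / η) * (LFunction ψ 1).re * ((q : ℝ) ^ η / η) =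
      ((q : ℝ) ^ η) ^ 2 * (LFunction ψ 1).re / η ^ 2 := by
    field_simp
  rw [e, le_div_iff₀ (by positivity)] at hfin
  refine le_of_mul_le_mul_left ?_ (by positivity : 0 < ((q : ℝ) ^ η) ^ 2)
  refine le_trans (le_of_eq ?_) hfin
  ring

/-- **Siegel's theorem** on the size of `L(1, χ)` for real Dirichlet characters. -/
theorem siegel {ε : ℝ} (hε : 0 < ε) : ∃ c : ℝ, 0 < c ∧ ∀ {q : ℕ} [NeZero q]
    {χ : DirichletCharacter ℂ q}, χ ^ 2 = 1 → χ ≠ 1 → c * (q : ℝ) ^ (-ε) ≤ (LFunction χ 1).re := by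
  obtain ⟨δ₀, C, hδ₀, hC, hbase⟩ := exists_le_re_LFunction_one
  have hC0 : 0 < C := by linarith
  obtain ⟨δ, hδ, hδ1, hδ2, hδ3⟩ : ∃ δ : ℝ, 0 < δ ∧ δ ≤ ε / 2 / 36 ∧ δ ≤ δ₀ / 2 ∧ δ ≤ 1 / 4 :=
    ⟨min (ε / 2 / 36) (min (δ₀ / 2) (1 / 4)), by positivity, min_le_left _ _,
      (min_le_right _ _).trans (min_le_left _ _), (min_le_right _ _).trans (min_le_right _ _)⟩
  by_cases hcase : ∀ {q : ℕ} [NeZero q] {χ : DirichletCharacter ℂ q}, χ ^ 2 = 1 → χ ≠ 1 →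
      0 ≤ (LFunction χ (1 - δ : ℝ)).re
  · refine ⟨δ / 6 * C ^ (-(6 * δ)), by positivity, fun {q} _ {χ} hχ2 hχ ↦ ?_⟩
    have hq : (1 : ℝ) ≤ q := by exact_mod_cast NeZero.one_le
    have h := hbase hχ2 hχ (β := 1 - δ) (by linarith) (by linarith) (by linarith) (hcase hχ2 hχ)
    rw [sub_sub_cancel, Real.mul_rpow hC0.le (by linarith), ← mul_assoc] at h
    refine le_trans ?_ h
    gcongr
    linarith
  · push Not at hcase
    obtain ⟨q₁, hq₁, χ₁, hχ₁2, hχ₁, hneg⟩ := hcase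
    obtain ⟨β, hβ, hβ1, hzero⟩ := exists_LFunction_eq_zero hχ₁2 hχ₁ (by linarith) hneg
    obtain ⟨c, hc, hA⟩ := exists_le_re_LFunction_one_of_eq_zero (half_pos hε) (β := β)
      (by linarith) hβ1 (by linarith)
    obtain ⟨W, hW, hω⟩ := two_pow_card_primeFactors_le_mul_rpow (half_pos hε)
    have hL₁ := re_LFunction_one_pos hχ₁2 hχ₁
    have hq₁0 : (0 : ℝ) < q₁ := by exact_mod_cast NeZero.pos q₁
    refine ⟨min (c / W) ((LFunction χ₁ 1).re / W ^ 2) * (q₁ : ℝ) ^ (-ε), by positivity,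
      fun {q₂} _ {χ₂} hχ₂2 hχ₂ ↦ ?_⟩
    have hq₂0 : (0 : ℝ) < q₂ := by exact_mod_cast NeZero.pos q₂
    have hd₁ : q₁ ∣ q₁ * q₂ := dvd_mul_right _ _
    have hd₂ : q₂ ∣ q₁ * q₂ := dvd_mul_left _ _
    have hψ₁2 : changeLevel hd₁ χ₁ ^ 2 = 1 := by rw [← map_pow, hχ₁2, map_one]
    have hψ₂2 : changeLevel hd₂ χ₂ ^ 2 = 1 := by rw [← map_pow, hχ₂2, map_one]
    have hψ₁ : changeLevel hd₁ χ₁ ≠ 1 := mt (changeLevel_eq_one_iff hd₁).mp hχ₁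
    have hψ₂ : changeLevel hd₂ χ₂ ≠ 1 := mt (changeLevel_eq_one_iff hd₂).mp hχ₂
    have hψ₁0 : LFunction (changeLevel hd₁ χ₁) β = 0 := by
      rw [LFunction_changeLevel hd₁ χ₁ (Or.inl hχ₁), hzero, zero_mul]
    have h₁ := (re_LFunction_changeLevel_one hd₁ hχ₁2 hχ₁).1
    have h₂ := (re_LFunction_changeLevel_one hd₂ hχ₂2 hχ₂).2
    have hωN := hω (q₁ * q₂) (NeZero.ne _)
    have hN0 : (0 : ℝ) < (q₁ * q₂ : ℕ) := by exact_mod_cast NeZero.pos (q₁ * q₂)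
    have hL₂ := re_LFunction_one_pos hχ₂2 hχ₂
    generalize hT : (2 : ℝ) ^ (q₁ * q₂).primeFactors.card = T at h₁ h₂ hωN
    have hT0 : 0 < T := by rw [← hT]; positivity
    generalize hP : ((q₁ * q₂ : ℕ) : ℝ) ^ (ε / 2) = P at hωN
    have hP0 : 0 < P := by rw [← hP]; positivity
    have hPinv : ((q₁ * q₂ : ℕ) : ℝ) ^ (-(ε / 2)) = P⁻¹ := by rw [Real.rpow_neg hN0.le, hP]
    have hPP : (q₁ : ℝ) ^ (-ε) * (q₂ : ℝ) ^ (-ε) = P⁻¹ * P⁻¹ := by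
      rw [← hPinv, ← Real.rpow_add hN0, ← Real.mul_rpow hq₁0.le hq₂0.le]
      push_cast
      congr 1
      ring
    rw [mul_assoc, hPP]
    by_cases hψ : changeLevel hd₁ χ₁ * changeLevel hd₂ χ₂ = 1
    · have heq : changeLevel hd₁ χ₁ = changeLevel hd₂ χ₂ := by
        rw [pow_two] at hψ₁2
        exact (mul_left_cancel (hψ.trans hψ₁2.symm)).symm
      rw [heq] at h₁
      have h : (LFunction χ₁ 1).re ≤ (LFunction χ₂ 1).re * T * T := by
        rw [← div_eq_mul_inv, div_le_iff₀ hT0] at h₁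
        exact h₁.trans (by gcongr)
      calc min (c / W) ((LFunction χ₁ 1).re / W ^ 2) * (P⁻¹ * P⁻¹)
          ≤ ((LFunction χ₁ 1).re / W ^ 2) * (P⁻¹ * P⁻¹) := by gcongr; exact min_le_right _ _
        _ = (LFunction χ₁ 1).re / ((W * P) * (W * P)) := by field_simp
        _ ≤ (LFunction χ₂ 1).re := by
          rw [div_le_iff₀ (by positivity)]
          refine h.trans ?_
          rw [mul_assoc]
          gcongr
    · have h := hA hψ₁2 hψ₂2 hψ₁ hψ₂ hψ hψ₁0
      rw [hPinv] at h
      calc min (c / W) ((LFunction χ₁ 1).re / W ^ 2) * (P⁻¹ * P⁻¹)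
          ≤ (c / W) * (P⁻¹ * P⁻¹) := by gcongr; exact min_le_left _ _
        _ = (c * P⁻¹) / (W * P) := by field_simp
        _ ≤ (LFunction χ₂ 1).re := by
          rw [div_le_iff₀ (by positivity)]
          refine (h.trans h₂).trans ?_
          gcongr

end DirichletCharacter

open ArithmeticFunction in
/-- The Dirichlet hyperbola method. -/
theorem ArithmeticFunction.sum_Ioc_mul_self_eq {R : Type*} [CommSemiring R]
    (f g : ArithmeticFunction R) (D : ℕ) :
    ∑ n ∈ Finset.Ioc 0 (D * D), (f * g) n =
      ∑ d ∈ Finset.Ioc 0 D, f d * ∑ e ∈ Finset.Ioc 0 (D * D / d), g e +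
      ∑ e ∈ Finset.Ioc 0 D, g e * ∑ d ∈ Finset.Ioc D (D * D / e), f d := by
  have hD : D ≤ D * D := Nat.le_mul_self D
  rw [sum_Ioc_mul_eq_sum_sum, ← Finset.Ioc_union_Ioc_eq_Ioc (Nat.zero_le D) hD,
    Finset.sum_union (Finset.Ioc_disjoint_Ioc_of_le le_rfl)]
  congr 1
  simp_rw [Finset.mul_sum]
  rw [Finset.sum_comm' (t' := Finset.Ioc 0 D) (s' := fun e ↦ Finset.Ioc D (D * D / e))]
  · simp_rw [mul_comm]
  · intro d e
    simp only [Finset.mem_Ioc]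
    constructor
    · rintro ⟨⟨h1, h2⟩, h3, h4⟩
      rw [Nat.le_div_iff_mul_le (by omega)] at h4
      refine ⟨⟨h1, ?_⟩, h3, ?_⟩
      · rw [Nat.le_div_iff_mul_le h3, mul_comm]; exact h4
      · by_contra! h
        nlinarith
    · rintro ⟨⟨h1, h2⟩, h3, h4⟩
      rw [Nat.le_div_iff_mul_le h3] at h2
      refine ⟨⟨h1, ?_⟩, h3, ?_⟩
      · nlinarith
      · rw [Nat.le_div_iff_mul_le (by omega), mul_comm]; exact h2

namespace DirichletCharacter

open Complex

variable {q : ℕ} [NeZero q] {χ : DirichletCharacter ℂ q}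

theorem norm_LFunction_one_sub_sum_le (hχ : χ ≠ 1) {D : ℕ} (hD : 0 < D) :
    ‖LFunction χ 1 - ∑ d ∈ Finset.Ioc 0 D, χ d / d‖ ≤ 2 * q / D := by
  have hS : ∀ s : ℂ, 1 < s.re → HasSum (LSeries.term (fun n ↦ if n ≤ D then 0 else χ n) s)
      (LFunction χ s - ∑ d ∈ Finset.Ioc 0 D, χ d / (d : ℂ) ^ s) := by
    intro s hs
    have h1 : HasSum (LSeries.term (χ ·) s) (LFunction χ s) := by
      rw [LFunction_eq_LSeries χ hs]
      exact (LSeriesSummable_natCast χ hs).LSeriesHasSum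
    have h2 : HasSum (fun n : ℕ ↦ if n ∈ Finset.Ioc 0 D then χ n / (n : ℂ) ^ s else 0)
        (∑ n ∈ Finset.Ioc 0 D, χ n / (n : ℂ) ^ s) := by
      rw [← Finset.sum_congr rfl fun n hn ↦ if_pos hn]
      exact hasSum_sum_of_ne_finset_zero fun n hn ↦ if_neg hn
    refine (h1.sub h2).congr_fun fun n ↦ ?_
    rcases eq_or_ne n 0 with rfl | hn
    · simp
    · by_cases h : n ≤ D <;> simp [LSeries.term_of_ne_zero, hn, h, Nat.pos_of_ne_zero hn]
  have h := norm_le_of_norm_sum_le (f := fun n ↦ if n ≤ D then 0 else χ n)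
    (F := fun s ↦ LFunction χ s - ∑ d ∈ Finset.Ioc 0 D, χ d / (d : ℂ) ^ s) (D := D + 1)
    (K := 2 * q) (r := 0) ?_ (fun s hs ↦ (hS s hs).summable) (fun s hs ↦ (hS s hs).tsum_eq.symm)
    (by positivity) le_rfl one_pos (by omega) (fun n hn ↦ ?_) (fun n ↦ ?_) (s := 1) (by simp)
  · simp only [cpow_one, norm_one, mul_one, one_re, sub_zero, div_one, zero_sub, Real.rpow_neg_one]
      at h
    refine h.trans ?_
    rw [← div_eq_mul_inv]
    gcongr
    simp
  · refine (differentiable_LFunction hχ).sub (Differentiable.fun_sum fun d hd ↦ ?_)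
    have : (d : ℂ) ≠ 0 := by exact_mod_cast (Finset.mem_Ioc.1 hd).1.ne'
    exact (differentiable_const _).div (differentiable_id.const_cpow (Or.inl this))
      fun s ↦ by simp [cpow_eq_zero_iff, this]
  · exact Finset.sum_eq_zero fun k hk ↦ if_pos (by have := Finset.mem_Icc.1 hk; omega)
  · rw [Real.rpow_zero, mul_one]
    have e : ∑ k ∈ Finset.Icc 1 n, (if k ≤ D then 0 else χ k) =
        ∑ k ∈ Finset.Icc 1 n, χ k - ∑ k ∈ Finset.Icc 1 (min n D), χ k := by
      have : Finset.Icc 1 (min n D) = {k ∈ Finset.Icc 1 n | k ≤ D} := by ext; simp; omega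
      rw [eq_sub_iff_add_eq, this, Finset.sum_filter, ← Finset.sum_add_distrib]
      exact Finset.sum_congr rfl fun k _ ↦ by split_ifs <;> simp
    rw [e, two_mul]
    exact (norm_sub_le _ _).trans (add_le_add (norm_sum_Icc_le hχ n) (norm_sum_Icc_le hχ _))

end DirichletCharacter

namespace DirichletCharacter

open Complex

variable {q : ℕ} [NeZero q] {χ : DirichletCharacter ℂ q}

theorem norm_sum_Ioc_one_sub_le (n : ℕ) :
    ‖∑ k ∈ Finset.Ioc 0 n, (1 : DirichletCharacter ℂ q) k - q.totient / q * n‖ ≤ 2 * q := by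
  have hq : (q : ℂ) ≠ 0 := by exact_mod_cast NeZero.ne q
  have h1 : ∑ k ∈ Finset.Ioc 0 n, (1 : DirichletCharacter ℂ q) k =
      (n / q : ℕ) * q.totient +
        ∑ k ∈ Finset.range (n % q), (1 : DirichletCharacter ℂ q) ((k + 1 : ℕ) : ZMod q) := by
    have := sum_Icc_one_eq_sum_range_add_one (fun k : ℕ ↦ (1 : DirichletCharacter ℂ q) k) n
    rw [ZMod.sum_range_add_one_eq (fun a ↦ (1 : DirichletCharacter ℂ q) a),
      MulChar.sum_one_eq_card_units, ZMod.card_units_eq_totient, nsmul_eq_mul] at this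
    exact this
  have h2 : (n : ℂ) = q * (n / q : ℕ) + (n % q : ℕ) := by exact_mod_cast (Nat.div_add_mod n q).symm
  have h3 : ((n % q : ℕ) : ℝ) ≤ q := by exact_mod_cast (Nat.mod_lt n (NeZero.pos q)).le
  have h4 : (q.totient : ℝ) ≤ q := by exact_mod_cast Nat.totient_le q
  have hq' : (0 : ℝ) < q := by exact_mod_cast NeZero.pos q
  have e : ∑ k ∈ Finset.Ioc 0 n, (1 : DirichletCharacter ℂ q) k - q.totient / q * n =
      ∑ k ∈ Finset.range (n % q), (1 : DirichletCharacter ℂ q) ((k + 1 : ℕ) : ZMod q) -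
        q.totient / q * (n % q : ℕ) := by
    rw [h1, h2]
    field_simp
    ring
  rw [e, two_mul]
  refine (norm_sub_le _ _).trans (add_le_add ?_ ?_)
  · refine (norm_sum_le_of_le _ fun k _ ↦ norm_le_one 1 _).trans ?_
    simpa using h3
  · rw [norm_mul, norm_div, Complex.norm_natCast, Complex.norm_natCast, Complex.norm_natCast]
    calc (q.totient : ℝ) / q * (n % q : ℕ) ≤ 1 * q := by
          gcongr
          exact (div_le_one hq').2 h4
      _ = q := one_mul _

theorem norm_sum_Ioc_le (hχ : χ ≠ 1) {D N : ℕ} (h : D ≤ N) :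
    ‖∑ k ∈ Finset.Ioc D N, χ k‖ ≤ 2 * q := by
  have e : ∑ k ∈ Finset.Ioc D N, χ k =
      ∑ k ∈ Finset.Ioc 0 N, χ k - ∑ k ∈ Finset.Ioc 0 D, χ k := by
    rw [eq_sub_iff_add_eq', Finset.sum_Ioc_consecutive _ (Nat.zero_le _) h]
  rw [e, two_mul]
  exact (norm_sub_le _ _).trans (add_le_add (norm_sum_Icc_le hχ N) (norm_sum_Icc_le hχ D))

theorem norm_sum_Ioc_mul_sub_le (hχ : χ ≠ 1) {D : ℕ} (hD : 0 < D) :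
    ‖∑ d ∈ Finset.Ioc 0 D, χ d * ∑ e ∈ Finset.Ioc 0 (D * D / d), (1 : DirichletCharacter ℂ q) e +
      ∑ e ∈ Finset.Ioc 0 D, (1 : DirichletCharacter ℂ q) e * ∑ d ∈ Finset.Ioc D (D * D / e), χ d -
      q.totient / q * D ^ 2 * LFunction χ 1‖ ≤ 7 * q * D := by
  have hq : (1 : ℝ) ≤ q := by exact_mod_cast NeZero.one_le
  have hD0 : (0 : ℝ) < D := by exact_mod_cast hD
  have hφ : ‖(q.totient : ℂ) / q‖ ≤ 1 := by
    rw [norm_div, Complex.norm_natCast, Complex.norm_natCast, div_le_one (by linarith)]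
    exact_mod_cast Nat.totient_le q
  have h1 : ∀ d ∈ Finset.Ioc 0 D, ‖χ d * (∑ e ∈ Finset.Ioc 0 (D * D / d),
      (1 : DirichletCharacter ℂ q) e - q.totient / q * D ^ 2 / d)‖ ≤ 3 * q := by
    intro d hd
    have hd0 : (0 : ℝ) < d := by exact_mod_cast (Finset.mem_Ioc.1 hd).1
    have hfloor : ‖((D * D / d : ℕ) : ℂ) - D ^ 2 / d‖ ≤ 1 := by
      have : ((D * D / d : ℕ) : ℂ) - D ^ 2 / d =
          ((⌊((D * D : ℕ) / d : ℝ)⌋₊ - (D * D : ℕ) / d : ℝ) : ℂ) := by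
        rw [Nat.floor_div_eq_div]
        push_cast
        ring
      rw [this, norm_real, Real.norm_eq_abs, abs_le]
      have h := Nat.floor_le (by positivity : (0 : ℝ) ≤ (D * D : ℕ) / d)
      have h' := Nat.lt_floor_add_one ((D * D : ℕ) / d : ℝ)
      constructor <;> linarith
    rw [norm_mul]
    have e : ∑ e ∈ Finset.Ioc 0 (D * D / d), (1 : DirichletCharacter ℂ q) e -
        q.totient / q * D ^ 2 / d =
        (∑ e ∈ Finset.Ioc 0 (D * D / d), (1 : DirichletCharacter ℂ q) e -
          q.totient / q * (D * D / d : ℕ)) +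
          q.totient / q * (((D * D / d : ℕ) : ℂ) - D ^ 2 / d) := by ring
    have hb : ‖∑ e ∈ Finset.Ioc 0 (D * D / d), (1 : DirichletCharacter ℂ q) e -
        q.totient / q * D ^ 2 / d‖ ≤ 2 * q + 1 * 1 := by
      rw [e]
      refine (norm_add_le _ _).trans (add_le_add (norm_sum_Ioc_one_sub_le _) ?_)
      rw [norm_mul]
      gcongr
    calc _ ≤ 1 * (2 * (q : ℝ) + 1 * 1) := by
          gcongr
          exact norm_le_one χ _
      _ ≤ 3 * q := by linarith
  have h2 : ∀ e ∈ Finset.Ioc 0 D,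
      ‖(1 : DirichletCharacter ℂ q) e * ∑ d ∈ Finset.Ioc D (D * D / e), χ d‖ ≤ 2 * q := by
    intro e he
    have he' := Finset.mem_Ioc.1 he
    rw [norm_mul]
    calc _ ≤ 1 * (2 * (q : ℝ)) := by
          gcongr
          · exact norm_le_one 1 _
          · refine norm_sum_Ioc_le hχ ?_
            rw [Nat.le_div_iff_mul_le he'.1]
            gcongr
            exact he'.2
      _ = 2 * q := one_mul _
  have h3 : ‖q.totient / q * (D : ℂ) ^ 2 * (LFunction χ 1 - ∑ d ∈ Finset.Ioc 0 D, χ d / d)‖ ≤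
      2 * q * D := by
    rw [norm_mul, norm_mul, norm_pow, Complex.norm_natCast]
    calc _ ≤ 1 * (D : ℝ) ^ 2 * (2 * q / D) := by
          gcongr
          exact norm_LFunction_one_sub_sum_le hχ hD
      _ = 2 * q * D := by field_simp
  have e : ∑ d ∈ Finset.Ioc 0 D, χ d * ∑ e ∈ Finset.Ioc 0 (D * D / d),
        (1 : DirichletCharacter ℂ q) e +
      ∑ e ∈ Finset.Ioc 0 D, (1 : DirichletCharacter ℂ q) e * ∑ d ∈ Finset.Ioc D (D * D / e), χ d -
      q.totient / q * D ^ 2 * LFunction χ 1 =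
      ∑ d ∈ Finset.Ioc 0 D, χ d * (∑ e ∈ Finset.Ioc 0 (D * D / d),
        (1 : DirichletCharacter ℂ q) e - q.totient / q * D ^ 2 / d) +
      ∑ e ∈ Finset.Ioc 0 D, (1 : DirichletCharacter ℂ q) e * ∑ d ∈ Finset.Ioc D (D * D / e), χ d -
      q.totient / q * (D : ℂ) ^ 2 * (LFunction χ 1 - ∑ d ∈ Finset.Ioc 0 D, χ d / d) := by
    simp_rw [mul_sub, Finset.sum_sub_distrib, Finset.mul_sum]
    rw [show ∑ d ∈ Finset.Ioc 0 D, χ d * (q.totient / q * (D : ℂ) ^ 2 / d) =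
      ∑ d ∈ Finset.Ioc 0 D, q.totient / q * (D : ℂ) ^ 2 * (χ d / d) from
        Finset.sum_congr rfl fun d _ ↦ by ring]
    ring
  rw [e]
  refine (norm_sub_le _ _).trans ?_
  refine (add_le_add ((norm_add_le _ _).trans (add_le_add (norm_sum_le_of_le _ h1)
    (norm_sum_le_of_le _ h2))) h3).trans ?_
  simp only [Finset.sum_const, Nat.card_Ioc, tsub_zero, nsmul_eq_mul]
  linarith

end DirichletCharacter

theorem Nat.inv_two_pow_card_primeFactors_le_totient_div (n : ℕ) [NeZero n] :
    ((2 : ℝ) ^ n.primeFactors.card)⁻¹ ≤ n.totient / n := by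
  have h : (n.totient : ℝ) = n * ∏ p ∈ n.primeFactors, (1 - (p : ℝ)⁻¹) := by
    have := congrArg (Rat.cast (K := ℝ)) n.totient_eq_mul_prod_factors
    push_cast at this
    exact this
  have hn : (n : ℝ) ≠ 0 := by exact_mod_cast NeZero.ne n
  rw [h, mul_div_cancel_left₀ _ hn, ← inv_pow, ← Finset.prod_const]
  refine Finset.prod_le_prod (fun _ _ ↦ by positivity) fun p hp ↦ ?_
  have hp2 : (2 : ℝ) ≤ p := by exact_mod_cast (Nat.prime_of_mem_primeFactors hp).two_le
  have : (p : ℝ)⁻¹ ≤ 2⁻¹ := inv_anti₀ two_pos hp2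
  linarith

namespace DirichletCharacter

open Complex

variable {q : ℕ} {χ : DirichletCharacter ℂ q}

theorem norm_zetaMul_le (n : ℕ) : ‖χ.zetaMul n‖ ≤ n.divisors.card := by
  rw [zetaMul_apply_eq_sum]
  refine (norm_sum_le_of_le _ fun d _ ↦ norm_le_one χ _).trans ?_
  simp

theorem toArithmeticFunction_mul_one_apply (n : ℕ) :
    (toArithmeticFunction (χ ·) * toArithmeticFunction ((1 : DirichletCharacter ℂ q) ·)) n =
      if n.Coprime q then χ.zetaMul n else 0 := by
  have h : ∀ x ∈ n.divisorsAntidiagonal, toArithmeticFunction (χ ·) x.1 *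
      toArithmeticFunction ((1 : DirichletCharacter ℂ q) ·) x.2 =
      if n.Coprime q then χ x.1 else 0 := by
    rintro ⟨a, b⟩ hx
    obtain ⟨rfl, hn⟩ := Nat.mem_divisorsAntidiagonal.1 hx
    obtain ⟨ha, hb⟩ := mul_ne_zero_iff.1 hn
    simp only [toArithmeticFunction, ArithmeticFunction.coe_mk, ha, hb, if_false,
      Nat.coprime_mul_iff_left]
    by_cases hcb : b.Coprime q
    · rw [MulChar.one_apply ((ZMod.isUnit_iff_coprime _ _).2 hcb), mul_one]
      by_cases hca : a.Coprime q
      · simp [hca, hcb]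
      · simp [hca, MulChar.map_nonunit _ (mt (ZMod.isUnit_iff_coprime _ _).1 hca)]
    · simp [hcb, MulChar.map_nonunit _ (mt (ZMod.isUnit_iff_coprime _ _).1 hcb)]
  rw [ArithmeticFunction.mul_apply, Finset.sum_congr rfl h]
  split_ifs
  · rw [zetaMul_apply_eq_sum, Nat.sum_divisorsAntidiagonal (fun a _ ↦ χ a)]
  · simp

theorem le_sum_norm_zetaMul [NeZero q] (hχ : χ ≠ 1) {D : ℕ} (hD : 0 < D) :
    q.totient / q * D ^ 2 * (LFunction χ 1).re - 7 * q * D ≤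
      ∑ n ∈ Finset.Ioc 0 (D * D), if n.Coprime q then ‖χ.zetaMul n‖ else 0 := by
  have h := norm_sum_Ioc_mul_sub_le hχ hD
  have hconv := ArithmeticFunction.sum_Ioc_mul_self_eq (toArithmeticFunction (χ ·))
    (toArithmeticFunction ((1 : DirichletCharacter ℂ q) ·)) D
  have hto : ∀ (ψ : DirichletCharacter ℂ q) (a b : ℕ),
      ∑ d ∈ Finset.Ioc a b, toArithmeticFunction (ψ ·) d = ∑ d ∈ Finset.Ioc a b, ψ d :=
    fun ψ a b ↦ Finset.sum_congr rfl fun d hd ↦ (ψ.apply_eq_toArithmeticFunction_apply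
      (by have := (Finset.mem_Ioc.1 hd).1; omega)).symm
  have hto' : ∀ (ψ : DirichletCharacter ℂ q) (F : ℕ → ℂ),
      ∑ d ∈ Finset.Ioc 0 D, toArithmeticFunction (ψ ·) d * F d =
        ∑ d ∈ Finset.Ioc 0 D, ψ d * F d :=
    fun ψ F ↦ Finset.sum_congr rfl fun d hd ↦ by
      rw [ψ.apply_eq_toArithmeticFunction_apply (by have := (Finset.mem_Ioc.1 hd).1; omega)]
  simp_rw [toArithmeticFunction_mul_one_apply, hto, hto'] at hconv
  rw [← hconv] at h
  have hre := (abs_le.1 ((abs_re_le_norm _).trans h)).1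
  have hval : ((q.totient : ℂ) / q * D ^ 2 * LFunction χ 1).re =
      q.totient / q * D ^ 2 * (LFunction χ 1).re := by
    rw [← re_ofReal_mul]
    push_cast
    rfl
  rw [sub_re, hval] at hre
  have hle : (∑ n ∈ Finset.Ioc 0 (D * D), if n.Coprime q then χ.zetaMul n else 0).re ≤
      ∑ n ∈ Finset.Ioc 0 (D * D), if n.Coprime q then ‖χ.zetaMul n‖ else 0 := by
    rw [re_sum]
    refine Finset.sum_le_sum fun n _ ↦ ?_
    split_ifs
    · exact re_le_norm _
    · simp
  linarith

open Finset in
/-- For a quadratic character `χ` modulo `q`, the function `∑ d ∣ n, χ d` is nonzero for a large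
proportion of the `n` coprime to `q` up to some bound polynomial in `q`. -/
theorem exists_le_card_zetaMul_ne_zero {ε : ℝ} (hε : 0 < ε) : ∃ c : ℝ, 0 < c ∧ ∀ {q : ℕ} [NeZero q]
    {χ : DirichletCharacter ℂ q}, χ ^ 2 = 1 → χ ≠ 1 → ∃ X : ℕ, q ≤ X ∧
      c * (q : ℝ) ^ (-ε) * X ≤ #{n ∈ Ioc 0 X | n.Coprime q ∧ χ.zetaMul n ≠ 0} := by
  have he : 0 < ε / 8 := by positivity
  obtain ⟨c₀, hc₀, hS₀⟩ := siegel one_pos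
  obtain ⟨c₁, hc₁, hS₁⟩ := siegel he
  obtain ⟨W, hW, hω⟩ := two_pow_card_primeFactors_le_mul_rpow he
  obtain ⟨C, hC, hdiv⟩ := card_divisors_le_mul_rpow he
  set K : ℝ := 14 / c₀ + 1 with hK
  have hK1 : 1 < K := by rw [hK]; linarith [div_pos (by norm_num : (0 : ℝ) < 14) hc₀]
  refine ⟨c₁ / W / (2 * C * ((K + 1) ^ 2) ^ (ε / 8)), by positivity, fun {q} _ {χ} hχ2 hχ ↦ ?_⟩
  have hq1 : (1 : ℝ) ≤ q := by exact_mod_cast NeZero.one_le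
  have hq0 : (0 : ℝ) < q := by linarith
  have hq3 : (1 : ℝ) ≤ (q : ℝ) ^ 3 := one_le_pow₀ hq1
  obtain ⟨D, hDK, hDK'⟩ : ∃ D : ℕ, K * q ^ 3 ≤ D ∧ (D : ℝ) ≤ (K + 1) * q ^ 3 :=
    ⟨⌈K * (q : ℝ) ^ 3⌉₊, Nat.le_ceil _, by
      linarith [Nat.ceil_lt_add_one (by positivity : 0 ≤ K * (q : ℝ) ^ 3)]⟩
  have hD0 : (0 : ℝ) < D := lt_of_lt_of_le (by positivity) hDK
  have hD : 0 < D := by exact_mod_cast hD0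
  have hqD : (q : ℝ) ≤ D := by
    have : (q : ℝ) ≤ (q : ℝ) ^ 3 := le_self_pow₀ hq1 (by norm_num)
    nlinarith
  have hqD' : q ≤ D := by exact_mod_cast hqD
  refine ⟨D * D, hqD'.trans (Nat.le_mul_self D), ?_⟩
  set A : ℝ := q.totient / q * (LFunction χ 1).re with hA
  have hLpos := re_LFunction_one_pos hχ2 hχ
  have hA₀ : c₀ * ((q : ℝ) ^ 2)⁻¹ ≤ A := by
    have h1 : (q : ℝ)⁻¹ ≤ q.totient / q := by
      rw [inv_eq_one_div]
      gcongr
      exact_mod_cast Nat.totient_pos.2 (NeZero.pos q)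
    have h2 := hS₀ hχ2 hχ
    rw [Real.rpow_neg_one] at h2
    calc c₀ * ((q : ℝ) ^ 2)⁻¹ = (q : ℝ)⁻¹ * (c₀ * (q : ℝ)⁻¹) := by field_simp
      _ ≤ A := by rw [hA]; gcongr
  have hA₁ : c₁ / W * ((q : ℝ) ^ (-(ε / 8))) ^ 2 ≤ A := by
    have h1 := Nat.inv_two_pow_card_primeFactors_le_totient_div q
    have h2 := hω q (NeZero.ne q)
    have h3 : W⁻¹ * (q : ℝ) ^ (-(ε / 8)) ≤ q.totient / q := by
      refine le_trans ?_ h1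
      rw [Real.rpow_neg hq0.le, ← mul_inv]
      exact inv_anti₀ (by positivity) h2
    calc c₁ / W * ((q : ℝ) ^ (-(ε / 8))) ^ 2
        = (W⁻¹ * (q : ℝ) ^ (-(ε / 8))) * (c₁ * (q : ℝ) ^ (-(ε / 8))) := by field_simp
      _ ≤ A := by rw [hA]; gcongr; exact hS₁ hχ2 hχ
  have hApos : 0 < A := by rw [hA]; have := Nat.totient_pos.2 (NeZero.pos q); positivity
  have hmain := le_sum_norm_zetaMul hχ hD
  have herr : 7 * (q : ℝ) * D ≤ A * D ^ 2 / 2 := by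
    have h1 : 14 * (q : ℝ) ≤ A * D := by
      calc 14 * (q : ℝ) = c₀ * ((q : ℝ) ^ 2)⁻¹ * (14 / c₀ * q ^ 3) := by field_simp
        _ ≤ A * D := by
          gcongr
          refine le_trans ?_ hDK
          gcongr
          rw [hK]; linarith
    nlinarith
  set B := {n ∈ Ioc 0 (D * D) | n.Coprime q ∧ χ.zetaMul n ≠ 0} with hB
  have hX0 : (0 : ℝ) < (D * D : ℕ) := by positivity
  have hsum : ∑ n ∈ Ioc 0 (D * D), (if n.Coprime q then ‖χ.zetaMul n‖ else 0) ≤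
      B.card * (C * ((D * D : ℕ) : ℝ) ^ (ε / 8)) := by
    rw [← nsmul_eq_mul, ← Finset.sum_const, hB, Finset.sum_filter]
    refine Finset.sum_le_sum fun n hn ↦ ?_
    have hn' := Finset.mem_Ioc.1 hn
    have hbound : ‖χ.zetaMul n‖ ≤ C * ((D * D : ℕ) : ℝ) ^ (ε / 8) := by
      refine (norm_zetaMul_le n).trans ((hdiv n (by omega)).trans ?_)
      gcongr
      exact hn'.2
    by_cases h : n.Coprime q
    · rw [if_pos h]
      by_cases h0 : χ.zetaMul n = 0
      · rw [if_neg (fun h' ↦ h'.2 h0), h0, norm_zero]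
      · rwa [if_pos ⟨h, h0⟩]
    · rw [if_neg h, if_neg fun h' ↦ h h'.1]
  have hXle : ((D * D : ℕ) : ℝ) ^ (ε / 8) ≤
      ((K + 1) ^ 2) ^ (ε / 8) * ((q : ℝ) ^ (ε / 8)) ^ 6 := by
    have : ((q : ℝ) ^ (ε / 8)) ^ 6 = ((q : ℝ) ^ 6) ^ (ε / 8) := by
      rw [← Real.rpow_natCast, ← Real.rpow_natCast, ← Real.rpow_mul hq0.le,
        ← Real.rpow_mul hq0.le, mul_comm]
    rw [this, ← Real.mul_rpow (by positivity) (by positivity)]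
    gcongr
    push_cast
    calc (D : ℝ) * D ≤ ((K + 1) * q ^ 3) * ((K + 1) * q ^ 3) := by gcongr
      _ = (K + 1) ^ 2 * q ^ 6 := by ring
  have hqε : (q : ℝ) ^ (-ε) = ((q : ℝ) ^ (-(ε / 8))) ^ 2 * (((q : ℝ) ^ (ε / 8)) ^ 6)⁻¹ := by
    rw [← Real.rpow_natCast, ← Real.rpow_natCast, ← Real.rpow_mul hq0.le, ← Real.rpow_mul hq0.le,
      ← Real.rpow_neg hq0.le, ← Real.rpow_add hq0]
    congr 1
    push_cast
    ring
  have hfin : A * ((D * D : ℕ) : ℝ) / 2 ≤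
      B.card * (C * (((K + 1) ^ 2) ^ (ε / 8) * ((q : ℝ) ^ (ε / 8)) ^ 6)) := by
    have h1 : A * ((D * D : ℕ) : ℝ) = q.totient / q * D ^ 2 * (LFunction χ 1).re := by
      rw [hA]; push_cast; ring
    have h2 : A * (D : ℝ) ^ 2 = q.totient / q * D ^ 2 * (LFunction χ 1).re := by
      rw [hA]; ring
    have h3 : (B.card : ℝ) * (C * ((D * D : ℕ) : ℝ) ^ (ε / 8)) ≤
      B.card * (C * (((K + 1) ^ 2) ^ (ε / 8) * ((q : ℝ) ^ (ε / 8)) ^ 6)) := by gcongr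
    linarith
  rw [hqε]
  have hT : 0 < ((K + 1) ^ 2) ^ (ε / 8) := by positivity
  have hU : 0 < ((q : ℝ) ^ (ε / 8)) ^ 6 := by positivity
  calc _ = (c₁ / W * ((q : ℝ) ^ (-(ε / 8))) ^ 2 * ((D * D : ℕ) : ℝ) / 2) /
        (C * (((K + 1) ^ 2) ^ (ε / 8) * ((q : ℝ) ^ (ε / 8)) ^ 6)) := by field_simp
    _ ≤ (A * ((D * D : ℕ) : ℝ) / 2) /
        (C * (((K + 1) ^ 2) ^ (ε / 8) * ((q : ℝ) ^ (ε / 8)) ^ 6)) := by gcongr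
    _ ≤ B.card := by rwa [div_le_iff₀ (by positivity)]

end DirichletCharacter

theorem stmt7 (ε : ℝ) (hε : 0 < ε) :
    ∃ c : ℝ, 0 < c ∧
      ∀ (s m : ℕ), 0 < m → ¬ (4 ∣ m) → m % 8 ≠ 7 →
        c * (m : ℝ) ^ ((1 : ℝ) / 2 - ε) ≤ (r3 (((4 ^ s * m : ℕ) : ℤ)) : ℝ) := by
  obtain ⟨c, hc, h⟩ := DirichletCharacter.exists_le_card_zetaMul_ne_zero hε
  refine ⟨c * 4 ^ (-ε) / 48, by positivity, fun s m hm h4 h7 ↦ ?_⟩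
  rw [r3_four_pow_mul]
  have hm0 : (0 : ℝ) < m := by exact_mod_cast hm
  have : NeZero (4 * m) := ⟨by omega⟩
  obtain ⟨χ, hχ2, hχ, hJ⟩ := exists_character_eq_jacobiSym hm h4
  obtain ⟨x, y, z, hxyz, hprim⟩ := sum_three_sq_primitive hm h4 h7
  obtain ⟨X, hqX, hX⟩ := h hχ2 hχ
  have hmX : (m : ℝ) ≤ X := by exact_mod_cast (by omega : m ≤ X)
  have hX0 : (0 : ℝ) < X := hm0.trans_le hmX
  have hcard := card_le_mul_r3 hm hxyz hprim hmX
      {n ∈ Finset.Ioc 0 X | n.Coprime (4 * m) ∧ χ.zetaMul n ≠ 0} fun n hn ↦ by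
    obtain ⟨hnX, hcop, hne⟩ := Finset.mem_filter.1 hn
    have hodd : n % 2 = 1 := by
      exact Nat.odd_iff.1 (Nat.coprime_two_right.1
        (Nat.Coprime.coprime_dvd_right (by omega : 2 ∣ 4 * m) hcop))
    have hcop' : n.Coprime m := Nat.Coprime.coprime_dvd_right (dvd_mul_left m 4) hcop
    refine ⟨by exact_mod_cast (Finset.mem_Ioc.1 hnX).2, hodd, hcop', ?_⟩
    exact exists_sq_mul_of_zetaMul_ne_zero
      (fun p hp hp2 ↦ hJ p (hp.eq_two_or_odd.resolve_left hp2)) hodd hcop' hne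
  have hle := hX.trans hcard
  rw [Real.sqrt_eq_rpow] at hle
  have hpow : ((4 * m : ℕ) : ℝ) ^ (-ε) = 4 ^ (-ε) * (m : ℝ) ^ (-ε) := by
    push_cast
    exact Real.mul_rpow (by norm_num) hm0.le
  have hsub : (m : ℝ) ^ ((1 : ℝ) / 2 - ε) = (m : ℝ) ^ ((1 : ℝ) / 2) * (m : ℝ) ^ (-ε) := by
    rw [← Real.rpow_add hm0, sub_eq_add_neg]
  rw [hpow] at hle
  rw [hsub]
  have hP : 0 < (m : ℝ) ^ ((1 : ℝ) / 2) := by positivity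
  refine le_of_mul_le_mul_left ?_ (by positivity : 0 < 48 * (X / (m : ℝ) ^ ((1 : ℝ) / 2)))
  refine le_trans (le_of_eq ?_) hle
  field_simp
end
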